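/- For n ∈ ℤ∖{0} and u ∈ 𝒞^δ_0, let w = 𝒦_{n,1}u (which is differentiable on (0,∞)) and define 𝒦_n u = (2μ−1)[ L_{n,+}^{−1}( β ↦ −βw'(β) + (inβ − 1)w(β) ) + L_{n,+}^{−1}(𝒦_{n,2}u) + L_{n,+}^{−1}(𝒦_{n,3}u) ]. Then for every n ∈ ℤ∖{0}, the map id + 𝒦_n : 𝒞^δ_0 → 𝒞^δ_0 is a bijection, and there is a constant C = C(μ, δ, η), independent of n, such that for every v ∈ 𝒞^δ_0 the unique u ∈ 𝒞^δ_0 with u + 𝒦_n u = v satisfies ‖u‖_{𝒞^δ} ≤ C‖v‖_{𝒞^δ}. -/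

import Mathlib

open Filter Topology Set MeasureTheory intervalIntegral

/-- sup norm over `[0,∞)`. -/
noncomputable def supN (f : ℝ → ℂ) : ℝ := ⨆ β : Ici (0 : ℝ), ‖f (β : ℝ)‖

/-- weighted seminorm `sup_{β>0} β^δ ‖f(β) − L‖`. -/
noncomputable def hoel (δ : ℝ) (f : ℝ → ℂ) (L : ℂ) : ℝ :=
  ⨆ β : Ioi (0 : ℝ), (β : ℝ) ^ δ * ‖f (β : ℝ) - L‖

/-- the `𝒞^δ` norm, with `L = f(∞)`. -/
noncomputable def normC (δ : ℝ) (f : ℝ → ℂ) (L : ℂ) : ℝ := supN f + hoel δ f L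

/-- membership in `𝒞^δ`, with limit value `L` at infinity. -/
def MemCdelta (δ : ℝ) (f : ℝ → ℂ) (L : ℂ) : Prop :=
  ContinuousOn f (Ici 0) ∧ Tendsto f atTop (nhds L) ∧
    BddAbove (Set.range fun β : Ioi (0 : ℝ) => (β : ℝ) ^ δ * ‖f (β : ℝ) - L‖)

/-- `a_n(β) = √(n²μ² − (2μ−1)η(β))`. -/
noncomputable def aFun (μ : ℝ) (η : ℝ → ℝ) (n : ℤ) (β : ℝ) : ℝ :=
  Real.sqrt ((n : ℝ) ^ 2 * μ ^ 2 - (2 * μ - 1) * η β)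

/-- `χ_n(β) = η(β) − βη'(β)/(2a_n(β))`. -/
noncomputable def chiFun (μ : ℝ) (η : ℝ → ℝ) (n : ℤ) (β : ℝ) : ℝ :=
  η β - β * deriv η β / (2 * aFun μ η n β)

/-- `W_n(β) = exp(∫_1^β a_n(b)/b db)`. -/
noncomputable def WFun (μ : ℝ) (η : ℝ → ℝ) (n : ℤ) (β : ℝ) : ℝ :=
  Real.exp (∫ b in (1 : ℝ)..β, aFun μ η n b / b)

/-- `L_{n,-}^{-1}`. -/
noncomputable def Lminus (μ : ℝ) (η : ℝ → ℝ) (n : ℤ) (f : ℝ → ℂ) (β : ℝ) : ℂ :=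
  if 2 ≤ |n| then
    -(((β ^ (2 * μ - 1) / WFun μ η n β : ℝ) : ℂ) *
      ∫ b in (0 : ℝ)..β, ((b ^ (-(2 * μ)) * WFun μ η n b : ℝ) : ℂ) *
        Complex.exp (Complex.I * (n : ℂ) * ((β : ℂ) - (b : ℂ))) * f b)
  else
    ((β ^ (2 * μ - 1) / WFun μ η n β : ℝ) : ℂ) *
      ∫ b in Ioi β, ((b ^ (-(2 * μ)) * WFun μ η n b : ℝ) : ℂ) *
        Complex.exp (Complex.I * (n : ℂ) * ((β : ℂ) - (b : ℂ))) * f b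

/-- the averaging operator `(D_β+1)^{-1} f (β) = β^{-1} ∫_0^β f(b) db`. -/
noncomputable def Avg (f : ℝ → ℂ) (β : ℝ) : ℂ :=
  if β = 0 then f 0 else ((β⁻¹ : ℝ) : ℂ) * ∫ b in (0 : ℝ)..β, f b

/-- `T_n f (β) = in ∫_0^β L_{n,-}^{-1} f (b) db`. -/
noncomputable def Tn (μ : ℝ) (η : ℝ → ℝ) (n : ℤ) (f : ℝ → ℂ) (β : ℝ) : ℂ :=
  Complex.I * (n : ℂ) * ∫ b in (0 : ℝ)..β, Lminus μ η n f b

/-- `𝒦_{n,1} f = χ_n · (D_β+1)^{-1} L_{n,-}^{-1} f`. -/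
noncomputable def K1 (μ : ℝ) (η : ℝ → ℝ) (n : ℤ) (f : ℝ → ℂ) (β : ℝ) : ℂ :=
  ((chiFun μ η n β : ℝ) : ℂ) * Avg (Lminus μ η n f) β

/-- `𝒦_{n,2} f = (βχ_n') · (D_β+1)^{-1} L_{n,-}^{-1} f`. -/
noncomputable def K2 (μ : ℝ) (η : ℝ → ℝ) (n : ℤ) (f : ℝ → ℂ) (β : ℝ) : ℂ :=
  ((β * deriv (chiFun μ η n) β : ℝ) : ℂ) * Avg (Lminus μ η n f) β

/-- `𝒦_{n,3} f = (1−χ_n) · T_n f`. -/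
noncomputable def K3 (μ : ℝ) (η : ℝ → ℝ) (n : ℤ) (f : ℝ → ℂ) (β : ℝ) : ℂ :=
  ((1 - chiFun μ η n β : ℝ) : ℂ) * Tn μ η n f β


/-- `L_{n,+}^{-1}`. -/
noncomputable def Lplus (μ : ℝ) (η : ℝ → ℝ) (n : ℤ) (f : ℝ → ℂ) (β : ℝ) : ℂ :=
  ((β ^ (2 * μ - 1) * WFun μ η n β : ℝ) : ℂ) *
    ∫ b in Ioi β, ((b ^ (-(2 * μ)) / WFun μ η n b : ℝ) : ℂ) *
      Complex.exp (Complex.I * (n : ℂ) * ((β : ℂ) - (b : ℂ))) * f b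

/-- the full perturbation operator
`𝒦_n = (2μ−1)(L_{n,+}^{-1}(D_ρ−1)𝒦_{n,1} + L_{n,+}^{-1}𝒦_{n,2} + L_{n,+}^{-1}𝒦_{n,3})`,
where `(D_ρ−1)w (β) = −βw'(β) + (inβ−1)w(β)` is applied to `w = 𝒦_{n,1}u`. -/
noncomputable def Kn (μ : ℝ) (η : ℝ → ℝ) (n : ℤ) (u : ℝ → ℂ) (β : ℝ) : ℂ :=
  ((2 * μ - 1 : ℝ) : ℂ) *
    (Lplus μ η n (fun b =>
        -(b : ℂ) * deriv (K1 μ η n u) b +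
          (Complex.I * (n : ℂ) * (b : ℂ) - 1) * K1 μ η n u b) β +
      Lplus μ η n (K2 μ η n u) β + Lplus μ η n (K3 μ η n u) β)

/-! ### Compactness and the Fredholm alternative -/

theorem isCompact_setOf_lipschitz_decay (L : NNReal) (ω : ℝ → ℝ) (B : ℝ)
    (hB : ∀ x, ω x ≤ B) (hω : Tendsto ω (cocompact ℝ) (𝓝 0)) :
    IsCompact {h : BoundedContinuousFunction ℝ ℂ | LipschitzWith L h ∧ ∀ x, ‖h x‖ ≤ ω x} := by
  rw [isCompact_iff_ultrafilter_le_nhds']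
  intro F hF
  have hlim : ∀ x, ∃ l : ℂ,
      Tendsto (fun h : BoundedContinuousFunction ℝ ℂ => h x) F (𝓝 l) := by
    intro x
    have hc : IsCompact (Metric.closedBall (0 : ℂ) (ω x)) := isCompact_closedBall _ _
    obtain ⟨l, -, hl⟩ := (isCompact_iff_ultrafilter_le_nhds'.1 hc) (F.map fun h => h x) (by
      rw [Ultrafilter.mem_map]
      filter_upwards [hF] with h hh
      simpa using hh.2 x)
    exact ⟨l, hl⟩
  choose l hl using hlim
  have hlip : LipschitzWith L l := by
    refine LipschitzWith.of_dist_le_mul fun x y => ?_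
    refine le_of_tendsto ((hl x).dist (hl y)) ?_
    filter_upwards [hF] with h hh
    exact hh.1.dist_le_mul x y
  have hbd : ∀ x, ‖l x‖ ≤ ω x := by
    intro x
    refine le_of_tendsto (hl x).norm ?_
    filter_upwards [hF] with h hh
    exact hh.2 x
  let g : BoundedContinuousFunction ℝ ℂ :=
    BoundedContinuousFunction.ofNormedAddCommGroup l hlip.continuous B
      fun x => (hbd x).trans (hB x)
  refine ⟨g, ⟨hlip, hbd⟩, ?_⟩
  have key : Tendsto (fun h : BoundedContinuousFunction ℝ ℂ => h) F (𝓝 g) := by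
    rw [Metric.tendsto_nhds]
    intro ε hε
    have h1 : ∀ᶠ x in cocompact ℝ, ω x < ε / 4 := hω.eventually_lt_const (by positivity)
    obtain ⟨T, hT, hTs⟩ := mem_cocompact.1 h1
    have hL : (0 : ℝ) < ε / (4 * (L + 1)) := by positivity
    obtain ⟨t, -, htf, ht⟩ := hT.finite_cover_balls hL
    have h2 : ∀ᶠ h : BoundedContinuousFunction ℝ ℂ in F, ∀ x ∈ t, dist (h x) (l x) < ε / 4 := by
      rw [eventually_all_finite htf]
      intro x _
      exact Metric.tendsto_nhds.1 (hl x) _ (by positivity)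
    filter_upwards [hF, h2] with h hh h2
    refine lt_of_le_of_lt ((BoundedContinuousFunction.dist_le
      (C := 3 * (ε / 4)) (by positivity)).2 fun x => ?_) (by linarith)
    by_cases hx : x ∈ T
    · obtain ⟨y, hy, hxy⟩ := mem_iUnion₂.1 (ht hx)
      have hxy' : (L : ℝ) * dist x y ≤ ε / 4 := by
        have h4 := (Metric.mem_ball.1 hxy).le
        calc (L : ℝ) * dist x y ≤ (L + 1) * (ε / (4 * (L + 1))) := by
              gcongr
              simp
          _ = ε / 4 := by field_simp
      have e1 : dist (h x) (h y) ≤ ε / 4 := (hh.1.dist_le_mul x y).trans hxy'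
      have e2 : dist (l y) (l x) ≤ ε / 4 := by
        rw [dist_comm]
        exact (hlip.dist_le_mul x y).trans hxy'
      have e3 := (h2 y hy).le
      calc dist (h x) (l x) ≤ dist (h x) (h y) + dist (h y) (l y) + dist (l y) (l x) :=
            dist_triangle4 _ _ _ _
        _ ≤ 3 * (ε / 4) := by linarith
    · have hx' : ω x < ε / 4 := hTs hx
      calc dist (h x) (l x) ≤ ‖h x‖ + ‖l x‖ := dist_le_norm_add_norm _ _
        _ ≤ 3 * (ε / 4) := by linarith [hh.2 x, hbd x]
  exact key

theorem IsCompactOperator.exists_bound_surjective_of_injective {X : Type*}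
    [NormedAddCommGroup X] [NormedSpace ℂ X] [CompleteSpace X] (T : X →L[ℂ] X)
    (hT : IsCompactOperator T) (hinj : ∀ u, u + T u = 0 → u = 0) :
    (∃ C : ℝ, 0 ≤ C ∧ ∀ u, ‖u‖ ≤ C * ‖u + T u‖) ∧ ∀ v, ∃ u, u + T u = v := by
  have hne : ¬ Module.End.HasEigenvalue (T : Module.End ℂ X) (-1) := by
    intro h
    obtain ⟨u, hu⟩ := h.exists_hasEigenvector
    refine hu.2 (hinj u ?_)
    have : T u = (-1 : ℂ) • u := hu.apply_eq_smul
    rw [this]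
    simp
  constructor
  · obtain ⟨K, hK⟩ := hT.antilipschitz_of_not_hasEigenvalue (by norm_num : (-1 : ℂ) ≠ 0) hne
    refine ⟨K, K.2, fun u => ?_⟩
    have := hK.le_mul_dist u 0
    simpa [add_comm] using this
  · intro v
    rcases hT.hasEigenvalue_or_mem_resolventSet (by norm_num : (-1 : ℂ) ≠ 0) with h | h
    · exact absurd h hne
    · obtain ⟨S, hS⟩ := spectrum.mem_resolventSet_iff.1 h
      have h1 : (S : X →L[ℂ] X) ((↑S⁻¹ : X →L[ℂ] X) v) = v := by
        have : ((S : X →L[ℂ] X) * (↑S⁻¹ : X →L[ℂ] X)) v = v := by rw [S.mul_inv]; rfl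
        exact this
      rw [hS] at h1
      refine ⟨-((↑S⁻¹ : X →L[ℂ] X) v), ?_⟩
      rw [map_neg, ← neg_add]
      simp [Algebra.algebraMap_eq_smul_one] at h1
      rw [neg_add]
      simpa [sub_eq_add_neg] using h1

/-! ### Laplace transforms -/

theorem eq_zero_of_laplace_nat_eq_zero_real (f : ℝ → ℝ) (M : ℝ) (hf : ContinuousOn f (Ioi 0))
    (hM : ∀ x, 0 < x → |f x| ≤ M)
    (h0 : ∀ k : ℕ, 0 < k → ∫ x in Ioi (0 : ℝ), Real.exp (-(k * x)) * f x = 0) :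
    ∀ x, 0 < x → f x = 0 := by
  have hM0 : 0 ≤ M := (abs_nonneg _).trans (hM 1 one_pos)
  have hexp : IntegrableOn (fun x : ℝ => Real.exp (-x)) (Ioi 0) := integrableOn_exp_neg_Ioi 0
  have hI : ∀ (g : ℝ → ℝ) (C : ℝ), ContinuousOn g (Ioi 0) → (∀ x, 0 < x → |g x| ≤ C) →
      IntegrableOn (fun x => Real.exp (-x) * g x) (Ioi 0) := by
    intro g C hg hC
    refine Integrable.mono' (hexp.const_mul C)
      ((ContinuousOn.mul (by fun_prop) hg).aestronglyMeasurable measurableSet_Ioi) ?_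
    filter_upwards [ae_restrict_mem measurableSet_Ioi] with x hx
    rw [norm_mul, Real.norm_eq_abs, Real.norm_eq_abs, abs_of_pos (Real.exp_pos _), mul_comm]
    exact mul_le_mul_of_nonneg_right (hC x hx) (Real.exp_pos _).le
  have hmem : ∀ x : ℝ, 0 < x → Real.exp (-x) ∈ Icc (0 : ℝ) 1 := fun x hx =>
    ⟨(Real.exp_pos _).le, Real.exp_le_one_iff.2 (by linarith)⟩
  have hpoly : ∀ P : Polynomial ℝ,
      ∫ x in Ioi (0 : ℝ), Real.exp (-x) * (P.eval (Real.exp (-x)) * f x) = 0 := by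
    intro P
    simp_rw [Polynomial.eval_eq_sum_range, Finset.sum_mul, Finset.mul_sum]
    have heq : ∀ (i : ℕ) (x : ℝ), Real.exp (-x) * (P.coeff i * Real.exp (-x) ^ i * f x) =
        P.coeff i * (Real.exp (-((i + 1 : ℕ) * x)) * f x) := by
      intro i x
      rw [← Real.exp_nat_mul]
      have : Real.exp (-((i + 1 : ℕ) * x)) = Real.exp (-x) * Real.exp (i * -x) := by
        rw [← Real.exp_add]
        congr 1
        push_cast
        ring
      rw [this]
      ring
    rw [MeasureTheory.integral_finsetSum]
    · refine Finset.sum_eq_zero fun i _ => ?_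
      simp_rw [heq]
      rw [MeasureTheory.integral_const_mul, h0 (i + 1) (Nat.succ_pos i), mul_zero]
    · intro i _
      refine hI (fun x => P.coeff i * Real.exp (-x) ^ i * f x) (|P.coeff i| * M)
        (by fun_prop) fun x hx => ?_
      rw [abs_mul, abs_mul]
      have h1 : |Real.exp (-x) ^ i| ≤ 1 := by
        rw [abs_of_nonneg (by positivity)]
        exact pow_le_one₀ (hmem x hx).1 (hmem x hx).2
      calc |P.coeff i| * |Real.exp (-x) ^ i| * |f x| ≤ |P.coeff i| * 1 * M := by
            gcongr
            exact hM x hx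
        _ = _ := by ring
  let ψ : ℝ → ℝ := fun y => y * (1 - y) * f (-Real.log y)
  have hψbd : ∀ y ∈ Ioo (0 : ℝ) 1, |f (-Real.log y)| ≤ M := fun y hy =>
    hM _ (by linarith [Real.log_neg hy.1 hy.2])
  have hψb : ∀ y ∈ Icc (0 : ℝ) 1, |ψ y| ≤ M * |y * (1 - y)| := by
    intro y hy
    by_cases h : y ∈ Ioo (0 : ℝ) 1
    · rw [abs_mul, mul_comm]
      exact mul_le_mul_of_nonneg_right (hψbd y h) (abs_nonneg _)
    · have : y * (1 - y) = 0 := by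
        rcases eq_or_lt_of_le hy.1 with h1 | h1
        · rw [← h1]; ring
        · rcases eq_or_lt_of_le hy.2 with h2 | h2
          · rw [h2]; ring
          · exact absurd ⟨h1, h2⟩ h
      simp [ψ, this]
  have hψ : ContinuousOn ψ (Icc 0 1) := by
    intro y hy
    by_cases h : y ∈ Ioo (0 : ℝ) 1
    · have h1 : ContinuousAt f (-Real.log y) :=
        hf.continuousAt (Ioi_mem_nhds (by linarith [Real.log_neg h.1 h.2]))
      have h2 : ContinuousAt (fun z => f (-Real.log z)) y :=
        ContinuousAt.comp (f := fun z => -Real.log z) h1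
          (Real.continuousAt_log h.1.ne').neg
      exact (ContinuousAt.mul (by fun_prop) h2).continuousWithinAt
    · have h0 : y * (1 - y) = 0 := by
        rcases eq_or_lt_of_le hy.1 with h1 | h1
        · rw [← h1]; ring
        · rcases eq_or_lt_of_le hy.2 with h2 | h2
          · rw [h2]; ring
          · exact absurd ⟨h1, h2⟩ h
      have hψ0 : ψ y = 0 := by simp [ψ, h0]
      have hc : Tendsto (fun z : ℝ => M * |z * (1 - z)|) (𝓝[Icc 0 1] y) (𝓝 0) := by
        have : ContinuousAt (fun z : ℝ => M * |z * (1 - z)|) y := by fun_prop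
        have h3 := this.tendsto
        simp only [h0, abs_zero, mul_zero] at h3
        exact h3.mono_left nhdsWithin_le_nhds
      rw [ContinuousWithinAt, hψ0]
      refine squeeze_zero_norm' ?_ hc
      filter_upwards [self_mem_nhdsWithin] with z hz
      exact hψb z hz
  have hψe : ∀ x : ℝ, ψ (Real.exp (-x)) = Real.exp (-x) * (1 - Real.exp (-x)) * f x := by
    intro x
    simp [ψ]
  have hψI : IntegrableOn (fun x => Real.exp (-x) * (ψ (Real.exp (-x)) * f x)) (Ioi 0) := by
    refine hI _ (M * M) ?_ fun x hx => ?_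
    · simp_rw [hψe]
      fun_prop
    · have h1 := hψb _ (hmem x hx)
      have h2 : |Real.exp (-x) * (1 - Real.exp (-x))| ≤ 1 := by
        have := hmem x hx
        rw [abs_of_nonneg (mul_nonneg this.1 (by linarith [this.2]))]
        nlinarith [this.1, this.2]
      rw [abs_mul]
      have h3 : |ψ (Real.exp (-x))| ≤ M := h1.trans (by nlinarith)
      exact mul_le_mul h3 (hM x hx) (abs_nonneg _) hM0
  have hzero : ∫ x in Ioi (0 : ℝ), Real.exp (-x) * (ψ (Real.exp (-x)) * f x) = 0 := by
    by_contra hne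
    have hpos := abs_pos.2 hne
    obtain ⟨P, hP⟩ := exists_polynomial_near_of_continuousOn 0 1 ψ hψ
      (|∫ x in Ioi (0 : ℝ), Real.exp (-x) * (ψ (Real.exp (-x)) * f x)| / (M + 1)) (by positivity)
    set J := ∫ x in Ioi (0 : ℝ), Real.exp (-x) * (ψ (Real.exp (-x)) * f x) with hJ
    have hPI : IntegrableOn (fun x => Real.exp (-x) * (P.eval (Real.exp (-x)) * f x)) (Ioi 0) := by
      obtain ⟨C, hC⟩ := isCompact_Icc.exists_bound_of_continuousOn
        (P.continuous.continuousOn (s := Icc (0 : ℝ) 1))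
      refine hI _ (C * M) (by fun_prop) fun x hx => ?_
      rw [abs_mul]
      have := hC _ (hmem x hx)
      exact mul_le_mul this (hM x hx) (abs_nonneg _) ((norm_nonneg _).trans this)
    have hd : J = ∫ x in Ioi (0 : ℝ), (Real.exp (-x) * (ψ (Real.exp (-x)) * f x) -
        Real.exp (-x) * (P.eval (Real.exp (-x)) * f x)) := by
      rw [integral_sub hψI hPI, hpoly P, sub_zero]
    have hb : |J| ≤ ∫ x in Ioi (0 : ℝ), (|J| / (M + 1) * M) * Real.exp (-x) := by
      conv_lhs => rw [hd]
      rw [← Real.norm_eq_abs]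
      refine norm_integral_le_of_norm_le (hexp.const_mul _) ?_
      filter_upwards [ae_restrict_mem measurableSet_Ioi] with x hx
      have h1 := (hP _ (hmem x hx)).le
      rw [← mul_sub, ← sub_mul, norm_mul, norm_mul, Real.norm_eq_abs, Real.norm_eq_abs,
        Real.norm_eq_abs, abs_of_pos (Real.exp_pos _), mul_comm]
      refine mul_le_mul_of_nonneg_right ?_ (Real.exp_pos _).le
      rw [abs_sub_comm]
      exact mul_le_mul h1 (hM x hx) (abs_nonneg _) (by positivity)
    rw [MeasureTheory.integral_const_mul, integral_exp_neg_Ioi_zero, mul_one] at hb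
    have : |J| / (M + 1) * M < |J| := by
      rw [div_mul_eq_mul_div, div_lt_iff₀ (by positivity)]
      nlinarith
    linarith
  have hnn : 0 ≤ᵐ[volume.restrict (Ioi (0 : ℝ))]
      fun x => Real.exp (-x) * (ψ (Real.exp (-x)) * f x) := by
    filter_upwards [ae_restrict_mem measurableSet_Ioi] with x hx
    rw [hψe]
    have := hmem x hx
    have h2 : 0 ≤ Real.exp (-x) * (1 - Real.exp (-x)) := mul_nonneg this.1 (by linarith [this.2])
    have : Real.exp (-x) * (Real.exp (-x) * (1 - Real.exp (-x)) * f x * f x) =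
      Real.exp (-x) * (Real.exp (-x) * (1 - Real.exp (-x))) * (f x * f x) := by ring
    rw [this]
    exact mul_nonneg (mul_nonneg (Real.exp_pos _).le h2) (mul_self_nonneg _)
  have hae := (setIntegral_eq_zero_iff_of_nonneg_ae hnn hψI).1 hzero
  have hcont : ContinuousOn (fun x => Real.exp (-x) * (ψ (Real.exp (-x)) * f x)) (Ioi 0) := by
    simp_rw [hψe]
    fun_prop
  have heq := Measure.eqOn_open_of_ae_eq hae isOpen_Ioi hcont continuousOn_const
  intro x hx
  have h1 := heq hx
  simp only [hψe, Pi.zero_apply] at h1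
  have h2 : Real.exp (-x) < 1 := by
    rw [Real.exp_lt_one_iff]
    linarith [hx]
  have h3 : 1 - Real.exp (-x) ≠ 0 := by linarith
  have h4 := Real.exp_ne_zero (-x)
  simpa [h3, h4] using h1

/-- The Laplace transform `∫_0^∞ e^{-px} f(x) dx`. -/
noncomputable def laplace (f : ℝ → ℂ) (p : ℝ) : ℂ :=
  ∫ x in Ioi (0 : ℝ), ((Real.exp (-(p * x)) : ℝ) : ℂ) * f x

theorem exp_neg_mul_mul_sq_le {p x : ℝ} (hp : 0 < p) (hx : 0 ≤ x) :
    (1 + x) ^ 2 * Real.exp (-(p * x)) ≤ (max 1 (4 / p)) ^ 2 * Real.exp (-(p / 2) * x) := by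
  have h1 : 1 + x ≤ max 1 (4 / p) * Real.exp (p * x / 4) := by
    have h2 : 1 + p * x / 4 ≤ Real.exp (p * x / 4) := by
      linarith [Real.add_one_le_exp (p * x / 4)]
    have h3 : 1 + x ≤ max 1 (4 / p) * (1 + p * x / 4) := by
      have a1 : (1 : ℝ) ≤ max 1 (4 / p) := le_max_left _ _
      have a2 : 4 / p * (p * x / 4) ≤ max 1 (4 / p) * (p * x / 4) := by
        gcongr
        exact le_max_right _ _
      have a3 : 4 / p * (p * x / 4) = x := by field_simp
      linarith
    exact h3.trans (by gcongr)
  calc (1 + x) ^ 2 * Real.exp (-(p * x))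
      ≤ (max 1 (4 / p) * Real.exp (p * x / 4)) ^ 2 * Real.exp (-(p * x)) := by gcongr
    _ = (max 1 (4 / p)) ^ 2 * (Real.exp (p * x / 4) * Real.exp (p * x / 4) *
          Real.exp (-(p * x))) := by ring
    _ = _ := by
      rw [← Real.exp_add, ← Real.exp_add]
      congr 2
      ring

theorem integrableOn_sq_mul_exp {p : ℝ} (hp : 0 < p) :
    IntegrableOn (fun x : ℝ => (1 + x) ^ 2 * Real.exp (-(p * x))) (Ioi 0) := by
  refine Integrable.mono'
    ((exp_neg_integrableOn_Ioi 0 (half_pos hp)).const_mul ((max 1 (4 / p)) ^ 2))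
    (Continuous.aestronglyMeasurable (by fun_prop)) ?_
  filter_upwards [ae_restrict_mem measurableSet_Ioi] with x hx
  rw [Real.norm_of_nonneg (by positivity)]
  exact exp_neg_mul_mul_sq_le hp (mem_Ioi.1 hx).le

theorem integrableOn_laplace {f : ℝ → ℂ} {N p : ℝ} (hf : ContinuousOn f (Ioi 0))
    (hN : ∀ x, 0 < x → ‖f x‖ ≤ N * (1 + x) ^ 2) (hp : 0 < p) :
    IntegrableOn (fun x => ((Real.exp (-(p * x)) : ℝ) : ℂ) * f x) (Ioi 0) := by
  refine Integrable.mono' ((integrableOn_sq_mul_exp hp).const_mul N)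
    ((ContinuousOn.mul (by fun_prop) hf).aestronglyMeasurable measurableSet_Ioi) ?_
  filter_upwards [ae_restrict_mem measurableSet_Ioi] with x hx
  rw [norm_mul, Complex.norm_real, Real.norm_of_nonneg (Real.exp_pos _).le, mul_comm, ← mul_assoc]
  exact mul_le_mul_of_nonneg_right (hN x hx) (Real.exp_pos _).le

theorem norm_mul_le_of_le_linear {f : ℝ → ℂ} {N : ℝ}
    (hN : ∀ x, 0 < x → ‖f x‖ ≤ N * (1 + x)) (x : ℝ) (hx : 0 < x) :
    ‖(x : ℂ) * f x‖ ≤ N * (1 + x) ^ 2 := by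
  have h0 := hN x hx
  have h1 : 0 ≤ N * (1 + x) := (norm_nonneg _).trans h0
  rw [norm_mul, Complex.norm_real, Real.norm_of_nonneg hx.le]
  calc x * ‖f x‖ ≤ (1 + x) * (N * (1 + x)) := by
        apply mul_le_mul (by linarith) h0 (norm_nonneg _) (by linarith)
    _ = _ := by ring

theorem le_sq_of_le_linear {f : ℝ → ℂ} {N : ℝ}
    (hN : ∀ x, 0 < x → ‖f x‖ ≤ N * (1 + x)) (x : ℝ) (hx : 0 < x) :
    ‖f x‖ ≤ N * (1 + x) ^ 2 := by
  have h0 := hN x hx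
  have h1 : 0 ≤ N * (1 + x) := (norm_nonneg _).trans h0
  nlinarith

theorem hasDerivAt_laplace {f : ℝ → ℂ} {N p : ℝ} (hf : ContinuousOn f (Ioi 0))
    (hN : ∀ x, 0 < x → ‖f x‖ ≤ N * (1 + x)) (hp : 0 < p) :
    HasDerivAt (laplace f) (-laplace (fun x => (x : ℂ) * f x) p) p := by
  have key := (hasDerivAt_integral_of_dominated_loc_of_deriv_le
    (μ := volume.restrict (Ioi (0 : ℝ))) (𝕜 := ℝ) (x₀ := p) (s := Ioi (p / 2))
    (F := fun q x => ((Real.exp (-(q * x)) : ℝ) : ℂ) * f x)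
    (F' := fun q x => -(((Real.exp (-(q * x)) : ℝ) : ℂ) * ((x : ℂ) * f x)))
    (bound := fun x => N * ((1 + x) ^ 2 * Real.exp (-(p / 2 * x))))
    (Ioi_mem_nhds (by linarith)) ?_ (integrableOn_laplace hf (le_sq_of_le_linear hN) hp) ?_ ?_ ?_
    ?_).2
  · rwa [MeasureTheory.integral_neg] at key
  · exact Eventually.of_forall fun q =>
      (ContinuousOn.mul (by fun_prop) hf).aestronglyMeasurable measurableSet_Ioi
  · refine ContinuousOn.aestronglyMeasurable ?_ measurableSet_Ioi
    fun_prop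
  · filter_upwards [ae_restrict_mem measurableSet_Ioi] with x hx q hq
    rw [norm_neg, norm_mul, Complex.norm_real, Real.norm_of_nonneg (Real.exp_pos _).le, mul_comm,
      ← mul_assoc]
    have h1 := norm_mul_le_of_le_linear hN x hx
    have hx' : 0 < x := hx
    have hq' : p / 2 < q := hq
    have h2 : Real.exp (-(q * x)) ≤ Real.exp (-(p / 2 * x)) := by
      apply Real.exp_le_exp.2
      nlinarith
    exact mul_le_mul h1 h2 (Real.exp_pos _).le ((norm_nonneg _).trans h1)
  · exact (integrableOn_sq_mul_exp (by linarith)).const_mul N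
  · filter_upwards [ae_restrict_mem measurableSet_Ioi] with x hx q hq
    have h1 : HasDerivAt (fun q : ℝ => Real.exp (-(q * x))) (Real.exp (-(q * x)) * -(1 * x)) q :=
      (((hasDerivAt_id q).mul_const x).neg).exp
    refine (h1.ofReal_comp.mul_const (f x)).congr_deriv ?_
    push_cast
    ring

theorem integral_deriv_eq_zero_of_bound {Φ Φ' : ℝ → ℂ} {N p : ℝ} (hp : 0 < p) (h0 : Φ 0 = 0)
    (hΦ : ∀ x, 0 < x → HasDerivAt Φ (Φ' x) x)
    (hb : ∀ x, 0 < x → ‖Φ x‖ ≤ N * x * (1 + x) * Real.exp (-(p * x)))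
    (hi : IntegrableOn Φ' (Ioi 0)) : ∫ x in Ioi (0 : ℝ), Φ' x = 0 := by
  have hN : 0 ≤ N := by
    have h1 := (norm_nonneg _).trans (hb 1 one_pos)
    have h2 := Real.exp_pos (-(p * 1))
    by_contra! h
    nlinarith
  have hcont : ContinuousWithinAt Φ (Ici 0) 0 := by
    rw [ContinuousWithinAt, h0]
    have hc : Tendsto (fun x : ℝ => N * x * (1 + x) * Real.exp (-(p * x))) (𝓝[Ici 0] 0) (𝓝 0) := by
      have : Continuous (fun x : ℝ => N * x * (1 + x) * Real.exp (-(p * x))) := by fun_prop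
      have h1 := this.tendsto 0
      simp only [mul_zero, zero_mul] at h1
      exact h1.mono_left nhdsWithin_le_nhds
    refine squeeze_zero_norm' ?_ hc
    filter_upwards [self_mem_nhdsWithin] with x hx
    rcases eq_or_lt_of_le (mem_Ici.1 hx) with h | h
    · rw [← h, h0]; simp
    · exact hb x h
  have hinf : Tendsto Φ atTop (𝓝 0) := by
    have hc : Tendsto (fun x : ℝ => N * ((max 1 (4 / p)) ^ 2 * Real.exp (-(p / 2) * x))) atTop
        (𝓝 0) := by
      have h1 : Tendsto (fun x : ℝ => Real.exp (-(p / 2) * x)) atTop (𝓝 0) := by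
        apply Real.tendsto_exp_atBot.comp
        exact tendsto_id.const_mul_atTop_of_neg (by linarith)
      simpa using (h1.const_mul ((max 1 (4 / p)) ^ 2)).const_mul N
    refine squeeze_zero_norm' ?_ hc
    filter_upwards [eventually_gt_atTop 0] with x hx
    refine (hb x hx).trans ?_
    have h2 := exp_neg_mul_mul_sq_le hp hx.le
    have h3 : N * x * (1 + x) * Real.exp (-(p * x)) ≤
        N * ((1 + x) ^ 2 * Real.exp (-(p * x))) := by
      rw [mul_assoc, mul_assoc]
      refine mul_le_mul_of_nonneg_left ?_ hN
      rw [← mul_assoc]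
      refine mul_le_mul_of_nonneg_right ?_ (Real.exp_pos _).le
      nlinarith
    exact h3.trans (mul_le_mul_of_nonneg_left h2 hN)
  rw [integral_Ioi_of_hasDerivAt_of_tendsto hcont (fun x hx => hΦ x hx) hi hinf, h0, sub_zero]

theorem laplace_euler {f h : ℝ → ℂ} {N p : ℝ} (hp : 0 < p)
    (hf : ∀ x, 0 < x → HasDerivAt f (-h x / x) x)
    (hN : ∀ x, 0 < x → ‖f x‖ ≤ N * (1 + x)) (hh : ContinuousOn h (Ioi 0))
    (hhN : ∀ x, 0 < x → ‖h x‖ ≤ N * (1 + x)) :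
    p * -laplace (fun x => (x : ℂ) * f x) p + laplace f p = laplace h p := by
  have hfc : ContinuousOn f (Ioi 0) := fun x hx => (hf x hx).continuousAt.continuousWithinAt
  have i1 := integrableOn_laplace hfc (le_sq_of_le_linear hN) hp
  have i2 := integrableOn_laplace (f := fun x => (x : ℂ) * f x) (by fun_prop)
    (norm_mul_le_of_le_linear hN) hp
  have i3 := integrableOn_laplace hh (le_sq_of_le_linear hhN) hp
  have key := integral_deriv_eq_zero_of_bound (N := N) (p := p)
    (Φ := fun x => ((Real.exp (-(p * x)) : ℝ) : ℂ) * ((x : ℂ) * f x))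
    (Φ' := fun x => ((Real.exp (-(p * x)) : ℝ) : ℂ) * f x -
      p * (((Real.exp (-(p * x)) : ℝ) : ℂ) * ((x : ℂ) * f x)) -
      ((Real.exp (-(p * x)) : ℝ) : ℂ) * h x) hp (by simp) ?_ ?_ ((i1.sub (i2.const_mul _)).sub i3)
  · have e1 : ∫ x in Ioi (0 : ℝ), (((Real.exp (-(p * x)) : ℝ) : ℂ) * f x -
      p * (((Real.exp (-(p * x)) : ℝ) : ℂ) * ((x : ℂ) * f x)) -
      ((Real.exp (-(p * x)) : ℝ) : ℂ) * h x) =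
        laplace f p - p * laplace (fun x => (x : ℂ) * f x) p - laplace h p := by
      have e2 := MeasureTheory.integral_sub (i1.sub (i2.const_mul (p : ℂ))) i3
      have e3 := MeasureTheory.integral_sub i1 (i2.const_mul (p : ℂ))
      rw [MeasureTheory.integral_const_mul] at e3
      simp only [Pi.sub_apply] at e2
      rw [e2, e3]
      rfl
    rw [e1] at key
    linear_combination key
  · intro x hx
    have h1 : HasDerivAt (fun q : ℝ => Real.exp (-(p * q))) (Real.exp (-(p * x)) * -(p * 1)) x :=
      (((hasDerivAt_id x).const_mul p).neg).exp
    have h2 : HasDerivAt (fun q : ℝ => (q : ℂ)) 1 x := by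
      simpa using (hasDerivAt_id x).ofReal_comp
    refine (h1.ofReal_comp.mul (h2.mul (hf x hx))).congr_deriv ?_
    have : (x : ℂ) ≠ 0 := by exact_mod_cast hx.ne'
    simp only [Pi.mul_apply]
    push_cast
    field_simp
    ring
  · intro x hx
    rw [norm_mul, norm_mul, Complex.norm_real, Complex.norm_real,
      Real.norm_of_nonneg (Real.exp_pos _).le, Real.norm_of_nonneg hx.le, mul_comm]
    refine mul_le_mul_of_nonneg_right ?_ (Real.exp_pos _).le
    calc x * ‖f x‖ ≤ x * (N * (1 + x)) := mul_le_mul_of_nonneg_left (hN x hx) hx.le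
      _ = _ := by ring

theorem laplace_deriv {f h : ℝ → ℂ} {N p : ℝ} (hp : 0 < p) (h0 : f 0 = 0)
    (hf : ∀ x, 0 < x → HasDerivAt f (h x) x)
    (hN : ∀ x, 0 < x → ‖f x‖ ≤ N * x) (hh : ContinuousOn h (Ioi 0))
    (hhN : ∀ x, 0 < x → ‖h x‖ ≤ N * (1 + x)) : p * laplace f p = laplace h p := by
  have hfc : ContinuousOn f (Ioi 0) := fun x hx => (hf x hx).continuousAt.continuousWithinAt
  have hN0 : 0 ≤ N := by simpa using (norm_nonneg _).trans (hN 1 one_pos)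
  have hN' : ∀ x, 0 < x → ‖f x‖ ≤ N * (1 + x) := fun x hx => (hN x hx).trans (by nlinarith)
  have i1 := integrableOn_laplace hfc (le_sq_of_le_linear hN') hp
  have i3 := integrableOn_laplace hh (le_sq_of_le_linear hhN) hp
  have key := integral_deriv_eq_zero_of_bound (N := N) (p := p)
    (Φ := fun x => ((Real.exp (-(p * x)) : ℝ) : ℂ) * f x)
    (Φ' := fun x => ((Real.exp (-(p * x)) : ℝ) : ℂ) * h x -
      p * (((Real.exp (-(p * x)) : ℝ) : ℂ) * f x)) hp (by simp [h0]) ?_ ?_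
      (i3.sub (i1.const_mul _))
  · have e1 : ∫ x in Ioi (0 : ℝ), (((Real.exp (-(p * x)) : ℝ) : ℂ) * h x -
      p * (((Real.exp (-(p * x)) : ℝ) : ℂ) * f x)) = laplace h p - p * laplace f p := by
      rw [MeasureTheory.integral_sub i3 (i1.const_mul _), MeasureTheory.integral_const_mul]
      rfl
    rw [e1] at key
    linear_combination -key
  · intro x hx
    have h1 : HasDerivAt (fun q : ℝ => Real.exp (-(p * q))) (Real.exp (-(p * x)) * -(p * 1)) x :=
      (((hasDerivAt_id x).const_mul p).neg).exp
    refine (h1.ofReal_comp.mul (hf x hx)).congr_deriv ?_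
    push_cast
    ring
  · intro x hx
    rw [norm_mul, Complex.norm_real, Real.norm_of_nonneg (Real.exp_pos _).le, mul_comm]
    refine mul_le_mul_of_nonneg_right ?_ (Real.exp_pos _).le
    refine (hN x hx).trans ?_
    have : 0 ≤ N * x := by positivity
    nlinarith

theorem norm_laplace_le {f : ℝ → ℂ} {N p : ℝ} (hp : 0 < p)
    (hN : ∀ x, 0 < x → ‖f x‖ ≤ N) : ‖laplace f p‖ ≤ N / p := by
  have h1 := Real.integral_rpow_mul_exp_neg_mul_Ioi (a := 1) (r := p) one_pos hp
  have h2 : IntegrableOn (fun x : ℝ => Real.exp (-(p * x))) (Ioi 0) := by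
    simpa using exp_neg_integrableOn_Ioi 0 hp
  have : ‖laplace f p‖ ≤ ∫ x in Ioi (0 : ℝ), N * Real.exp (-(p * x)) := by
    refine norm_integral_le_of_norm_le (h2.const_mul N) ?_
    filter_upwards [ae_restrict_mem measurableSet_Ioi] with x hx
    rw [norm_mul, Complex.norm_real, Real.norm_of_nonneg (Real.exp_pos _).le, mul_comm]
    exact mul_le_mul_of_nonneg_right (hN x hx) (Real.exp_pos _).le
  rw [MeasureTheory.integral_const_mul] at this
  simp only [sub_self, Real.rpow_zero, one_mul, Real.rpow_one, Real.Gamma_one, mul_one] at h1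
  rw [h1] at this
  simpa [div_eq_mul_inv] using this

theorem norm_laplace_le_sq {f : ℝ → ℂ} {N p : ℝ} (hp : 0 < p)
    (hN : ∀ x, 0 < x → ‖f x‖ ≤ N * x) : ‖laplace f p‖ ≤ N / p ^ 2 := by
  have h1 := Real.integral_rpow_mul_exp_neg_mul_Ioi (a := 2) (r := p) two_pos hp
  have h2 : IntegrableOn (fun x : ℝ => x * Real.exp (-(p * x))) (Ioi 0) := by
    refine Integrable.mono' (integrableOn_sq_mul_exp hp)
      (Continuous.aestronglyMeasurable (by fun_prop)) ?_
    filter_upwards [ae_restrict_mem measurableSet_Ioi] with x hx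
    have hx' : 0 < x := hx
    rw [Real.norm_of_nonneg (by positivity)]
    refine mul_le_mul_of_nonneg_right ?_ (Real.exp_pos _).le
    nlinarith
  have : ‖laplace f p‖ ≤ ∫ x in Ioi (0 : ℝ), N * (x * Real.exp (-(p * x))) := by
    refine norm_integral_le_of_norm_le (h2.const_mul N) ?_
    filter_upwards [ae_restrict_mem measurableSet_Ioi] with x hx
    rw [norm_mul, Complex.norm_real, Real.norm_of_nonneg (Real.exp_pos _).le, mul_comm,
      ← mul_assoc]
    exact mul_le_mul_of_nonneg_right (hN x hx) (Real.exp_pos _).le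
  rw [MeasureTheory.integral_const_mul] at this
  have h3 : (2 : ℝ) - 1 = 1 := by norm_num
  simp only [h3, Real.rpow_one, Real.Gamma_two, mul_one, Real.rpow_two] at h1
  rw [h1] at this
  simpa [div_eq_mul_inv] using this

theorem eq_zero_of_laplace_eq_zero {f : ℝ → ℂ} {M : ℝ} (hf : ContinuousOn f (Ioi 0))
    (hM : ∀ x, 0 < x → ‖f x‖ ≤ M) (h0 : ∀ p, 0 < p → laplace f p = 0) :
    ∀ x, 0 < x → f x = 0 := by
  have hM0 : 0 ≤ M := (norm_nonneg _).trans (hM 1 one_pos)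
  have hint : ∀ p : ℝ, 0 < p →
      IntegrableOn (fun x => ((Real.exp (-(p * x)) : ℝ) : ℂ) * f x) (Ioi 0) := fun p hp =>
    integrableOn_laplace hf (N := M) (fun x hx => (hM x hx).trans
      (by nlinarith [mul_nonneg hM0 hx.le, mul_nonneg hM0 (sq_nonneg x)])) hp
  have hre := eq_zero_of_laplace_nat_eq_zero_real (fun x => (f x).re) M
    (Complex.continuous_re.comp_continuousOn hf)
    (fun x hx => (Complex.abs_re_le_norm _).trans (hM x hx)) fun k hk => by
      have hk' : (0 : ℝ) < k := by exact_mod_cast hk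
      have h1 := integral_re (hint k hk')
      have h2 := h0 k hk'
      rw [laplace] at h2
      rw [h2] at h1
      simpa only [RCLike.re_eq_complex_re, Complex.re_ofReal_mul, Complex.zero_re] using h1
  have him := eq_zero_of_laplace_nat_eq_zero_real (fun x => (f x).im) M
    (Complex.continuous_im.comp_continuousOn hf)
    (fun x hx => (Complex.abs_im_le_norm _).trans (hM x hx)) fun k hk => by
      have hk' : (0 : ℝ) < k := by exact_mod_cast hk
      have h1 := integral_im (hint k hk')
      have h2 := h0 k hk'
      rw [laplace] at h2
      rw [h2] at h1
      simpa only [RCLike.im_eq_complex_im, Complex.im_ofReal_mul, Complex.zero_im] using h1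
  exact fun x hx => Complex.ext (hre x hx) (him x hx)

/-! ### A maximum principle for `θ² k = V k`, `θ = p d/dp` -/

theorem eq_zero_of_euler_second_order {k l V : ℝ → ℂ} {s : ℝ}
    (hV : ∀ p, 0 < p → s ^ 2 ≤ (V p).re)
    (hk : ∀ p, 0 < p → HasDerivAt k (l p / p) p)
    (hl : ∀ p, 0 < p → HasDerivAt l (V p * k p / p) p)
    (h0 : Tendsto (fun p : ℝ => p ^ (-s) * ‖k p‖) (𝓝[>] 0) (𝓝 0))
    (hinf : Tendsto (fun p : ℝ => p ^ (-s) * ‖k p‖) atTop (𝓝 0)) :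
    ∀ p, 0 < p → k p = 0 := by
  set h : ℝ → ℝ := fun p => p ^ (-(2 * s)) * ‖k p‖ ^ 2 with hh
  set E : ℝ → ℝ := fun p => 2 * inner ℝ (k p) (l p) - 2 * s * ‖k p‖ ^ 2 with hE
  have hsq : ∀ p, 0 < p → h p = (p ^ (-s) * ‖k p‖) ^ 2 := by
    intro p hp
    have h1 : p ^ (-(2 * s)) = (p ^ (-s)) ^ 2 := by
      rw [← Real.rpow_natCast, ← Real.rpow_mul hp.le]
      push_cast
      ring_nf
    simp only [hh, mul_pow, h1]
  have h0' : Tendsto h (𝓝[>] 0) (𝓝 0) := by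
    have : Tendsto (fun p : ℝ => (p ^ (-s) * ‖k p‖) ^ 2) (𝓝[>] 0) (𝓝 0) := by
      simpa using h0.pow 2
    refine this.congr' ?_
    filter_upwards [self_mem_nhdsWithin] with p hp using (hsq p hp).symm
  have hinf' : Tendsto h atTop (𝓝 0) := by
    have : Tendsto (fun p : ℝ => (p ^ (-s) * ‖k p‖) ^ 2) atTop (𝓝 0) := by
      simpa using hinf.pow 2
    refine this.congr' ?_
    filter_upwards [eventually_gt_atTop 0] with p hp using (hsq p hp).symm
  have hinner : ∀ z w : ℂ, inner ℝ z w = z.re * w.re + z.im * w.im := by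
    intro z w
    simp [Complex.inner]
    ring
  have hnsq : ∀ z : ℂ, ‖z‖ ^ 2 = z.re * z.re + z.im * z.im := by
    intro z
    rw [Complex.sq_norm, Complex.normSq_apply]
  have hdiv : ∀ (z : ℂ) (p : ℝ), z / (p : ℂ) = ((p⁻¹ : ℝ) : ℂ) * z := by
    intro z p
    push_cast
    rw [div_eq_inv_mul]
  have hhd : ∀ p, 0 < p → HasDerivAt h (p ^ (-(2 * s) - 1) * E p) p := by
    intro p hp
    have d1 := (Real.hasDerivAt_rpow_const (p := -(2 * s)) (Or.inl hp.ne'))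
    have d2 := (hk p hp).norm_sq
    refine (d1.mul d2).congr_deriv ?_
    simp only [hE]
    rw [hdiv]
    simp only [hinner, hnsq, Complex.re_ofReal_mul, Complex.im_ofReal_mul]
    have : p ^ (-(2 * s)) = p ^ (-(2 * s) - 1) * p := by
      rw [← Real.rpow_add_one hp.ne']
      congr 1
      ring
    rw [this]
    field_simp
    ring
  have hEd : ∀ p, 0 < p → HasDerivAt E
      (p⁻¹ * (2 * ‖l p - s * k p‖ ^ 2 + 2 * ((V p).re - s ^ 2) * ‖k p‖ ^ 2)) p := by
    intro p hp
    have d1 := ((hk p hp).inner ℝ (hl p hp)).const_mul 2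
    have d2 := ((hk p hp).norm_sq).const_mul (2 * s)
    refine (d1.sub d2).congr_deriv ?_
    rw [hdiv, hdiv]
    simp only [hinner, hnsq, Complex.ofReal_re, Complex.ofReal_im, Complex.mul_re,
      Complex.mul_im, Complex.sub_re, Complex.sub_im]
    ring
  have hEmono : MonotoneOn E (Ioi 0) := by
    refine monotoneOn_of_deriv_nonneg (convex_Ioi 0)
      (fun p hp => (hEd p hp).continuousAt.continuousWithinAt) ?_ ?_
    · intro p hp
      rw [interior_Ioi] at hp
      exact (hEd p hp).differentiableAt.differentiableWithinAt
    · intro p hp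
      rw [interior_Ioi] at hp
      rw [(hEd p hp).deriv]
      have := hV p hp
      have hp' : 0 < p := hp
      have : 0 ≤ (V p).re - s ^ 2 := by linarith
      positivity
  intro p hp
  have hle : h p ≤ 0 := by
    rcases le_total 0 (E p) with hEp | hEp
    · have hmono : MonotoneOn h (Ici p) := by
        refine monotoneOn_of_deriv_nonneg (convex_Ici p)
          (fun q hq => (hhd q (hp.trans_le hq)).continuousAt.continuousWithinAt) ?_ ?_
        · intro q hq
          rw [interior_Ici] at hq
          exact (hhd q (hp.trans hq)).differentiableAt.differentiableWithinAt
        · intro q hq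
          rw [interior_Ici] at hq
          have hq0 : 0 < q := hp.trans hq
          rw [(hhd q hq0).deriv]
          exact mul_nonneg (Real.rpow_nonneg hq0.le _) (hEp.trans (hEmono hp hq0 (le_of_lt hq)))
      refine ge_of_tendsto hinf' ?_
      filter_upwards [eventually_ge_atTop p] with q hq
      exact hmono self_mem_Ici hq hq
    · have hanti : AntitoneOn h (Ioc 0 p) := by
        refine antitoneOn_of_deriv_nonpos (convex_Ioc 0 p)
          (fun q hq => (hhd q hq.1).continuousAt.continuousWithinAt) ?_ ?_
        · intro q hq
          rw [interior_Ioc] at hq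
          exact (hhd q hq.1).differentiableAt.differentiableWithinAt
        · intro q hq
          rw [interior_Ioc] at hq
          rw [(hhd q hq.1).deriv]
          exact mul_nonpos_of_nonneg_of_nonpos (Real.rpow_nonneg hq.1.le _)
            ((hEmono hq.1 hp hq.2.le).trans hEp)
      refine ge_of_tendsto h0' ?_
      filter_upwards [Ioc_mem_nhdsGT hp] with q hq
      exact hanti hq ⟨hp, le_rfl⟩ hq.2
  have h1 : 0 < p ^ (-(2 * s)) := Real.rpow_pos_of_pos hp _
  have h2 : ‖k p‖ ^ 2 ≤ 0 := by
    by_contra! hc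
    have : 0 < h p := mul_pos h1 hc
    linarith
  have h3 : ‖k p‖ = 0 := by nlinarith [norm_nonneg (k p)]
  exact norm_eq_zero.1 h3

/-- A smooth cutoff which vanishes on `(-∞,1]` and equals one on `[2,∞)`. -/
structure IsCutoff (η : ℝ → ℝ) : Prop where
  smooth : ContDiff ℝ (⊤ : ℕ∞) η
  range : ∀ β, 0 ≤ η β ∧ η β ≤ 1
  eq_zero : ∀ β : ℝ, β ≤ 1 → η β = 0
  eq_one : ∀ β : ℝ, 2 ≤ β → η β = 1

/-- The value `√(n²μ² − (2μ−1))` of `a_n` near infinity. -/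
noncomputable def alphaInf (μ : ℝ) (n : ℤ) : ℝ := Real.sqrt ((n : ℝ) ^ 2 * μ ^ 2 - (2 * μ - 1))

section Coefficients

variable {μ : ℝ} {η : ℝ → ℝ} {n : ℤ}

theorem one_le_abs_cast (hn : n ≠ 0) : (1 : ℝ) ≤ |(n : ℝ)| := by
  exact_mod_cast Int.one_le_abs hn

theorem one_le_sq_cast (hn : n ≠ 0) : (1 : ℝ) ≤ (n : ℝ) ^ 2 := by
  rw [← sq_abs]
  nlinarith [one_le_abs_cast hn]

theorem sq_mul_le_radicand (hμ : 1 < μ) (hn : n ≠ 0) :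
    (|(n : ℝ)| * (μ - 1)) ^ 2 ≤ (n : ℝ) ^ 2 * μ ^ 2 - (2 * μ - 1) := by
  rw [mul_pow, sq_abs]
  nlinarith [one_le_sq_cast hn]

theorem radicand_le (hμ : 1 < μ) (hη : IsCutoff η) (n : ℤ) (β : ℝ) :
    (n : ℝ) ^ 2 * μ ^ 2 - (2 * μ - 1) ≤ (n : ℝ) ^ 2 * μ ^ 2 - (2 * μ - 1) * η β := by
  nlinarith [(hη.range β).2]

theorem abs_mul_le_alphaInf (hμ : 1 < μ) (hn : n ≠ 0) : |(n : ℝ)| * (μ - 1) ≤ alphaInf μ n :=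
  Real.le_sqrt_of_sq_le (sq_mul_le_radicand hμ hn)

theorem sub_one_le_alphaInf (hμ : 1 < μ) (hn : n ≠ 0) : μ - 1 ≤ alphaInf μ n :=
  le_trans (by nlinarith [one_le_abs_cast hn]) (abs_mul_le_alphaInf hμ hn)

theorem alphaInf_pos (hμ : 1 < μ) (hn : n ≠ 0) : 0 < alphaInf μ n :=
  lt_of_lt_of_le (by linarith) (sub_one_le_alphaInf hμ hn)

theorem sq_alphaInf (hμ : 1 < μ) (hn : n ≠ 0) :
    alphaInf μ n ^ 2 = (n : ℝ) ^ 2 * μ ^ 2 - (2 * μ - 1) :=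
  Real.sq_sqrt ((sq_nonneg _).trans (sq_mul_le_radicand hμ hn))

theorem alphaInf_le_aFun (hμ : 1 < μ) (hη : IsCutoff η) (n : ℤ) (β : ℝ) :
    alphaInf μ n ≤ aFun μ η n β :=
  Real.sqrt_le_sqrt (radicand_le hμ hη n β)

theorem aFun_pos (hμ : 1 < μ) (hη : IsCutoff η) (hn : n ≠ 0) (β : ℝ) : 0 < aFun μ η n β :=
  (alphaInf_pos hμ hn).trans_le (alphaInf_le_aFun hμ hη n β)

theorem aFun_le (hμ : 1 < μ) (hη : IsCutoff η) (n : ℤ) (β : ℝ) :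
    aFun μ η n β ≤ |(n : ℝ)| * μ := by
  refine Real.sqrt_le_iff.2 ⟨by positivity, ?_⟩
  rw [mul_pow, sq_abs]
  nlinarith [(hη.range β).1]

theorem radicand_pos (hμ : 1 < μ) (hη : IsCutoff η) (hn : n ≠ 0) (β : ℝ) :
    0 < (n : ℝ) ^ 2 * μ ^ 2 - (2 * μ - 1) * η β :=
  Real.sqrt_pos.1 (aFun_pos hμ hη hn β)

theorem sq_aFun (hμ : 1 < μ) (hη : IsCutoff η) (hn : n ≠ 0) (β : ℝ) :
    aFun μ η n β ^ 2 = (n : ℝ) ^ 2 * μ ^ 2 - (2 * μ - 1) * η β :=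
  Real.sq_sqrt (radicand_pos hμ hη hn β).le

theorem alphaInf_sub_lower (hμ : 1 < μ) :
    ∃ k : ℝ, 0 < k ∧ ∀ n : ℤ, 2 ≤ |n| → k * |(n : ℝ)| ≤ alphaInf μ n - (2 * μ - 1) := by
  have h2 : 2 * μ - 1 < alphaInf μ 2 := by
    refine Real.lt_sqrt_of_sq_lt ?_
    push_cast
    nlinarith
  refine ⟨(alphaInf μ 2 - (2 * μ - 1)) / 2, by linarith, fun n hn => ?_⟩
  have hn' : (2 : ℝ) ≤ |(n : ℝ)| := by exact_mod_cast hn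
  have h3 : |(n : ℝ)| / 2 * alphaInf μ 2 ≤ alphaInf μ n := by
    refine Real.le_sqrt_of_sq_le ?_
    have h4 := sq_alphaInf (n := 2) hμ two_ne_zero
    push_cast at h4
    rw [mul_pow, h4, div_pow, sq_abs]
    have h5 : (4 : ℝ) ≤ (n : ℝ) ^ 2 := by rw [← sq_abs]; nlinarith
    nlinarith
  nlinarith

theorem contDiff_aFun (hμ : 1 < μ) (hη : IsCutoff η) (hn : n ≠ 0) :
    ContDiff ℝ (⊤ : ℕ∞) (aFun μ η n) := by
  refine ContDiff.sqrt ?_ fun β => (radicand_pos hμ hη hn β).ne'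
  have := hη.smooth
  fun_prop

theorem continuous_aFun (hμ : 1 < μ) (hη : IsCutoff η) (hn : n ≠ 0) : Continuous (aFun μ η n) :=
  (contDiff_aFun hμ hη hn).continuous

theorem IsCutoff.hasDerivAt (hη : IsCutoff η) (β : ℝ) : HasDerivAt η (deriv η β) β :=
  (hη.smooth.differentiable (by simp) β).hasDerivAt

theorem IsCutoff.contDiff_deriv (hη : IsCutoff η) : ContDiff ℝ (⊤ : ℕ∞) (deriv η) := by
  have h := hη.smooth
  rw [show ((⊤ : ℕ∞) : WithTop ℕ∞) = ((⊤ : ℕ∞) : WithTop ℕ∞) + 1 from rfl,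
    contDiff_succ_iff_deriv] at h
  exact h.2.2

theorem IsCutoff.hasDerivAt_deriv (hη : IsCutoff η) (β : ℝ) :
    HasDerivAt (deriv η) (deriv (deriv η) β) β :=
  (hη.contDiff_deriv.differentiable (by simp) β).hasDerivAt

theorem hasDerivAt_aFun (hμ : 1 < μ) (hη : IsCutoff η) (hn : n ≠ 0) (β : ℝ) :
    HasDerivAt (aFun μ η n) (-((2 * μ - 1) * deriv η β) / (2 * aFun μ η n β)) β :=
  (((hη.hasDerivAt β).const_mul (2 * μ - 1)).const_sub _).sqrt (radicand_pos hμ hη hn β).ne'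

theorem IsCutoff.deriv_of_le_one (hη : IsCutoff η) {β : ℝ} (hβ : β ≤ 1) : deriv η β = 0 := by
  have h := (hη.hasDerivAt β).hasDerivWithinAt (s := Iic 1)
  have h2 : HasDerivWithinAt η 0 (Iic 1) β :=
    (hasDerivWithinAt_const β (Iic 1) (0 : ℝ)).congr (fun x hx => hη.eq_zero x hx)
      (hη.eq_zero β hβ)
  exact (uniqueDiffOn_Iic (1 : ℝ) β hβ).eq_deriv _ h h2

theorem IsCutoff.deriv_of_two_le (hη : IsCutoff η) {β : ℝ} (hβ : 2 ≤ β) : deriv η β = 0 := by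
  have h := (hη.hasDerivAt β).hasDerivWithinAt (s := Ici 2)
  have h2 : HasDerivWithinAt η 0 (Ici 2) β :=
    (hasDerivWithinAt_const β (Ici 2) (1 : ℝ)).congr (fun x hx => hη.eq_one x hx)
      (hη.eq_one β hβ)
  exact (uniqueDiffOn_Ici (2 : ℝ) β hβ).eq_deriv _ h h2

theorem chiFun_of_le_one (hη : IsCutoff η) {β : ℝ} (hβ : β ≤ 1) : chiFun μ η n β = 0 := by
  simp [chiFun, hη.eq_zero β hβ, hη.deriv_of_le_one hβ]

theorem chiFun_of_two_le (hη : IsCutoff η) {β : ℝ} (hβ : 2 ≤ β) : chiFun μ η n β = 1 := by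
  simp [chiFun, hη.eq_one β hβ, hη.deriv_of_two_le hβ]

theorem contDiff_chiFun (hμ : 1 < μ) (hη : IsCutoff η) (hn : n ≠ 0) :
    ContDiff ℝ (⊤ : ℕ∞) (chiFun μ η n) := by
  have h1 := hη.smooth
  have h2 := hη.contDiff_deriv
  have h3 := contDiff_aFun hμ hη hn
  refine h1.sub ((contDiff_id.mul h2).div (contDiff_const.mul h3) fun β => ?_)
  exact mul_ne_zero two_ne_zero (aFun_pos hμ hη hn β).ne'

theorem differentiable_chiFun (hμ : 1 < μ) (hη : IsCutoff η) (hn : n ≠ 0) :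
    Differentiable ℝ (chiFun μ η n) :=
  (contDiff_chiFun hμ hη hn).differentiable (by simp)

theorem continuous_deriv_chiFun (hμ : 1 < μ) (hη : IsCutoff η) (hn : n ≠ 0) :
    Continuous (deriv (chiFun μ η n)) :=
  (contDiff_chiFun hμ hη hn).continuous_deriv (by simp)

theorem deriv_chiFun (hμ : 1 < μ) (hη : IsCutoff η) (hn : n ≠ 0) (β : ℝ) :
    deriv (chiFun μ η n) β = deriv η β -
      (deriv η β + β * deriv (deriv η) β) * (2 * aFun μ η n β)⁻¹ -
      β * deriv η β ^ 2 * (2 * (2 * μ - 1)) * (2 * aFun μ η n β)⁻¹ ^ 3 := by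
  have ha := (aFun_pos hμ hη hn β).ne'
  have h := (hη.hasDerivAt β).sub (((hasDerivAt_id β).mul (hη.hasDerivAt_deriv β)).div
    ((hasDerivAt_aFun hμ hη hn β).const_mul 2) (mul_ne_zero two_ne_zero ha))
  have h1 : HasDerivAt (chiFun μ η n) _ β := h
  rw [h1.deriv]
  simp only [id, Pi.mul_apply]
  field_simp
  ring

theorem deriv_chiFun_eq_zero (hη : IsCutoff η) {β : ℝ} (hβ : β ∉ Icc (1 : ℝ) 2) :
    deriv (chiFun μ η n) β = 0 := by
  rcases lt_or_ge β 1 with h | h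
  · have : chiFun μ η n =ᶠ[𝓝 β] fun _ => 0 := by
      filter_upwards [Iio_mem_nhds h] with x hx using chiFun_of_le_one hη (le_of_lt hx)
    rw [this.deriv_eq, deriv_const]
  · have h2 : 2 < β := by
      by_contra! h2
      exact hβ ⟨h, h2⟩
    have : chiFun μ η n =ᶠ[𝓝 β] fun _ => 1 := by
      filter_upwards [Ioi_mem_nhds h2] with x hx using chiFun_of_two_le hη (le_of_lt hx)
    rw [this.deriv_eq, deriv_const]

theorem exists_chiFun_bound (hμ : 1 < μ) (hη : IsCutoff η) :
    ∃ X : ℝ, 1 ≤ X ∧ ∀ n : ℤ, n ≠ 0 → ∀ β, |chiFun μ η n β| ≤ X ∧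
      |β * deriv (chiFun μ η n) β| ≤ X ∧ |deriv (chiFun μ η n) β| ≤ X := by
  obtain ⟨E, hE⟩ := isCompact_Icc.exists_bound_of_continuousOn (s := Icc (1 : ℝ) 2)
    (f := fun x => |deriv η x| + |deriv (deriv η) x|)
    (((hη.contDiff_deriv.continuous).abs.add
      ((hη.contDiff_deriv.continuous_deriv (by simp)).abs)).continuousOn)
  have hE0 : 0 ≤ E := (norm_nonneg _).trans (hE 1 (by norm_num))
  set R : ℝ := (2 * (μ - 1))⁻¹ with hR
  have hR0 : 0 < R := by rw [hR]; apply inv_pos.2; linarith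
  set Q : ℝ := E + (E + 2 * E) * R + 2 * E ^ 2 * (2 * (2 * μ - 1)) * R ^ 3 with hQ
  have hc : 0 < 2 * μ - 1 := by linarith
  have hQ0 : 0 ≤ Q := by positivity
  have hX0 : 0 ≤ E * R := by positivity
  refine ⟨1 + 2 * E * R + 2 * Q, by linarith, fun n hn β => ?_⟩
  by_cases hβ : β ∈ Icc (1 : ℝ) 2
  · have ha : 0 < aFun μ η n β := aFun_pos hμ hη hn β
    have hr0 : 0 ≤ (2 * aFun μ η n β)⁻¹ := by positivity
    have hrR : (2 * aFun μ η n β)⁻¹ ≤ R := by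
      refine inv_anti₀ (by linarith) ?_
      linarith [sub_one_le_alphaInf hμ hn, alphaInf_le_aFun hμ hη n β]
    have hEβ := hE β hβ
    rw [Real.norm_of_nonneg (by positivity)] at hEβ
    have hβ0 : 0 ≤ β := by linarith [hβ.1]
    have hβ2 : |β| ≤ 2 := by rw [abs_of_nonneg hβ0]; exact hβ.2
    have e1 : |deriv η β| ≤ E := by linarith [abs_nonneg (deriv (deriv η) β)]
    have e2 : |deriv (deriv η) β| ≤ E := by linarith [abs_nonneg (deriv η β)]
    have hχ' : |deriv (chiFun μ η n) β| ≤ Q := by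
      rw [deriv_chiFun hμ hη hn]
      refine (abs_sub _ _).trans (add_le_add ((abs_sub _ _).trans (add_le_add e1 ?_)) ?_)
      · rw [abs_mul, abs_of_nonneg hr0]
        refine mul_le_mul ((abs_add_le _ _).trans (add_le_add e1 ?_)) hrR hr0 (by positivity)
        rw [abs_mul]
        exact mul_le_mul hβ2 e2 (abs_nonneg _) two_pos.le
      · rw [abs_mul, abs_mul, abs_mul, abs_pow, abs_pow, abs_of_nonneg hr0,
          abs_of_pos (by positivity : (0 : ℝ) < 2 * (2 * μ - 1))]
        gcongr
    refine ⟨?_, ?_, by linarith⟩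
    · have h1 : |chiFun μ η n β| ≤ 1 + 2 * E * R := by
        rw [chiFun, div_eq_mul_inv]
        refine (abs_sub _ _).trans (add_le_add ?_ ?_)
        · rw [abs_of_nonneg (hη.range β).1]
          exact (hη.range β).2
        · rw [abs_mul, abs_mul, abs_of_nonneg hr0]
          gcongr
      linarith
    · rw [abs_mul]
      have : |β| * |deriv (chiFun μ η n) β| ≤ 2 * Q := by gcongr
      linarith
  · rw [deriv_chiFun_eq_zero hη hβ]
    refine ⟨?_, by simp; linarith, by simp; linarith⟩
    rcases lt_or_ge β 1 with h | h
    · rw [chiFun_of_le_one hη h.le]; simp; linarith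
    · have h2 : 2 ≤ β := by
        by_contra! h2
        exact hβ ⟨h, h2.le⟩
      rw [chiFun_of_two_le hη h2]; simp; linarith

/-! ### The weight `W` -/

theorem WFun_pos (β : ℝ) : 0 < WFun μ η n β := Real.exp_pos _

theorem continuousOn_aFun_div (hμ : 1 < μ) (hη : IsCutoff η) (hn : n ≠ 0) :
    ContinuousOn (fun b => aFun μ η n b / b) (Ioi 0) :=
  (continuous_aFun hμ hη hn).continuousOn.div continuousOn_id fun _ hx => (mem_Ioi.1 hx).ne'

theorem uIcc_subset_Ioi_zero {a b : ℝ} (ha : 0 < a) (hb : 0 < b) : uIcc a b ⊆ Ioi 0 :=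
  fun _ hx => (lt_min ha hb).trans_le hx.1

theorem intervalIntegrable_aFun_div (hμ : 1 < μ) (hη : IsCutoff η) (hn : n ≠ 0) {a b : ℝ}
    (ha : 0 < a) (hb : 0 < b) : IntervalIntegrable (fun b => aFun μ η n b / b) volume a b :=
  ((continuousOn_aFun_div hμ hη hn).mono (uIcc_subset_Ioi_zero ha hb)).intervalIntegrable

theorem hasDerivAt_WFun (hμ : 1 < μ) (hη : IsCutoff η) (hn : n ≠ 0) {β : ℝ} (hβ : 0 < β) :
    HasDerivAt (WFun μ η n) (WFun μ η n β * (aFun μ η n β / β)) β := by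
  refine HasDerivAt.exp ?_
  have hc := continuousOn_aFun_div hμ hη hn
  exact integral_hasDerivAt_right (intervalIntegrable_aFun_div hμ hη hn one_pos hβ)
    (hc.stronglyMeasurableAtFilter isOpen_Ioi β hβ) (hc.continuousAt (Ioi_mem_nhds hβ))

theorem WFun_div (hμ : 1 < μ) (hη : IsCutoff η) (hn : n ≠ 0) {b β : ℝ} (hb : 0 < b)
    (hβ : 0 < β) : WFun μ η n β / WFun μ η n b = Real.exp (∫ x in b..β, aFun μ η n x / x) := by
  rw [WFun, WFun, ← Real.exp_sub]
  congr 1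
  rw [integral_interval_sub_left (intervalIntegrable_aFun_div hμ hη hn one_pos hβ)
    (intervalIntegrable_aFun_div hμ hη hn one_pos hb)]

theorem integral_const_div_of_pos {b β : ℝ} (c : ℝ) (hb : 0 < b) (hβ : 0 < β) :
    Real.exp (∫ x in b..β, c / x) = β ^ c * b ^ (-c) := by
  simp_rw [div_eq_mul_inv]
  rw [intervalIntegral.integral_const_mul, integral_inv_of_pos hb hβ, Real.log_div hβ.ne' hb.ne',
    Real.rpow_def_of_pos hβ, Real.rpow_def_of_pos hb, ← Real.exp_add]
  congr 1
  ring

theorem WFun_div_le (hμ : 1 < μ) (hη : IsCutoff η) (hn : n ≠ 0) {b β : ℝ} (hb : 0 < b)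
    (h : b ≤ β) : WFun μ η n b / WFun μ η n β ≤ b ^ alphaInf μ n * β ^ (-alphaInf μ n) := by
  have hβ := hb.trans_le h
  rw [WFun_div hμ hη hn hβ hb, ← integral_const_div_of_pos _ hβ hb, integral_symm b β,
    integral_symm b β]
  refine Real.exp_le_exp.2 (neg_le_neg (integral_mono_on h ?_
    (intervalIntegrable_aFun_div hμ hη hn hb hβ) fun x hx => ?_))
  · refine ContinuousOn.intervalIntegrable (continuousOn_const.div continuousOn_id fun x hx => ?_)
    exact (uIcc_subset_Ioi_zero hb hβ hx).ne'
  · have hx0 : 0 < x := hb.trans_le hx.1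
    exact div_le_div_of_nonneg_right (alphaInf_le_aFun hμ hη n x) hx0.le

theorem WFun_div_le_of_ge (hμ : 1 < μ) (hη : IsCutoff η) (hn : n ≠ 0) {b β : ℝ} (hb : 0 < b)
    (h : b ≤ β) :
    WFun μ η n β / WFun μ η n b ≤ β ^ (|(n : ℝ)| * μ) * b ^ (-(|(n : ℝ)| * μ)) := by
  have hβ := hb.trans_le h
  rw [WFun_div hμ hη hn hb hβ, ← integral_const_div_of_pos _ hb hβ]
  refine Real.exp_le_exp.2 (integral_mono_on h (intervalIntegrable_aFun_div hμ hη hn hb hβ) ?_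
    fun x hx => ?_)
  · refine ContinuousOn.intervalIntegrable (continuousOn_const.div continuousOn_id fun x hx => ?_)
    exact (uIcc_subset_Ioi_zero hb hβ hx).ne'
  · have hx0 : 0 < x := hb.trans_le hx.1
    exact div_le_div_of_nonneg_right (aFun_le hμ hη n x) hx0.le

end Coefficients

/-! ### Integrals with a power bound -/

theorem integrableOn_Ioi_of_rpow {A : ℝ → ℂ} (hA : ContinuousOn A (Ioi 0)) {β K s : ℝ}
    (hβ : 0 < β) (hs : 0 < s) (h : ∀ b, β < b → ‖A b‖ ≤ K * b ^ (-1 - s)) :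
    IntegrableOn A (Ioi β) := by
  refine Integrable.mono' ((integrableOn_Ioi_rpow_of_lt (by linarith : -1 - s < -1) hβ).const_mul K)
    ((hA.mono (Ioi_subset_Ioi hβ.le)).aestronglyMeasurable measurableSet_Ioi) ?_
  filter_upwards [ae_restrict_mem measurableSet_Ioi] with b hb using h b hb

theorem norm_integral_Ioi_le_rpow {A : ℝ → ℂ} {β K s : ℝ} (hβ : 0 < β) (hs : 0 < s)
    (h : ∀ b, β < b → ‖A b‖ ≤ K * b ^ (-1 - s)) : ‖∫ b in Ioi β, A b‖ ≤ K * (β ^ (-s) / s) := by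
  have h1 : -1 - s < -1 := by linarith
  have h2 : ‖∫ b in Ioi β, A b‖ ≤ ∫ b in Ioi β, K * b ^ (-1 - s) := by
    refine MeasureTheory.norm_integral_le_of_norm_le
      ((integrableOn_Ioi_rpow_of_lt h1 hβ).const_mul K) ?_
    filter_upwards [ae_restrict_mem measurableSet_Ioi] with b hb using h b hb
  rw [MeasureTheory.integral_const_mul, integral_Ioi_rpow_of_lt h1 hβ] at h2
  have h3 : -1 - s + 1 = -s := by ring
  rwa [h3, neg_div_neg_eq] at h2

theorem intervalIntegrable_of_rpow {A : ℝ → ℂ} (hA : ContinuousOn A (Ioi 0)) {β K s : ℝ}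
    (hβ : 0 < β) (hs : 0 < s) (h : ∀ b, 0 < b → b ≤ β → ‖A b‖ ≤ K * b ^ (s - 1)) :
    IntervalIntegrable A volume 0 β := by
  rw [intervalIntegrable_iff_integrableOn_Ioc_of_le hβ.le]
  have h1 := (intervalIntegrable_rpow' (a := 0) (b := β) (by linarith : -1 < s - 1)).const_mul K
  rw [intervalIntegrable_iff_integrableOn_Ioc_of_le hβ.le] at h1
  refine Integrable.mono' h1
    ((hA.mono Ioc_subset_Ioi_self).aestronglyMeasurable measurableSet_Ioc) ?_
  filter_upwards [ae_restrict_mem measurableSet_Ioc] with b hb using h b hb.1 hb.2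

theorem norm_integral_zero_le_rpow {A : ℝ → ℂ} {β K s : ℝ} (hβ : 0 < β) (hs : 0 < s)
    (h : ∀ b, 0 < b → b ≤ β → ‖A b‖ ≤ K * b ^ (s - 1)) :
    ‖∫ b in (0 : ℝ)..β, A b‖ ≤ K * (β ^ s / s) := by
  have h1 := (intervalIntegrable_rpow' (a := 0) (b := β) (by linarith : -1 < s - 1)).const_mul K
  have h2 := intervalIntegral.norm_integral_le_of_norm_le (μ := volume) hβ.le
    (Eventually.of_forall fun t (ht : t ∈ Ioc 0 β) => h t ht.1 ht.2) h1
  rw [intervalIntegral.integral_const_mul, integral_rpow (Or.inl (by linarith : -1 < s - 1)),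
    sub_add_cancel, Real.zero_rpow hs.ne', sub_zero] at h2
  exact h2

theorem hasDerivAt_integral_Ioi {A : ℝ → ℂ} (hA : ContinuousOn A (Ioi 0))
    (hint : ∀ b, 0 < b → IntegrableOn A (Ioi b)) {β : ℝ} (hβ : 0 < β) :
    HasDerivAt (fun x => ∫ b in Ioi x, A b) (-A β) β := by
  have h1 : HasDerivAt (fun x => ∫ b in β..x, A b) (A β) β :=
    integral_hasDerivAt_right (by simp)
      (hA.stronglyMeasurableAtFilter isOpen_Ioi β hβ) (hA.continuousAt (Ioi_mem_nhds hβ))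
  refine (h1.const_sub (∫ b in Ioi β, A b)).congr_of_eventuallyEq ?_
  filter_upwards [Ioi_mem_nhds hβ] with x hx
  rw [← integral_Ioi_sub_Ioi' (hint β hβ) (hint x hx)]
  ring

theorem hasDerivAt_integral_zero {A : ℝ → ℂ} (hA : ContinuousOn A (Ioi 0)) {β : ℝ} (hβ : 0 < β)
    (hint : IntervalIntegrable A volume 0 β) :
    HasDerivAt (fun x => ∫ b in (0 : ℝ)..x, A b) (A β) β :=
  integral_hasDerivAt_right hint
    (hA.stronglyMeasurableAtFilter isOpen_Ioi β hβ) (hA.continuousAt (Ioi_mem_nhds hβ))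

theorem norm_phase (n : ℤ) (x y : ℝ) :
    ‖Complex.exp (Complex.I * (n : ℂ) * ((x : ℂ) - (y : ℂ)))‖ = 1 := by
  rw [show Complex.I * (n : ℂ) * ((x : ℂ) - (y : ℂ)) = ((n * (x - y) : ℝ) : ℂ) * Complex.I by
    push_cast; ring, Complex.norm_exp_ofReal_mul_I]

theorem norm_phase_zero (n : ℤ) (x : ℝ) : ‖Complex.exp (Complex.I * (n : ℂ) * (x : ℂ))‖ = 1 := by
  simpa using norm_phase n x 0

/-- The homogeneous solution `β^{2μ-1} W_n(β) e^{inβ}`. -/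
noncomputable def growMode (μ : ℝ) (η : ℝ → ℝ) (n : ℤ) (β : ℝ) : ℂ :=
  ((β ^ (2 * μ - 1) * WFun μ η n β : ℝ) : ℂ) * Complex.exp (Complex.I * (n : ℂ) * (β : ℂ))

/-- The homogeneous solution `β^{2μ-1} W_n(β)^{-1} e^{inβ}`. -/
noncomputable def decayMode (μ : ℝ) (η : ℝ → ℝ) (n : ℤ) (β : ℝ) : ℂ :=
  ((β ^ (2 * μ - 1) / WFun μ η n β : ℝ) : ℂ) * Complex.exp (Complex.I * (n : ℂ) * (β : ℂ))

section Resolvents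

variable {μ : ℝ} {η : ℝ → ℝ} {n : ℤ}

theorem norm_growMode {β : ℝ} (hβ : 0 < β) :
    ‖growMode μ η n β‖ = β ^ (2 * μ - 1) * WFun μ η n β := by
  have := WFun_pos (μ := μ) (η := η) (n := n) β
  rw [growMode, norm_mul, norm_phase_zero, mul_one, Complex.norm_real,
    Real.norm_of_nonneg (by positivity)]

theorem norm_decayMode {β : ℝ} (hβ : 0 < β) :
    ‖decayMode μ η n β‖ = β ^ (2 * μ - 1) / WFun μ η n β := by
  have := WFun_pos (μ := μ) (η := η) (n := n) β
  rw [decayMode, norm_mul, norm_phase_zero, mul_one, Complex.norm_real,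
    Real.norm_of_nonneg (by positivity)]

theorem growMode_ne_zero {β : ℝ} (hβ : 0 < β) : growMode μ η n β ≠ 0 := by
  have := WFun_pos (μ := μ) (η := η) (n := n) β
  rw [← norm_pos_iff, norm_growMode hβ]
  positivity

theorem decayMode_ne_zero {β : ℝ} (hβ : 0 < β) : decayMode μ η n β ≠ 0 := by
  have := WFun_pos (μ := μ) (η := η) (n := n) β
  rw [← norm_pos_iff, norm_decayMode hβ]
  positivity

theorem hasDerivAt_phase (n : ℤ) (β : ℝ) :
    HasDerivAt (fun β : ℝ => Complex.exp (Complex.I * (n : ℂ) * (β : ℂ)))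
      (Complex.exp (Complex.I * (n : ℂ) * (β : ℂ)) * (Complex.I * n)) β := by
  have h : HasDerivAt (fun q : ℝ => (q : ℂ)) 1 β := by
    simpa using (hasDerivAt_id β).ofReal_comp
  simpa using (h.const_mul (Complex.I * (n : ℂ))).cexp

theorem hasDerivAt_growMode (hμ : 1 < μ) (hη : IsCutoff η) (hn : n ≠ 0) {β : ℝ} (hβ : 0 < β) :
    HasDerivAt (growMode μ η n)
      (growMode μ η n β * (Complex.I * n + ((2 * μ - 1 + aFun μ η n β : ℝ) : ℂ) / β)) β := by
  have h1 := (Real.hasDerivAt_rpow_const (p := 2 * μ - 1) (Or.inl hβ.ne')).mul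
    (hasDerivAt_WFun hμ hη hn hβ)
  refine (h1.ofReal_comp.mul (hasDerivAt_phase n β)).congr_deriv ?_
  have hβ' : (β : ℂ) ≠ 0 := by exact_mod_cast hβ.ne'
  rw [Real.rpow_sub_one hβ.ne', growMode]
  simp only [Pi.mul_apply]
  push_cast
  field_simp
  ring

theorem hasDerivAt_decayMode (hμ : 1 < μ) (hη : IsCutoff η) (hn : n ≠ 0) {β : ℝ} (hβ : 0 < β) :
    HasDerivAt (decayMode μ η n)
      (decayMode μ η n β * (Complex.I * n + ((2 * μ - 1 - aFun μ η n β : ℝ) : ℂ) / β)) β := by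
  have hW := (WFun_pos (μ := μ) (η := η) (n := n) β).ne'
  have h1 := (Real.hasDerivAt_rpow_const (p := 2 * μ - 1) (Or.inl hβ.ne')).div
    (hasDerivAt_WFun hμ hη hn hβ) hW
  refine (h1.ofReal_comp.mul (hasDerivAt_phase n β)).congr_deriv ?_
  have hβ' : (β : ℂ) ≠ 0 := by exact_mod_cast hβ.ne'
  have hW' : (WFun μ η n β : ℂ) ≠ 0 := by exact_mod_cast hW
  rw [Real.rpow_sub_one hβ.ne', decayMode]
  simp only [Pi.div_apply]
  push_cast
  field_simp
  ring

theorem phase_sub (n : ℤ) (x y : ℝ) : Complex.exp (Complex.I * (n : ℂ) * ((x : ℂ) - (y : ℂ))) =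
    Complex.exp (Complex.I * (n : ℂ) * (x : ℂ)) / Complex.exp (Complex.I * (n : ℂ) * (y : ℂ)) := by
  rw [← Complex.exp_sub, mul_sub]

theorem Lplus_eq (f : ℝ → ℂ) {β : ℝ} (hβ : 0 < β) :
    Lplus μ η n f β = growMode μ η n β * ∫ b in Ioi β, f b / (b * growMode μ η n b) := by
  rw [Lplus, growMode, mul_assoc,
    ← MeasureTheory.integral_const_mul (Complex.exp (Complex.I * (n : ℂ) * (β : ℂ)))]
  congr 1
  refine MeasureTheory.setIntegral_congr_fun measurableSet_Ioi fun b hb => ?_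
  have hb0 : 0 < b := hβ.trans hb
  have hb' : (b : ℂ) ≠ 0 := by exact_mod_cast hb0.ne'
  have hW : (WFun μ η n b : ℂ) ≠ 0 := by
    exact_mod_cast (WFun_pos (μ := μ) (η := η) (n := n) b).ne'
  have hp : ((b ^ (2 * μ - 1) : ℝ) : ℂ) ≠ 0 := by
    exact_mod_cast (Real.rpow_pos_of_pos hb0 _).ne'
  have he := Complex.exp_ne_zero (Complex.I * (n : ℂ) * (b : ℂ))
  have h1 : b ^ (-(2 * μ)) = b⁻¹ * (b ^ (2 * μ - 1))⁻¹ := by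
    rw [← Real.rpow_neg_one, ← Real.rpow_neg hb0.le, ← Real.rpow_add hb0]
    congr 1
    ring
  simp only [growMode, phase_sub]
  rw [h1]
  push_cast
  field_simp

theorem kernel_decayMode (f : ℝ → ℂ) (β : ℝ) {b : ℝ} (hb0 : 0 < b) :
    ((b ^ (-(2 * μ)) * WFun μ η n b : ℝ) : ℂ) *
        Complex.exp (Complex.I * (n : ℂ) * ((β : ℂ) - (b : ℂ))) * f b =
      Complex.exp (Complex.I * (n : ℂ) * (β : ℂ)) * (f b / (b * decayMode μ η n b)) := by
  have hb' : (b : ℂ) ≠ 0 := by exact_mod_cast hb0.ne'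
  have hW : (WFun μ η n b : ℂ) ≠ 0 := by
    exact_mod_cast (WFun_pos (μ := μ) (η := η) (n := n) b).ne'
  have hp : ((b ^ (2 * μ - 1) : ℝ) : ℂ) ≠ 0 := by
    exact_mod_cast (Real.rpow_pos_of_pos hb0 _).ne'
  have he := Complex.exp_ne_zero (Complex.I * (n : ℂ) * (b : ℂ))
  have h1 : b ^ (-(2 * μ)) = b⁻¹ * (b ^ (2 * μ - 1))⁻¹ := by
    rw [← Real.rpow_neg_one, ← Real.rpow_neg hb0.le, ← Real.rpow_add hb0]
    congr 1
    ring
  simp only [decayMode, phase_sub]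
  rw [h1]
  push_cast
  field_simp

theorem Lminus_eq_of_two_le (hn2 : 2 ≤ |n|) (f : ℝ → ℂ) {β : ℝ} (hβ : 0 < β) :
    Lminus μ η n f β =
      -(decayMode μ η n β * ∫ b in (0 : ℝ)..β, f b / (b * decayMode μ η n b)) := by
  rw [Lminus, if_pos hn2, decayMode, mul_assoc,
    ← intervalIntegral.integral_const_mul (Complex.exp (Complex.I * (n : ℂ) * (β : ℂ)))]
  congr 2
  rw [integral_of_le hβ.le, integral_of_le hβ.le]
  exact MeasureTheory.setIntegral_congr_fun measurableSet_Ioc fun b hb =>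
    kernel_decayMode f β hb.1

theorem Lminus_eq_of_not_two_le (hn2 : ¬ 2 ≤ |n|) (f : ℝ → ℂ) {β : ℝ} (hβ : 0 < β) :
    Lminus μ η n f β = decayMode μ η n β * ∫ b in Ioi β, f b / (b * decayMode μ η n b) := by
  rw [Lminus, if_neg hn2, decayMode, mul_assoc,
    ← MeasureTheory.integral_const_mul (Complex.exp (Complex.I * (n : ℂ) * (β : ℂ)))]
  congr 1
  exact MeasureTheory.setIntegral_congr_fun measurableSet_Ioi fun b hb =>
    kernel_decayMode f β (hβ.trans hb)

theorem continuousOn_div_growMode (hμ : 1 < μ) (hη : IsCutoff η) (hn : n ≠ 0) {f : ℝ → ℂ}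
    (hf : ContinuousOn f (Ioi 0)) :
    ContinuousOn (fun b => f b / (b * growMode μ η n b)) (Ioi 0) := by
  have hE : ContinuousOn (growMode μ η n) (Ioi 0) := fun b hb =>
    (hasDerivAt_growMode hμ hη hn hb).continuousAt.continuousWithinAt
  refine hf.div (Complex.continuous_ofReal.continuousOn.mul hE) fun b hb => ?_
  exact mul_ne_zero (by exact_mod_cast (mem_Ioi.1 hb).ne') (growMode_ne_zero hb)

theorem continuousOn_div_decayMode (hμ : 1 < μ) (hη : IsCutoff η) (hn : n ≠ 0) {f : ℝ → ℂ}
    (hf : ContinuousOn f (Ioi 0)) :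
    ContinuousOn (fun b => f b / (b * decayMode μ η n b)) (Ioi 0) := by
  have hE : ContinuousOn (decayMode μ η n) (Ioi 0) := fun b hb =>
    (hasDerivAt_decayMode hμ hη hn hb).continuousAt.continuousWithinAt
  refine hf.div (Complex.continuous_ofReal.continuousOn.mul hE) fun b hb => ?_
  exact mul_ne_zero (by exact_mod_cast (mem_Ioi.1 hb).ne') (decayMode_ne_zero hb)

/-! ### The resolvent `L_{n,+}^{-1}` -/

theorem norm_div_growMode_le (hμ : 1 < μ) (hη : IsCutoff η) (hn : n ≠ 0) {f : ℝ → ℂ}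
    {N r β b : ℝ} (hβ : 0 < β) (hb : β ≤ b) (hf : ‖f b‖ ≤ N * b ^ r) :
    ‖f b / (b * growMode μ η n b)‖ ≤ N * β ^ alphaInf μ n / WFun μ η n β *
      b ^ (-1 - (2 * μ - 1 + alphaInf μ n - r)) := by
  have hb0 : 0 < b := hβ.trans_le hb
  have hWb := WFun_pos (μ := μ) (η := η) (n := n) b
  have hWβ := WFun_pos (μ := μ) (η := η) (n := n) β
  have h1 := WFun_div_le hμ hη hn hβ hb
  rw [div_le_iff₀ hWb] at h1
  rw [norm_div, norm_mul, Complex.norm_real, Real.norm_of_nonneg hb0.le, norm_growMode hb0]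
  have h2 : b ^ (-1 - (2 * μ - 1 + alphaInf μ n - r)) =
      b⁻¹ * (b ^ (2 * μ - 1))⁻¹ * b ^ (-alphaInf μ n) * b ^ r := by
    rw [← Real.rpow_neg_one, ← Real.rpow_neg hb0.le, ← Real.rpow_add hb0, ← Real.rpow_add hb0,
      ← Real.rpow_add hb0]
    congr 1
    ring
  have hp := Real.rpow_pos_of_pos hb0 (2 * μ - 1)
  have hN : 0 ≤ N * b ^ r := (norm_nonneg _).trans hf
  have h3 : (WFun μ η n b)⁻¹ ≤ β ^ alphaInf μ n * b ^ (-alphaInf μ n) / WFun μ η n β := by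
    rw [inv_le_iff_one_le_mul₀ hWb, div_mul_eq_mul_div, one_le_div hWβ]
    exact h1
  calc ‖f b‖ / (b * (b ^ (2 * μ - 1) * WFun μ η n b))
      = ‖f b‖ * (b⁻¹ * (b ^ (2 * μ - 1))⁻¹) * (WFun μ η n b)⁻¹ := by field_simp
    _ ≤ (N * b ^ r) * (b⁻¹ * (b ^ (2 * μ - 1))⁻¹) *
        (β ^ alphaInf μ n * b ^ (-alphaInf μ n) / WFun μ η n β) := by gcongr
    _ = _ := by rw [h2]; ring

theorem integrableOn_div_growMode (hμ : 1 < μ) (hη : IsCutoff η) (hn : n ≠ 0) {f : ℝ → ℂ}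
    {N r β : ℝ} (hβ : 0 < β) (hr : r ≤ 2 * μ - 1) (hfc : ContinuousOn f (Ioi 0))
    (hf : ∀ b, β < b → ‖f b‖ ≤ N * b ^ r) :
    IntegrableOn (fun b => f b / (b * growMode μ η n b)) (Ioi β) :=
  integrableOn_Ioi_of_rpow (continuousOn_div_growMode hμ hη hn hfc) hβ
    (by linarith [alphaInf_pos hμ hn])
    fun b hb => norm_div_growMode_le hμ hη hn hβ hb.le (hf b hb)

theorem norm_Lplus_le (hμ : 1 < μ) (hη : IsCutoff η) (hn : n ≠ 0) {f : ℝ → ℂ} {N r β : ℝ}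
    (hβ : 0 < β) (hN : 0 ≤ N) (hr : r ≤ 2 * μ - 1) (hf : ∀ b, β < b → ‖f b‖ ≤ N * b ^ r) :
    ‖Lplus μ η n f β‖ ≤ N / (|(n : ℝ)| * (μ - 1)) * β ^ r := by
  have hs : |(n : ℝ)| * (μ - 1) ≤ 2 * μ - 1 + alphaInf μ n - r := by
    linarith [abs_mul_le_alphaInf hμ hn]
  have hs0 : 0 < |(n : ℝ)| * (μ - 1) := by nlinarith [one_le_abs_cast hn]
  have h1 := norm_integral_Ioi_le_rpow hβ (hs0.trans_le hs) fun b hb =>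
    norm_div_growMode_le (η := η) hμ hη hn hβ hb.le (hf b hb)
  have hWβ := WFun_pos (μ := μ) (η := η) (n := n) β
  rw [Lplus_eq f hβ, norm_mul, norm_growMode hβ]
  have hβr := Real.rpow_pos_of_pos hβ r
  have h2 : β ^ (2 * μ - 1) * β ^ alphaInf μ n * β ^ (-(2 * μ - 1 + alphaInf μ n - r)) = β ^ r := by
    rw [← Real.rpow_add hβ, ← Real.rpow_add hβ]
    congr 1
    ring
  calc _ ≤ β ^ (2 * μ - 1) * WFun μ η n β * (N * β ^ alphaInf μ n / WFun μ η n β *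
        (β ^ (-(2 * μ - 1 + alphaInf μ n - r)) / (2 * μ - 1 + alphaInf μ n - r))) := by gcongr
    _ = N / (2 * μ - 1 + alphaInf μ n - r) *
        (β ^ (2 * μ - 1) * β ^ alphaInf μ n * β ^ (-(2 * μ - 1 + alphaInf μ n - r))) := by
      field_simp
    _ ≤ N / (|(n : ℝ)| * (μ - 1)) * β ^ r := by
      rw [h2]
      gcongr

theorem hasDerivAt_Lplus (hμ : 1 < μ) (hη : IsCutoff η) (hn : n ≠ 0) {f : ℝ → ℂ} {N β : ℝ}
    (hβ : 0 < β) (hfc : ContinuousOn f (Ioi 0)) (hf : ∀ b, 0 < b → ‖f b‖ ≤ N) :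
    HasDerivAt (Lplus μ η n f)
      ((Complex.I * n + ((2 * μ - 1 + aFun μ η n β : ℝ) : ℂ) / β) * Lplus μ η n f β - f β / β)
      β := by
  have hint : ∀ b, 0 < b → IntegrableOn (fun b => f b / (b * growMode μ η n b)) (Ioi b) :=
    fun b hb => integrableOn_div_growMode hμ hη hn (N := N) (r := 0) hb (by linarith) hfc
      fun x hx => by simpa using hf x (hb.trans hx)
  have h1 := (hasDerivAt_growMode hμ hη hn hβ).mul
    (hasDerivAt_integral_Ioi (continuousOn_div_growMode hμ hη hn hfc) hint hβ)
  refine (h1.congr_of_eventuallyEq ?_).congr_deriv ?_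
  · filter_upwards [Ioi_mem_nhds hβ] with x hx using Lplus_eq f hx
  · rw [Lplus_eq f hβ]
    have hE := growMode_ne_zero (μ := μ) (η := η) (n := n) hβ
    have hβ' : (β : ℂ) ≠ 0 := by exact_mod_cast hβ.ne'
    field_simp
    ring

theorem Lplus_add (hμ : 1 < μ) (hη : IsCutoff η) (hn : n ≠ 0) {f g : ℝ → ℂ} {N β : ℝ}
    (hβ : 0 < β) (hfc : ContinuousOn f (Ioi 0)) (hgc : ContinuousOn g (Ioi 0))
    (hf : ∀ b, 0 < b → ‖f b‖ ≤ N * b) (hg : ∀ b, 0 < b → ‖g b‖ ≤ N * b) :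
    Lplus μ η n (fun b => f b + g b) β = Lplus μ η n f β + Lplus μ η n g β := by
  have hint : ∀ h : ℝ → ℂ, ContinuousOn h (Ioi 0) → (∀ b, 0 < b → ‖h b‖ ≤ N * b) →
      IntegrableOn (fun b => h b / (b * growMode μ η n b)) (Ioi β) :=
    fun h hc hb => integrableOn_div_growMode hμ hη hn (N := N) (r := 1) hβ (by linarith) hc
      fun x hx => by simpa using hb x (hβ.trans hx)
  rw [Lplus_eq _ hβ, Lplus_eq _ hβ, Lplus_eq _ hβ, ← mul_add,
    ← MeasureTheory.integral_add (hint f hfc hf) (hint g hgc hg)]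
  simp_rw [add_div]

theorem Lplus_const_mul (c : ℂ) (f : ℝ → ℂ) {β : ℝ} (hβ : 0 < β) :
    Lplus μ η n (fun b => c * f b) β = c * Lplus μ η n f β := by
  rw [Lplus_eq _ hβ, Lplus_eq _ hβ, mul_left_comm, ← MeasureTheory.integral_const_mul c]
  simp_rw [mul_div_assoc]

theorem Lplus_congr {f g : ℝ → ℂ} {β : ℝ} (h : ∀ b, β < b → f b = g b) :
    Lplus μ η n f β = Lplus μ η n g β := by
  rw [Lplus, Lplus]
  congr 1
  exact MeasureTheory.setIntegral_congr_fun measurableSet_Ioi fun b hb => by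
    simp only [h b hb]

theorem Lplus_of_hasDerivAt (hμ : 1 < μ) (hη : IsCutoff η) (hn : n ≠ 0) {w dw h : ℝ → ℂ}
    {M N β : ℝ} (hβ : 0 < β) (hw : ∀ b, 0 < b → HasDerivAt w (dw b) b)
    (hwM : ∀ b, 0 < b → ‖w b‖ ≤ M) (hhc : ContinuousOn h (Ioi 0))
    (hh : ∀ b, 0 < b → h b = -b * dw b +
      (Complex.I * n * b + ((2 * μ - 1 + aFun μ η n b : ℝ) : ℂ)) * w b)
    (hhN : ∀ b, 0 < b → ‖h b‖ ≤ N * b) : Lplus μ η n h β = w β := by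
  have hint : IntegrableOn (fun b => h b / (b * growMode μ η n b)) (Ioi β) :=
    integrableOn_div_growMode hμ hη hn (N := N) (r := 1) hβ (by linarith) hhc
      fun x hx => by simpa using hhN x (hβ.trans hx)
  have hd : ∀ b ∈ Ici β, HasDerivAt (fun b => -(w b / growMode μ η n b))
      (h b / (b * growMode μ η n b)) b := by
    intro b hb
    have hb0 : 0 < b := hβ.trans_le hb
    have hE := growMode_ne_zero (μ := μ) (η := η) (n := n) hb0
    have hb' : (b : ℂ) ≠ 0 := by exact_mod_cast hb0.ne'
    refine ((hw b hb0).div (hasDerivAt_growMode hμ hη hn hb0) hE).neg.congr_deriv ?_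
    rw [hh b hb0]
    field_simp
    ring
  have hlim : Tendsto (fun b => -(w b / growMode μ η n b)) atTop (𝓝 0) := by
    have h0 : Tendsto (fun b : ℝ => M * β ^ alphaInf μ n / WFun μ η n β *
        b ^ (-(2 * μ - 1 + alphaInf μ n))) atTop (𝓝 0) := by
      simpa using (tendsto_rpow_neg_atTop
        (by linarith [alphaInf_pos hμ hn] : 0 < 2 * μ - 1 + alphaInf μ n)).const_mul
        (M * β ^ alphaInf μ n / WFun μ η n β)
    refine squeeze_zero_norm' ?_ h0
    filter_upwards [eventually_ge_atTop β] with b hb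
    have hb0 : 0 < b := hβ.trans_le hb
    have hb' : (b : ℂ) ≠ 0 := by exact_mod_cast hb0.ne'
    have h1 := norm_div_growMode_le (f := fun b => b * w b) (N := M) (r := 1) hμ hη hn hβ hb
      (by rw [norm_mul, Complex.norm_real, Real.norm_of_nonneg hb0.le, Real.rpow_one, mul_comm]
          exact mul_le_mul_of_nonneg_right (hwM b hb0) hb0.le)
    rw [mul_div_mul_left _ _ hb'] at h1
    rw [norm_neg]
    refine h1.trans_eq ?_
    congr 2
    ring
  rw [Lplus_eq h hβ, integral_Ioi_of_hasDerivAt_of_tendsto' hd hint hlim]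
  have hE := growMode_ne_zero (μ := μ) (η := η) (n := n) hβ
  field_simp
  ring

end Resolvents

/-! ### The resolvent `L_{n,-}^{-1}` -/

section MinusResolvent

variable {μ : ℝ} {η : ℝ → ℝ} {n : ℤ}

theorem norm_div_decayMode_le (hμ : 1 < μ) (hη : IsCutoff η) (hn : n ≠ 0) {f : ℝ → ℂ}
    {N r β b : ℝ} (hb0 : 0 < b) (hb : b ≤ β) (hf : ‖f b‖ ≤ N * b ^ r) :
    ‖f b / (b * decayMode μ η n b)‖ ≤ N * WFun μ η n β * β ^ (-alphaInf μ n) *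
      b ^ (alphaInf μ n - (2 * μ - 1) + r - 1) := by
  have hβ : 0 < β := hb0.trans_le hb
  have hWb := WFun_pos (μ := μ) (η := η) (n := n) b
  have hWβ := WFun_pos (μ := μ) (η := η) (n := n) β
  have h1 := WFun_div_le hμ hη hn hb0 hb
  rw [div_le_iff₀ hWβ] at h1
  rw [norm_div, norm_mul, Complex.norm_real, Real.norm_of_nonneg hb0.le, norm_decayMode hb0]
  have h2 : b ^ (alphaInf μ n - (2 * μ - 1) + r - 1) =
      b⁻¹ * (b ^ (2 * μ - 1))⁻¹ * b ^ (alphaInf μ n) * b ^ r := by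
    rw [← Real.rpow_neg_one, ← Real.rpow_neg hb0.le, ← Real.rpow_add hb0, ← Real.rpow_add hb0,
      ← Real.rpow_add hb0]
    congr 1
    ring
  have hp := Real.rpow_pos_of_pos hb0 (2 * μ - 1)
  have hN : 0 ≤ N * b ^ r := (norm_nonneg _).trans hf
  calc ‖f b‖ / (b * (b ^ (2 * μ - 1) / WFun μ η n b))
      = ‖f b‖ * (b⁻¹ * (b ^ (2 * μ - 1))⁻¹) * WFun μ η n b := by field_simp
    _ ≤ (N * b ^ r) * (b⁻¹ * (b ^ (2 * μ - 1))⁻¹) *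
        (b ^ alphaInf μ n * β ^ (-alphaInf μ n) * WFun μ η n β) := by gcongr
    _ = _ := by rw [h2]; ring

theorem norm_div_decayMode_le_of_ge (hμ : 1 < μ) (hη : IsCutoff η) (hn : n ≠ 0) {f : ℝ → ℂ}
    {N β b : ℝ} (hβ : 0 < β) (hb : β ≤ b) (hf : ‖f b‖ ≤ N) :
    ‖f b / (b * decayMode μ η n b)‖ ≤ N * WFun μ η n β * β ^ (-(|(n : ℝ)| * μ)) *
      b ^ (-1 - (2 * μ - 1 - |(n : ℝ)| * μ)) := by
  have hb0 : 0 < b := hβ.trans_le hb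
  have hWb := WFun_pos (μ := μ) (η := η) (n := n) b
  have hWβ := WFun_pos (μ := μ) (η := η) (n := n) β
  have h1 := WFun_div_le_of_ge hμ hη hn hβ hb
  rw [div_le_iff₀ hWβ] at h1
  rw [norm_div, norm_mul, Complex.norm_real, Real.norm_of_nonneg hb0.le, norm_decayMode hb0]
  have h2 : b ^ (-1 - (2 * μ - 1 - |(n : ℝ)| * μ)) =
      b⁻¹ * (b ^ (2 * μ - 1))⁻¹ * b ^ (|(n : ℝ)| * μ) := by
    rw [← Real.rpow_neg_one, ← Real.rpow_neg hb0.le, ← Real.rpow_add hb0, ← Real.rpow_add hb0]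
    congr 1
    ring
  have hp := Real.rpow_pos_of_pos hb0 (2 * μ - 1)
  have hN : 0 ≤ N := (norm_nonneg _).trans hf
  calc ‖f b‖ / (b * (b ^ (2 * μ - 1) / WFun μ η n b))
      = ‖f b‖ * (b⁻¹ * (b ^ (2 * μ - 1))⁻¹) * WFun μ η n b := by field_simp
    _ ≤ N * (b⁻¹ * (b ^ (2 * μ - 1))⁻¹) *
        (b ^ (|(n : ℝ)| * μ) * β ^ (-(|(n : ℝ)| * μ)) * WFun μ η n β) := by gcongr
    _ = _ := by rw [h2]; ring

theorem abs_eq_one_of_not_two_le (hn : n ≠ 0) (hn2 : ¬ 2 ≤ |n|) : |n| = 1 := by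
  have := Int.one_le_abs hn
  omega

theorem alphaInf_sub_pos (hμ : 1 < μ) (hn2 : 2 ≤ |n|) : 0 < alphaInf μ n - (2 * μ - 1) := by
  obtain ⟨k, hk, h⟩ := alphaInf_sub_lower hμ
  have h1 := h n hn2
  have h2 : (2 : ℝ) ≤ |(n : ℝ)| := by exact_mod_cast hn2
  nlinarith

theorem intervalIntegrable_div_decayMode (hμ : 1 < μ) (hη : IsCutoff η) (hn : n ≠ 0)
    (hn2 : 2 ≤ |n|) {f : ℝ → ℂ} {N β : ℝ} (hβ : 0 < β) (hfc : ContinuousOn f (Ioi 0))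
    (hf : ∀ b, 0 < b → ‖f b‖ ≤ N) :
    IntervalIntegrable (fun b => f b / (b * decayMode μ η n b)) volume 0 β :=
  intervalIntegrable_of_rpow (continuousOn_div_decayMode hμ hη hn hfc) hβ
    (s := alphaInf μ n - (2 * μ - 1) + 0) (by linarith [alphaInf_sub_pos hμ hn2])
    fun b hb0 hb => norm_div_decayMode_le hμ hη hn hb0 hb (N := N) (by simpa using hf b hb0)

theorem integrableOn_div_decayMode (hμ : 1 < μ) (hη : IsCutoff η) (hn : n ≠ 0)
    (hn2 : ¬ 2 ≤ |n|) {f : ℝ → ℂ} {N β : ℝ} (hβ : 0 < β) (hfc : ContinuousOn f (Ioi 0))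
    (hf : ∀ b, 0 < b → ‖f b‖ ≤ N) :
    IntegrableOn (fun b => f b / (b * decayMode μ η n b)) (Ioi β) := by
  have h1 : |(n : ℝ)| = 1 := by exact_mod_cast abs_eq_one_of_not_two_le hn hn2
  exact integrableOn_Ioi_of_rpow (continuousOn_div_decayMode hμ hη hn hfc) hβ
    (s := 2 * μ - 1 - |(n : ℝ)| * μ) (by rw [h1]; linarith)
    fun b hb => norm_div_decayMode_le_of_ge hμ hη hn hβ hb.le (hf b (hβ.trans hb))

theorem norm_Lminus_le_of_two_le (hμ : 1 < μ) (hη : IsCutoff η) (hn : n ≠ 0) (hn2 : 2 ≤ |n|)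
    {f : ℝ → ℂ} {N r β : ℝ} (hβ : 0 < β) (hN : 0 ≤ N) (hr : 0 ≤ r)
    (hf : ∀ b, 0 < b → ‖f b‖ ≤ N * b ^ r) :
    ‖Lminus μ η n f β‖ ≤ N / (alphaInf μ n - (2 * μ - 1)) * β ^ r := by
  have hs0 := alphaInf_sub_pos hμ hn2
  have h1 := norm_integral_zero_le_rpow hβ (s := alphaInf μ n - (2 * μ - 1) + r) (by linarith)
    fun b hb0 hb => norm_div_decayMode_le (η := η) hμ hη hn hb0 hb (hf b hb0)
  have hWβ := WFun_pos (μ := μ) (η := η) (n := n) β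
  rw [Lminus_eq_of_two_le hn2 f hβ, norm_neg, norm_mul, norm_decayMode hβ]
  have hβr := Real.rpow_pos_of_pos hβ r
  have h2 : β ^ (2 * μ - 1) * β ^ (-alphaInf μ n) * β ^ (alphaInf μ n - (2 * μ - 1) + r) =
      β ^ r := by
    rw [← Real.rpow_add hβ, ← Real.rpow_add hβ]
    congr 1
    ring
  calc _ ≤ β ^ (2 * μ - 1) / WFun μ η n β * (N * WFun μ η n β * β ^ (-alphaInf μ n) *
        (β ^ (alphaInf μ n - (2 * μ - 1) + r) / (alphaInf μ n - (2 * μ - 1) + r))) := by gcongr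
    _ = N / (alphaInf μ n - (2 * μ - 1) + r) *
        (β ^ (2 * μ - 1) * β ^ (-alphaInf μ n) * β ^ (alphaInf μ n - (2 * μ - 1) + r)) := by
      field_simp
    _ ≤ N / (alphaInf μ n - (2 * μ - 1)) * β ^ r := by
      rw [h2]
      gcongr
      linarith

theorem norm_Lminus_le_of_not_two_le (hμ : 1 < μ) (hη : IsCutoff η) (hn : n ≠ 0)
    (hn2 : ¬ 2 ≤ |n|) {f : ℝ → ℂ} {N β : ℝ} (hβ : 0 < β) (hf : ∀ b, 0 < b → ‖f b‖ ≤ N) :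
    ‖Lminus μ η n f β‖ ≤ N / (μ - 1) := by
  have hn1 : |(n : ℝ)| = 1 := by exact_mod_cast abs_eq_one_of_not_two_le hn hn2
  have h1 := norm_integral_Ioi_le_rpow hβ (s := 2 * μ - 1 - |(n : ℝ)| * μ)
    (by rw [hn1]; linarith) fun b hb =>
    norm_div_decayMode_le_of_ge (η := η) hμ hη hn hβ (le_of_lt hb) (hf b (hβ.trans hb))
  have hWβ := WFun_pos (μ := μ) (η := η) (n := n) β
  rw [Lminus_eq_of_not_two_le hn2 f hβ, norm_mul, norm_decayMode hβ]
  have h2 : β ^ (2 * μ - 1) * β ^ (-(|(n : ℝ)| * μ)) * β ^ (-(2 * μ - 1 - |(n : ℝ)| * μ)) = 1 := by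
    rw [← Real.rpow_add hβ, ← Real.rpow_add hβ, ← Real.rpow_zero β]
    congr 1
    ring
  have hμ1 : 2 * μ - 1 - |(n : ℝ)| * μ = μ - 1 := by rw [hn1]; ring
  calc _ ≤ β ^ (2 * μ - 1) / WFun μ η n β * (N * WFun μ η n β * β ^ (-(|(n : ℝ)| * μ)) *
        (β ^ (-(2 * μ - 1 - |(n : ℝ)| * μ)) / (2 * μ - 1 - |(n : ℝ)| * μ))) := by gcongr
    _ = N / (2 * μ - 1 - |(n : ℝ)| * μ) *
        (β ^ (2 * μ - 1) * β ^ (-(|(n : ℝ)| * μ)) * β ^ (-(2 * μ - 1 - |(n : ℝ)| * μ))) := by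
      field_simp
    _ = N / (μ - 1) := by rw [h2, hμ1, mul_one]

theorem exists_Lminus_bound (hμ : 1 < μ) (hη : IsCutoff η) :
    ∃ C : ℝ, 0 < C ∧ ∀ n : ℤ, n ≠ 0 → ∀ (f : ℝ → ℂ) (N : ℝ), (∀ b, 0 < b → ‖f b‖ ≤ N) →
      ∀ β, 0 < β → |(n : ℝ)| * ‖Lminus μ η n f β‖ ≤ C * N := by
  obtain ⟨k, hk, h⟩ := alphaInf_sub_lower hμ
  have hμ1 : 0 < μ - 1 := by linarith
  refine ⟨k⁻¹ + (μ - 1)⁻¹, by positivity, fun n hn f N hf β hβ => ?_⟩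
  have hN : 0 ≤ N := (norm_nonneg _).trans (hf 1 one_pos)
  have hn0 := one_le_abs_cast hn
  by_cases hn2 : 2 ≤ |n|
  · have h1 := norm_Lminus_le_of_two_le (r := 0) hμ hη hn hn2 hβ hN le_rfl
      (fun b hb => by simpa using hf b hb)
    rw [Real.rpow_zero, mul_one] at h1
    have h2 := h n hn2
    calc |(n : ℝ)| * ‖Lminus μ η n f β‖ ≤ |(n : ℝ)| * (N / (k * |(n : ℝ)|)) := by
          refine mul_le_mul_of_nonneg_left (h1.trans ?_) (abs_nonneg _)
          exact div_le_div_of_nonneg_left hN (by positivity) h2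
      _ = k⁻¹ * N := by field_simp
      _ ≤ _ := by
        have : 0 ≤ (μ - 1)⁻¹ * N := by positivity
        linarith
  · have h1 := norm_Lminus_le_of_not_two_le hμ hη hn hn2 hβ hf
    have hn1 : |(n : ℝ)| = 1 := by exact_mod_cast abs_eq_one_of_not_two_le hn hn2
    rw [hn1, one_mul]
    refine h1.trans ?_
    have : 0 ≤ k⁻¹ * N := by positivity
    rw [div_eq_inv_mul]
    linarith

theorem hasDerivAt_Lminus (hμ : 1 < μ) (hη : IsCutoff η) (hn : n ≠ 0) {f : ℝ → ℂ} {N β : ℝ}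
    (hβ : 0 < β) (hfc : ContinuousOn f (Ioi 0)) (hf : ∀ b, 0 < b → ‖f b‖ ≤ N) :
    HasDerivAt (Lminus μ η n f)
      ((Complex.I * n + ((2 * μ - 1 - aFun μ η n β : ℝ) : ℂ) / β) * Lminus μ η n f β - f β / β)
      β := by
  have hE := decayMode_ne_zero (μ := μ) (η := η) (n := n) hβ
  have hβ' : (β : ℂ) ≠ 0 := by exact_mod_cast hβ.ne'
  by_cases hn2 : 2 ≤ |n|
  · have h1 := ((hasDerivAt_decayMode hμ hη hn hβ).mul
      (hasDerivAt_integral_zero (continuousOn_div_decayMode hμ hη hn hfc) hβ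
        (intervalIntegrable_div_decayMode hμ hη hn hn2 hβ hfc hf))).neg
    refine (h1.congr_of_eventuallyEq ?_).congr_deriv ?_
    · filter_upwards [Ioi_mem_nhds hβ] with x hx using Lminus_eq_of_two_le hn2 f hx
    · rw [Lminus_eq_of_two_le hn2 f hβ]
      field_simp
      ring
  · have h1 := (hasDerivAt_decayMode hμ hη hn hβ).mul
      (hasDerivAt_integral_Ioi (continuousOn_div_decayMode hμ hη hn hfc)
        (fun b hb => integrableOn_div_decayMode hμ hη hn hn2 hb hfc hf) hβ)
    refine (h1.congr_of_eventuallyEq ?_).congr_deriv ?_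
    · filter_upwards [Ioi_mem_nhds hβ] with x hx using Lminus_eq_of_not_two_le hn2 f hx
    · rw [Lminus_eq_of_not_two_le hn2 f hβ]
      field_simp
      ring

theorem continuousOn_Lminus (hμ : 1 < μ) (hη : IsCutoff η) (hn : n ≠ 0) {f : ℝ → ℂ} {N : ℝ}
    (hfc : ContinuousOn f (Ioi 0)) (hf : ∀ b, 0 < b → ‖f b‖ ≤ N) :
    ContinuousOn (Lminus μ η n f) (Ioi 0) := fun _ hβ =>
  (hasDerivAt_Lminus hμ hη hn hβ hfc hf).continuousAt.continuousWithinAt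

theorem Lminus_add (hμ : 1 < μ) (hη : IsCutoff η) (hn : n ≠ 0) {f g : ℝ → ℂ} {N β : ℝ}
    (hβ : 0 < β) (hfc : ContinuousOn f (Ioi 0)) (hgc : ContinuousOn g (Ioi 0))
    (hf : ∀ b, 0 < b → ‖f b‖ ≤ N) (hg : ∀ b, 0 < b → ‖g b‖ ≤ N) :
    Lminus μ η n (fun b => f b + g b) β = Lminus μ η n f β + Lminus μ η n g β := by
  by_cases hn2 : 2 ≤ |n|
  · rw [Lminus_eq_of_two_le hn2 _ hβ, Lminus_eq_of_two_le hn2 _ hβ, Lminus_eq_of_two_le hn2 _ hβ,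
      ← neg_add, ← mul_add, ← intervalIntegral.integral_add
        (intervalIntegrable_div_decayMode hμ hη hn hn2 hβ hfc hf)
        (intervalIntegrable_div_decayMode hμ hη hn hn2 hβ hgc hg)]
    simp_rw [add_div]
  · rw [Lminus_eq_of_not_two_le hn2 _ hβ, Lminus_eq_of_not_two_le hn2 _ hβ,
      Lminus_eq_of_not_two_le hn2 _ hβ, ← mul_add, ← MeasureTheory.integral_add
        (integrableOn_div_decayMode hμ hη hn hn2 hβ hfc hf)
        (integrableOn_div_decayMode hμ hη hn hn2 hβ hgc hg)]
    simp_rw [add_div]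

theorem Lminus_const_mul (c : ℂ) (f : ℝ → ℂ) {β : ℝ} (hβ : 0 < β) :
    Lminus μ η n (fun b => c * f b) β = c * Lminus μ η n f β := by
  by_cases hn2 : 2 ≤ |n|
  · rw [Lminus_eq_of_two_le hn2 _ hβ, Lminus_eq_of_two_le hn2 _ hβ, mul_neg, mul_left_comm,
      ← intervalIntegral.integral_const_mul c]
    simp_rw [mul_div_assoc]
  · rw [Lminus_eq_of_not_two_le hn2 _ hβ, Lminus_eq_of_not_two_le hn2 _ hβ, mul_left_comm,
      ← MeasureTheory.integral_const_mul c]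
    simp_rw [mul_div_assoc]

theorem Lminus_congr {f g : ℝ → ℂ} (h : ∀ b, 0 < b → f b = g b) {β : ℝ} (hβ : 0 < β) :
    Lminus μ η n f β = Lminus μ η n g β := by
  by_cases hn2 : 2 ≤ |n|
  · rw [Lminus_eq_of_two_le hn2 _ hβ, Lminus_eq_of_two_le hn2 _ hβ]
    congr 2
    rw [integral_of_le hβ.le, integral_of_le hβ.le]
    exact MeasureTheory.setIntegral_congr_fun measurableSet_Ioc fun b (hb : b ∈ Ioc (0 : ℝ) β) => by
      simp only [h b hb.1]
  · rw [Lminus_eq_of_not_two_le hn2 _ hβ, Lminus_eq_of_not_two_le hn2 _ hβ]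
    congr 1
    exact MeasureTheory.setIntegral_congr_fun measurableSet_Ioi fun b (hb : β < b) => by
      simp only [h b (hβ.trans hb)]

end MinusResolvent

/-! ### The primitive and the average of `L_{n,-}^{-1} u` -/

section Operator

variable {μ : ℝ} {η : ℝ → ℝ} {n : ℤ}

/-- The primitive `∫_0^β L_{n,-}^{-1} u`. -/
noncomputable def primMinus (μ : ℝ) (η : ℝ → ℝ) (n : ℤ) (u : ℝ → ℂ) (β : ℝ) : ℂ :=
  ∫ b in (0 : ℝ)..β, Lminus μ η n u b

/-- The average `β^{-1} ∫_0^β L_{n,-}^{-1} u`. -/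
noncomputable def avgMinus (μ : ℝ) (η : ℝ → ℝ) (n : ℤ) (u : ℝ → ℂ) (β : ℝ) : ℂ :=
  primMinus μ η n u β / β

theorem exists_norm_Lminus_le (hμ : 1 < μ) (hη : IsCutoff η) (hn : n ≠ 0) :
    ∃ C : ℝ, 0 < C ∧ ∀ (u : ℝ → ℂ) (M : ℝ), (∀ b, 0 < b → ‖u b‖ ≤ M) →
      ∀ β, 0 < β → ‖Lminus μ η n u β‖ ≤ C * M := by
  obtain ⟨C, hC, h⟩ := exists_Lminus_bound hμ hη
  refine ⟨C, hC, fun u M hu β hβ => le_trans ?_ (h n hn u M hu β hβ)⟩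
  exact le_mul_of_one_le_left (norm_nonneg _) (one_le_abs_cast hn)

theorem intervalIntegrable_Lminus (hμ : 1 < μ) (hη : IsCutoff η) (hn : n ≠ 0) {u : ℝ → ℂ} {M : ℝ}
    (huc : ContinuousOn u (Ioi 0)) (hu : ∀ b, 0 < b → ‖u b‖ ≤ M) {β : ℝ} (hβ : 0 < β) :
    IntervalIntegrable (Lminus μ η n u) volume 0 β := by
  obtain ⟨C, -, hC⟩ := exists_norm_Lminus_le hμ hη hn
  exact intervalIntegrable_of_rpow (K := C * M) (s := 1) (continuousOn_Lminus hμ hη hn huc hu) hβ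
    one_pos fun b hb _ => by simpa using hC u M hu b hb

theorem hasDerivAt_primMinus (hμ : 1 < μ) (hη : IsCutoff η) (hn : n ≠ 0) {u : ℝ → ℂ} {M : ℝ}
    (huc : ContinuousOn u (Ioi 0)) (hu : ∀ b, 0 < b → ‖u b‖ ≤ M) {β : ℝ} (hβ : 0 < β) :
    HasDerivAt (primMinus μ η n u) (Lminus μ η n u β) β :=
  hasDerivAt_integral_zero (continuousOn_Lminus hμ hη hn huc hu) hβ
    (intervalIntegrable_Lminus hμ hη hn huc hu hβ)

theorem norm_primMinus_le {u : ℝ → ℂ} {N : ℝ} (hg : ∀ b, 0 < b → ‖Lminus μ η n u b‖ ≤ N) {β : ℝ}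
    (hβ : 0 < β) : ‖primMinus μ η n u β‖ ≤ N * β := by
  have h := intervalIntegral.norm_integral_le_of_norm_le_const (a := 0) (b := β) (C := N)
    (f := Lminus μ η n u) fun x hx => by
      rw [uIoc_of_le hβ.le] at hx
      exact hg x hx.1
  rwa [sub_zero, abs_of_pos hβ] at h

theorem norm_avgMinus_le {u : ℝ → ℂ} {N : ℝ} (hg : ∀ b, 0 < b → ‖Lminus μ η n u b‖ ≤ N) {β : ℝ}
    (hβ : 0 < β) : ‖avgMinus μ η n u β‖ ≤ N := by
  rw [avgMinus, norm_div, Complex.norm_real, Real.norm_of_nonneg hβ.le, div_le_iff₀ hβ]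
  exact norm_primMinus_le hg hβ

theorem hasDerivAt_ofReal (β : ℝ) : HasDerivAt (fun q : ℝ => (q : ℂ)) 1 β := by
  simpa using (hasDerivAt_id β).ofReal_comp

theorem hasDerivAt_avgMinus (hμ : 1 < μ) (hη : IsCutoff η) (hn : n ≠ 0) {u : ℝ → ℂ} {M : ℝ}
    (huc : ContinuousOn u (Ioi 0)) (hu : ∀ b, 0 < b → ‖u b‖ ≤ M) {β : ℝ} (hβ : 0 < β) :
    HasDerivAt (avgMinus μ η n u) ((Lminus μ η n u β - avgMinus μ η n u β) / β) β := by
  have hβ' : (β : ℂ) ≠ 0 := by exact_mod_cast hβ.ne'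
  refine ((hasDerivAt_primMinus hμ hη hn huc hu hβ).div (hasDerivAt_ofReal β) hβ').congr_deriv ?_
  simp only [avgMinus]
  field_simp

theorem continuousOn_avgMinus (hμ : 1 < μ) (hη : IsCutoff η) (hn : n ≠ 0) {u : ℝ → ℂ} {M : ℝ}
    (huc : ContinuousOn u (Ioi 0)) (hu : ∀ b, 0 < b → ‖u b‖ ≤ M) :
    ContinuousOn (avgMinus μ η n u) (Ioi 0) := fun _ hβ =>
  (hasDerivAt_avgMinus hμ hη hn huc hu hβ).continuousAt.continuousWithinAt

theorem Avg_Lminus (u : ℝ → ℂ) {β : ℝ} (hβ : 0 < β) :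
    Avg (Lminus μ η n u) β = avgMinus μ η n u β := by
  rw [Avg, if_neg hβ.ne', avgMinus, primMinus, Complex.ofReal_inv, div_eq_inv_mul]

/-- Oscillation makes the average decay like `β^{-δ}`, uniformly in `n`. -/
theorem exists_avgMinus_decay (hμ : 1 < μ) (hη : IsCutoff η) {δ : ℝ} (hδ0 : 0 < δ) (hδ1 : δ < 1) :
    ∃ C : ℝ, 0 < C ∧ ∀ n : ℤ, n ≠ 0 → ∀ (u : ℝ → ℂ) (M : ℝ), ContinuousOn u (Ioi 0) →
      (∀ b, 0 < b → ‖u b‖ ≤ M) → ∀ β, 0 < β → |(n : ℝ)| * ‖avgMinus μ η n u β‖ ≤ C * M ∧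
        |(n : ℝ)| * ‖avgMinus μ η n u β‖ ≤ C * M * β ^ (-δ) := by
  obtain ⟨C, hC, hCb⟩ := exists_Lminus_bound hμ hη
  have hδ : 0 < 1 - δ := by linarith
  have hE : 0 ≤ ((3 * μ) * C + 1) / (1 - δ) := by positivity
  refine ⟨3 * C + ((3 * μ) * C + 1) / (1 - δ), by positivity, fun n hn u M huc hu β hβ => ?_⟩
  have hM : 0 ≤ M := (norm_nonneg _).trans (hu 1 one_pos)
  have hn1 := one_le_abs_cast hn
  have hn0 : 0 < |(n : ℝ)| := by linarith
  have hg : ∀ b, 0 < b → ‖Lminus μ η n u b‖ ≤ C * M / |(n : ℝ)| := fun b hb => by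
    rw [le_div_iff₀ hn0, mul_comm]
    exact hCb n hn u M hu b hb
  have hφ : |(n : ℝ)| * ‖avgMinus μ η n u β‖ ≤ C * M := by
    rw [mul_comm, ← le_div_iff₀ hn0]
    exact norm_avgMinus_le hg hβ
  have hCM : 0 ≤ C * M := by positivity
  have hEM : 0 ≤ ((3 * μ) * C + 1) / (1 - δ) * M := by positivity
  refine ⟨by nlinarith, ?_⟩
  rcases le_or_gt β 1 with h1 | h1
  · have : 1 ≤ β ^ (-δ) := Real.one_le_rpow_of_pos_of_le_one_of_nonpos hβ h1 (by linarith)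
    nlinarith
  set g := Lminus μ η n u with hgdef
  have hgc : ContinuousOn g (Ioi 0) := continuousOn_Lminus hμ hη hn huc hu
  have hsub : uIcc 1 β ⊆ Ioi 0 := by
    rw [uIcc_of_le h1.le]
    exact fun x hx => one_pos.trans_le hx.1
  have hac := (continuous_aFun hμ hη hn).continuousOn (s := Ioi 0)
  let R : ℝ → ℂ := fun b => (((2 * μ - 1 - aFun μ η n b : ℝ) : ℂ) * g b - u b) / b
  have hinvc : ContinuousOn (fun b : ℝ => (b : ℂ)) (Ioi 0) := Complex.continuous_ofReal.continuousOn
  have hRc : ContinuousOn R (Ioi 0) := by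
    refine ContinuousOn.div (((Complex.continuous_ofReal.comp_continuousOn
      (continuousOn_const.sub hac)).mul hgc).sub huc) hinvc fun b hb => ?_
    exact_mod_cast (ne_of_gt hb : b ≠ 0)
  have hgi := (hgc.mono hsub).intervalIntegrable (μ := volume)
  have hRi := (hRc.mono hsub).intervalIntegrable (μ := volume)
  have hft : ∫ b in (1 : ℝ)..β, (Complex.I * n * g b + R b) = g β - g 1 := by
    refine intervalIntegral.integral_eq_sub_of_hasDerivAt (fun b hb => ?_)
      ((hgi.const_mul _).add hRi)
    have hb0 : 0 < b := hsub hb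
    refine (hasDerivAt_Lminus hμ hη hn hb0 huc hu).congr_deriv ?_
    have : (b : ℂ) ≠ 0 := by exact_mod_cast hb0.ne'
    simp only [R, hgdef]
    field_simp
    ring
  rw [intervalIntegral.integral_add (hgi.const_mul _) hRi,
    intervalIntegral.integral_const_mul (Complex.I * n)] at hft
  have hRb : ∀ b ∈ Ioc 1 β, ‖R b‖ ≤ ((3 * μ) * C + 1) * M * b⁻¹ := fun b hb => by
    have hb0 : 0 < b := one_pos.trans hb.1
    simp only [R]
    rw [norm_div, Complex.norm_real, Real.norm_of_nonneg hb0.le, ← div_eq_mul_inv]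
    gcongr
    refine (norm_sub_le _ _).trans ?_
    have ha0 := aFun_pos hμ hη hn b
    have ha1 := aFun_le hμ hη n b
    have h2 : |2 * μ - 1 - aFun μ η n b| ≤ |(n : ℝ)| * (3 * μ) := by
      rw [abs_le]
      constructor <;> nlinarith
    have h3 : ‖((2 * μ - 1 - aFun μ η n b : ℝ) : ℂ) * g b‖ ≤ 3 * μ * C * M := by
      rw [norm_mul, Complex.norm_real, Real.norm_eq_abs]
      calc _ ≤ |(n : ℝ)| * (3 * μ) * (C * M / |(n : ℝ)|) :=
            mul_le_mul h2 (hg b hb0) (norm_nonneg _) (by positivity)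
        _ = _ := by field_simp
    linarith [hu b hb0]
  have hRint : ‖∫ b in (1 : ℝ)..β, R b‖ ≤ ((3 * μ) * C + 1) * M * (β ^ (1 - δ) / (1 - δ)) := by
    have hinv : IntervalIntegrable (fun b : ℝ => ((3 * μ) * C + 1) * M * b⁻¹) volume 1 β :=
      (ContinuousOn.intervalIntegrable (fun b hb =>
        (continuousAt_inv₀ (ne_of_gt (hsub hb))).continuousWithinAt)).const_mul _
    have h4 := intervalIntegral.norm_integral_le_of_norm_le (μ := volume) h1.le
      (Eventually.of_forall hRb) hinv
    rw [intervalIntegral.integral_const_mul, integral_inv_of_pos one_pos hβ, div_one] at h4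
    refine h4.trans ?_
    gcongr
    exact Real.log_le_rpow_div hβ.le hδ
  have hsplit : primMinus μ η n u β = primMinus μ η n u 1 + ∫ b in (1 : ℝ)..β, g b :=
    (intervalIntegral.integral_add_adjacent_intervals
      (intervalIntegrable_Lminus hμ hη hn huc hu one_pos) hgi).symm
  have hG1 : |(n : ℝ)| * ‖primMinus μ η n u 1‖ ≤ C * M := by
    have := norm_primMinus_le hg one_pos
    rw [mul_one, le_div_iff₀ hn0] at this
    linarith
  have hsmall : ∀ b, 0 < b → ‖g b‖ ≤ C * M := fun b hb =>
    (le_mul_of_one_le_left (norm_nonneg _) hn1).trans (hCb n hn u M hu b hb)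
  have hG2 : |(n : ℝ)| * ‖∫ b in (1 : ℝ)..β, g b‖ ≤
      2 * (C * M) + ((3 * μ) * C + 1) * M * (β ^ (1 - δ) / (1 - δ)) := by
    have h5 : Complex.I * n * ∫ b in (1 : ℝ)..β, g b = g β - g 1 - ∫ b in (1 : ℝ)..β, R b := by
      rw [← hft]
      ring
    have h6 : |(n : ℝ)| * ‖∫ b in (1 : ℝ)..β, g b‖ = ‖g β - g 1 - ∫ b in (1 : ℝ)..β, R b‖ := by
      rw [← h5]
      simp
    rw [h6]
    refine (norm_sub_le _ _).trans (add_le_add ((norm_sub_le _ _).trans ?_) hRint)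
    linarith [hsmall β hβ, hsmall 1 one_pos]
  have hp1 : 1 ≤ β ^ (1 - δ) := Real.one_le_rpow h1.le hδ.le
  have hp2 : β ^ (1 - δ) = β * β ^ (-δ) := by
    rw [sub_eq_add_neg, Real.rpow_add hβ, Real.rpow_one]
  have hG3 : |(n : ℝ)| * ‖primMinus μ η n u β‖ ≤
      (3 * C + ((3 * μ) * C + 1) / (1 - δ)) * M * β ^ (1 - δ) := by
    rw [hsplit]
    calc _ ≤ |(n : ℝ)| * (‖primMinus μ η n u 1‖ + ‖∫ b in (1 : ℝ)..β, g b‖) := by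
          gcongr
          exact norm_add_le _ _
      _ ≤ 3 * (C * M) * 1 + ((3 * μ) * C + 1) * M * (β ^ (1 - δ) / (1 - δ)) := by linarith
      _ ≤ 3 * (C * M) * β ^ (1 - δ) + ((3 * μ) * C + 1) * M * (β ^ (1 - δ) / (1 - δ)) := by
          gcongr
      _ = _ := by ring
  rw [avgMinus, norm_div, Complex.norm_real, Real.norm_of_nonneg hβ.le, mul_div_assoc',
    div_le_iff₀ hβ]
  calc _ ≤ _ := hG3
    _ = _ := by rw [hp2]; ring

/-! ### The operator `𝒦_n` in terms of the average -/

theorem exists_chiFun_linear_bound (hμ : 1 < μ) (hη : IsCutoff η) :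
    ∃ X : ℝ, 1 ≤ X ∧ ∀ n : ℤ, n ≠ 0 → ∀ β, 0 < β →
      (|chiFun μ η n β| ≤ X ∧ |β * deriv (chiFun μ η n) β| ≤ X ∧ |deriv (chiFun μ η n) β| ≤ X) ∧
      |chiFun μ η n β| ≤ X * β ∧ |β * deriv (chiFun μ η n) β| ≤ X * β ∧
      |(1 - chiFun μ η n β) * β| ≤ 2 * (1 + X) := by
  obtain ⟨X, hX, h⟩ := exists_chiFun_bound hμ hη
  refine ⟨X, hX, fun n hn β hβ => ⟨h n hn β, ?_, ?_, ?_⟩⟩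
  · rcases le_or_gt β 1 with h1 | h1
    · rw [chiFun_of_le_one hη h1, abs_zero]
      positivity
    · have := (h n hn β).1
      nlinarith
  · rw [abs_mul, abs_of_pos hβ, mul_comm]
    gcongr
    exact (h n hn β).2.2
  · rcases le_or_gt 2 β with h1 | h1
    · rw [chiFun_of_two_le hη h1]
      simp
      linarith
    · have h2 : |1 - chiFun μ η n β| ≤ 1 + X :=
        (abs_sub _ _).trans (by simpa using (h n hn β).1)
      rw [abs_mul, abs_of_pos hβ, mul_comm]
      gcongr

/-- The coefficient of the average in the lower order part of `𝒦_n`. -/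
noncomputable def lowerCoeff (μ : ℝ) (η : ℝ → ℝ) (n : ℤ) (β : ℝ) : ℂ :=
  ((β * deriv (chiFun μ η n) β - (2 * μ + aFun μ η n β) * chiFun μ η n β : ℝ) : ℂ) +
    Complex.I * n * (((1 - chiFun μ η n β) * β : ℝ) : ℂ)

theorem continuous_lowerCoeff (hμ : 1 < μ) (hη : IsCutoff η) (hn : n ≠ 0) :
    Continuous (lowerCoeff μ η n) := by
  have h1 := (contDiff_chiFun hμ hη hn).continuous
  have h2 := continuous_deriv_chiFun hμ hη hn
  have h3 := continuous_aFun hμ hη hn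
  unfold lowerCoeff
  fun_prop

theorem exists_lowerCoeff_bound (hμ : 1 < μ) (hη : IsCutoff η) :
    ∃ P : ℝ, 0 < P ∧ ∀ n : ℤ, n ≠ 0 → ∀ β, 0 < β →
      |chiFun μ η n β| ≤ P ∧ |chiFun μ η n β| ≤ P * β ∧
      ‖lowerCoeff μ η n β‖ ≤ |(n : ℝ)| * P ∧ ‖lowerCoeff μ η n β‖ ≤ |(n : ℝ)| * P * β := by
  obtain ⟨X, hX, h⟩ := exists_chiFun_linear_bound hμ hη
  refine ⟨X + 3 * μ * X + 2 * (1 + X), by positivity, fun n hn β hβ => ?_⟩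
  obtain ⟨⟨h1, h2, -⟩, h3, h4, h5⟩ := h n hn β hβ
  have hn1 := one_le_abs_cast hn
  have ha0 := aFun_pos hμ hη hn β
  have ha1 := aFun_le hμ hη n β
  have ha : |2 * μ + aFun μ η n β| ≤ |(n : ℝ)| * (3 * μ) := by
    rw [abs_of_pos (by positivity)]
    nlinarith
  have hχ : |(1 - chiFun μ η n β) * β| ≤ 2 * (1 + X) * β := by
    rw [abs_mul, abs_of_pos hβ]
    gcongr
    refine (abs_sub _ _).trans ?_
    rw [abs_one]
    linarith
  have hP : 0 ≤ 3 * μ * X := by positivity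
  have key : ∀ t s : ℝ, |β * deriv (chiFun μ η n) β| ≤ t → |chiFun μ η n β| ≤ t →
      |(1 - chiFun μ η n β) * β| ≤ s →
      ‖lowerCoeff μ η n β‖ ≤ |(n : ℝ)| * (t + 3 * μ * t + s) := fun t s ht1 ht2 hs => by
    have ht : 0 ≤ t := (abs_nonneg _).trans ht2
    refine (norm_add_le _ _).trans ?_
    rw [Complex.norm_real, Real.norm_eq_abs, norm_mul, norm_mul, Complex.norm_I, one_mul,
      Complex.norm_intCast, Complex.norm_real, Real.norm_eq_abs]
    have h6 : |(2 * μ + aFun μ η n β) * chiFun μ η n β| ≤ |(n : ℝ)| * (3 * μ) * t := by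
      rw [abs_mul]
      exact mul_le_mul ha ht2 (abs_nonneg _) (by positivity)
    have h7 := abs_sub (β * deriv (chiFun μ η n) β) ((2 * μ + aFun μ η n β) * chiFun μ η n β)
    have h8 : |(n : ℝ)| * |(1 - chiFun μ η n β) * β| ≤ |(n : ℝ)| * s := by gcongr
    have h9 : t ≤ |(n : ℝ)| * t := by nlinarith
    linarith
  have hk1 := key X (2 * (1 + X)) h2 h1 h5
  have hk2 := key (X * β) (2 * (1 + X) * β) h4 h3 hχ
  refine ⟨by linarith, ?_, hk1, hk2.trans (le_of_eq (by ring))⟩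
  refine h3.trans ?_
  gcongr
  linarith

/-- The source `lowerCoeff · avgMinus`. -/
noncomputable def lowerSource (μ : ℝ) (η : ℝ → ℝ) (n : ℤ) (u : ℝ → ℂ) (β : ℝ) : ℂ :=
  lowerCoeff μ η n β * avgMinus μ η n u β

theorem continuousOn_lowerSource (hμ : 1 < μ) (hη : IsCutoff η) (hn : n ≠ 0) {u : ℝ → ℂ} {M : ℝ}
    (huc : ContinuousOn u (Ioi 0)) (hu : ∀ b, 0 < b → ‖u b‖ ≤ M) :
    ContinuousOn (lowerSource μ η n u) (Ioi 0) :=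
  (continuous_lowerCoeff hμ hη hn).continuousOn.mul (continuousOn_avgMinus hμ hη hn huc hu)

/-- The function `χ_n · avgMinus`. -/
noncomputable def cutAvg (μ : ℝ) (η : ℝ → ℝ) (n : ℤ) (u : ℝ → ℂ) (β : ℝ) : ℂ :=
  ((chiFun μ η n β : ℝ) : ℂ) * avgMinus μ η n u β

/-- The derivative of `cutAvg`. -/
noncomputable def cutAvgDeriv (μ : ℝ) (η : ℝ → ℝ) (n : ℤ) (u : ℝ → ℂ) (β : ℝ) : ℂ :=
  ((deriv (chiFun μ η n) β : ℝ) : ℂ) * avgMinus μ η n u β +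
    ((chiFun μ η n β : ℝ) : ℂ) * ((Lminus μ η n u β - avgMinus μ η n u β) / β)

theorem hasDerivAt_cutAvg (hμ : 1 < μ) (hη : IsCutoff η) (hn : n ≠ 0) {u : ℝ → ℂ} {M : ℝ}
    (huc : ContinuousOn u (Ioi 0)) (hu : ∀ b, 0 < b → ‖u b‖ ≤ M) {β : ℝ} (hβ : 0 < β) :
    HasDerivAt (cutAvg μ η n u) (cutAvgDeriv μ η n u β) β :=
  ((differentiable_chiFun hμ hη hn) β).hasDerivAt.ofReal_comp.mul
    (hasDerivAt_avgMinus hμ hη hn huc hu hβ)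

theorem continuousOn_cutAvgDeriv (hμ : 1 < μ) (hη : IsCutoff η) (hn : n ≠ 0) {u : ℝ → ℂ} {M : ℝ}
    (huc : ContinuousOn u (Ioi 0)) (hu : ∀ b, 0 < b → ‖u b‖ ≤ M) :
    ContinuousOn (cutAvgDeriv μ η n u) (Ioi 0) := by
  have h1 := continuousOn_avgMinus hμ hη hn huc hu
  have h2 := continuousOn_Lminus hμ hη hn huc hu
  refine ((Complex.continuous_ofReal.comp (continuous_deriv_chiFun hμ hη hn)).continuousOn.mul
    h1).add ((Complex.continuous_ofReal.comp (contDiff_chiFun hμ hη hn).continuous).continuousOn.mul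
    ((h2.sub h1).div Complex.continuous_ofReal.continuousOn fun b hb => ?_))
  exact_mod_cast (ne_of_gt hb : b ≠ 0)

theorem K1_eq (u : ℝ → ℂ) {β : ℝ} (hβ : 0 < β) : K1 μ η n u β = cutAvg μ η n u β := by
  rw [K1, Avg_Lminus u hβ, cutAvg]

theorem deriv_K1 (hμ : 1 < μ) (hη : IsCutoff η) (hn : n ≠ 0) {u : ℝ → ℂ} {M : ℝ}
    (huc : ContinuousOn u (Ioi 0)) (hu : ∀ b, 0 < b → ‖u b‖ ≤ M) {β : ℝ} (hβ : 0 < β) :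
    deriv (K1 μ η n u) β = cutAvgDeriv μ η n u β := by
  refine ((hasDerivAt_cutAvg hμ hη hn huc hu hβ).congr_of_eventuallyEq ?_).deriv
  filter_upwards [Ioi_mem_nhds hβ] with x hx using K1_eq u hx

theorem exists_norm_cutAvgDeriv_le (hμ : 1 < μ) (hη : IsCutoff η) (hn : n ≠ 0) :
    ∃ C : ℝ, 0 < C ∧ ∀ (u : ℝ → ℂ) (M : ℝ), (∀ b, 0 < b → ‖u b‖ ≤ M) → ∀ β, 0 < β →
      ‖avgMinus μ η n u β‖ ≤ C * M ∧ ‖cutAvgDeriv μ η n u β‖ ≤ C * M := by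
  obtain ⟨C, hC, hCb⟩ := exists_norm_Lminus_le hμ hη hn
  obtain ⟨X, hX, h⟩ := exists_chiFun_linear_bound hμ hη
  refine ⟨3 * X * C, by positivity, fun u M hu β hβ => ?_⟩
  have hM : 0 ≤ M := (norm_nonneg _).trans (hu 1 one_pos)
  have hCM : 0 ≤ C * M := by positivity
  have hg := hCb u M hu
  have hφ := norm_avgMinus_le hg hβ
  obtain ⟨⟨-, -, h1⟩, h2, -, -⟩ := h n hn β hβ
  refine ⟨by nlinarith, ?_⟩
  refine (norm_add_le _ _).trans ?_
  rw [norm_mul, norm_mul, norm_div, Complex.norm_real, Complex.norm_real, Complex.norm_real,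
    Real.norm_of_nonneg hβ.le, Real.norm_eq_abs, Real.norm_eq_abs, mul_div_assoc']
  have h3 : |deriv (chiFun μ η n) β| * ‖avgMinus μ η n u β‖ ≤ X * (C * M) := by gcongr
  have h4 : |chiFun μ η n β| * ‖Lminus μ η n u β - avgMinus μ η n u β‖ / β ≤ X * (2 * (C * M)) := by
    rw [div_le_iff₀ hβ]
    have h5 : ‖Lminus μ η n u β - avgMinus μ η n u β‖ ≤ 2 * (C * M) :=
      (norm_sub_le _ _).trans (by linarith [hg β hβ])
    calc _ ≤ X * β * (2 * (C * M)) := by gcongr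
      _ = _ := by ring
  linarith

theorem Kn_eq (hμ : 1 < μ) (hη : IsCutoff η) (hn : n ≠ 0) {u : ℝ → ℂ} {M : ℝ}
    (huc : ContinuousOn u (Ioi 0)) (hu : ∀ b, 0 < b → ‖u b‖ ≤ M) {β : ℝ} (hβ : 0 < β) :
    Kn μ η n u β = ((2 * μ - 1 : ℝ) : ℂ) *
      (cutAvg μ η n u β + Lplus μ η n (lowerSource μ η n u) β) := by
  obtain ⟨C, hC, hCb⟩ := exists_norm_cutAvgDeriv_le (μ := μ) (η := η) hμ hη hn
  obtain ⟨P, hP, hPb⟩ := exists_lowerCoeff_bound hμ hη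
  obtain ⟨X, hX, hXb⟩ := exists_chiFun_linear_bound hμ hη
  have hM : 0 ≤ M := (norm_nonneg _).trans (hu 1 one_pos)
  have hCM : 0 ≤ C * M := by positivity
  have hn1 := one_le_abs_cast hn
  have hφ : ∀ b, 0 < b → ‖avgMinus μ η n u b‖ ≤ C * M := fun b hb => (hCb u M hu b hb).1
  have hφc := continuousOn_avgMinus hμ hη hn huc hu
  have hχc := (Complex.continuous_ofReal.comp
    (contDiff_chiFun hμ hη hn).continuous).continuousOn (s := Ioi 0)
  have hdχc := (Complex.continuous_ofReal.comp
    (continuous_id.mul (continuous_deriv_chiFun hμ hη hn))).continuousOn (s := Ioi 0)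
  have hac := (Complex.continuous_ofReal.comp (continuous_const (y := 2 * μ - 1) |>.add
    (continuous_aFun hμ hη hn))).continuousOn (s := Ioi 0)
  have hidc : ContinuousOn (fun b : ℝ => (b : ℂ)) (Ioi 0) := Complex.continuous_ofReal.continuousOn
  have hdc := continuousOn_cutAvgDeriv hμ hη hn huc hu
  have hwc : ContinuousOn (cutAvg μ η n u) (Ioi 0) := hχc.mul hφc
  let w := cutAvg μ η n u
  let dw := cutAvgDeriv μ η n u
  have hwM : ∀ b, 0 < b → ‖w b‖ ≤ X * (C * M) := fun b hb => by
    simp only [w, cutAvg]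
    rw [norm_mul, Complex.norm_real, Real.norm_eq_abs]
    gcongr
    exacts [(hXb n hn b hb).1.1, hφ b hb]
  have hwl : ∀ b, 0 < b → ‖w b‖ ≤ X * (C * M) * b := fun b hb => by
    simp only [w, cutAvg]
    rw [norm_mul, Complex.norm_real, Real.norm_eq_abs]
    calc _ ≤ X * b * (C * M) := by
          gcongr
          exacts [(hXb n hn b hb).2.1, hφ b hb]
      _ = _ := by ring
  have hdl : ∀ b : ℝ, 0 < b → ‖-(b : ℂ) * dw b‖ ≤ C * M * b := fun b hb => by
    rw [norm_mul, norm_neg, Complex.norm_real, Real.norm_of_nonneg hb.le, mul_comm]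
    gcongr
    exact (hCb u M hu b hb).2
  let f1 : ℝ → ℂ := fun b => -(b : ℂ) * dw b + (Complex.I * n * b - 1) * w b
  let f2 : ℝ → ℂ := fun b => ((b * deriv (chiFun μ η n) b : ℝ) : ℂ) * avgMinus μ η n u b
  let f3 : ℝ → ℂ := fun b => ((1 - chiFun μ η n b : ℝ) : ℂ) * (Complex.I * n * primMinus μ η n u b)
  let h : ℝ → ℂ := fun b => -(b : ℂ) * dw b +
    (Complex.I * n * b + ((2 * μ - 1 + aFun μ η n b : ℝ) : ℂ)) * w b
  have hf1c : ContinuousOn f1 (Ioi 0) :=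
    (hidc.neg.mul hdc).add (((continuousOn_const.mul hidc).sub continuousOn_const).mul hwc)
  have hhc : ContinuousOn h (Ioi 0) :=
    (hidc.neg.mul hdc).add (((continuousOn_const.mul hidc).add hac).mul hwc)
  have hf2c : ContinuousOn f2 (Ioi 0) := hdχc.mul hφc
  have hGc : ContinuousOn (primMinus μ η n u) (Ioi 0) := fun b hb =>
    (hasDerivAt_primMinus hμ hη hn huc hu hb).continuousAt.continuousWithinAt
  have hf3c : ContinuousOn f3 (Ioi 0) := by
    refine ContinuousOn.mul ?_ (continuousOn_const.mul hGc)
    exact (Complex.continuous_ofReal.comp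
      (continuous_const.sub (contDiff_chiFun hμ hη hn).continuous)).continuousOn
  have hG : ∀ b, 0 < b → primMinus μ η n u b = b * avgMinus μ η n u b := fun b hb => by
    have : (b : ℂ) ≠ 0 := by exact_mod_cast hb.ne'
    rw [avgMinus]
    field_simp
  have hinw : ∀ b, 0 < b → ‖Complex.I * n * b * w b‖ ≤ |(n : ℝ)| * X * (C * M) * b :=
    fun b hb => by
      rw [norm_mul, norm_mul, norm_mul, Complex.norm_I, Complex.norm_intCast, Complex.norm_real,
        Real.norm_of_nonneg hb.le, one_mul]
      calc _ ≤ |(n : ℝ)| * b * (X * (C * M)) := by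
            gcongr
            exact hwM b hb
        _ = _ := by ring
  have haw : ∀ b, 0 < b → ‖((2 * μ - 1 + aFun μ η n b : ℝ) : ℂ) * w b‖ ≤
      |(n : ℝ)| * (3 * μ) * (X * (C * M)) * b := fun b hb => by
    have ha0 := aFun_pos hμ hη hn b
    have ha1 := aFun_le hμ hη n b
    have h4 : 0 < 2 * μ - 1 := by linarith
    rw [norm_mul, Complex.norm_real, Real.norm_of_nonneg (by positivity)]
    calc _ ≤ (|(n : ℝ)| * (3 * μ)) * (X * (C * M) * b) := by
          gcongr
          · nlinarith
          · exact hwl b hb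
      _ = _ := by ring
  let N : ℝ := C * M + |(n : ℝ)| * X * (C * M) + |(n : ℝ)| * (3 * μ) * (X * (C * M)) +
    X * (C * M) + |(n : ℝ)| * (1 + X) * (C * M) + |(n : ℝ)| * P * (C * M)
  have hXCM : 0 ≤ X * (C * M) := by positivity
  have hnX : 0 ≤ |(n : ℝ)| * X * (C * M) := by positivity
  have hnX' : 0 ≤ |(n : ℝ)| * (3 * μ) * (X * (C * M)) := by positivity
  have hnX2 : 0 ≤ |(n : ℝ)| * (1 + X) * (C * M) := by positivity
  have hnP : 0 ≤ |(n : ℝ)| * P * (C * M) := by positivity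
  have hf1N : ∀ b, 0 < b → ‖f1 b‖ ≤ N * b := fun b hb => by
    have e : f1 b = -(b : ℂ) * dw b + Complex.I * n * b * w b - w b := by
      simp only [f1]
      ring
    rw [e]
    refine (norm_sub_le _ _).trans ((add_le_add ((norm_add_le _ _).trans
      (add_le_add (hdl b hb) (hinw b hb))) (hwl b hb)).trans ?_)
    simp only [N, add_mul]
    nlinarith [mul_nonneg hnX' hb.le, mul_nonneg hnX2 hb.le, mul_nonneg hnP hb.le]
  have hhN : ∀ b, 0 < b → ‖h b‖ ≤ N * b := fun b hb => by
    have e : h b = -(b : ℂ) * dw b + Complex.I * n * b * w b +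
        ((2 * μ - 1 + aFun μ η n b : ℝ) : ℂ) * w b := by
      simp only [h]
      ring
    rw [e]
    refine (norm_add_le _ _).trans ((add_le_add ((norm_add_le _ _).trans
      (add_le_add (hdl b hb) (hinw b hb))) (haw b hb)).trans ?_)
    simp only [N, add_mul]
    nlinarith [mul_nonneg hXCM hb.le, mul_nonneg hnX2 hb.le, mul_nonneg hnP hb.le]
  have hf2N : ∀ b, 0 < b → ‖f2 b‖ ≤ N * b := fun b hb => by
    simp only [f2]
    rw [norm_mul, Complex.norm_real, Real.norm_eq_abs]
    calc _ ≤ X * b * (C * M) := by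
          gcongr
          exacts [(hXb n hn b hb).2.2.1, hφ b hb]
      _ = X * (C * M) * b := by ring
      _ ≤ N * b := by
          gcongr
          simp only [N]
          linarith
  have hf3N : ∀ b, 0 < b → ‖f3 b‖ ≤ N * b := fun b hb => by
    simp only [f3]
    rw [hG b hb, norm_mul, norm_mul, norm_mul, norm_mul, Complex.norm_I, Complex.norm_intCast,
      Complex.norm_real, Complex.norm_real, Real.norm_of_nonneg hb.le, Real.norm_eq_abs, one_mul]
    have h2 : |1 - chiFun μ η n b| ≤ 1 + X :=
      (abs_sub _ _).trans (by simpa using (hXb n hn b hb).1.1)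
    calc _ ≤ (1 + X) * (|(n : ℝ)| * (b * (C * M))) := by
          gcongr
          exact hφ b hb
      _ = |(n : ℝ)| * (1 + X) * (C * M) * b := by ring
      _ ≤ N * b := by
          gcongr
          simp only [N]
          linarith
  have hFN : ∀ b, 0 < b → ‖lowerSource μ η n u b‖ ≤ N * b := fun b hb => by
    rw [lowerSource, norm_mul]
    calc _ ≤ |(n : ℝ)| * P * b * (C * M) := by
          gcongr
          exacts [(hPb n hn b hb).2.2.2, hφ b hb]
      _ = |(n : ℝ)| * P * (C * M) * b := by ring
      _ ≤ N * b := by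
          gcongr
          simp only [N]
          linarith
  have hFc := continuousOn_lowerSource hμ hη hn huc hu
  have e1 : Lplus μ η n (fun b => -(b : ℂ) * deriv (K1 μ η n u) b +
      (Complex.I * (n : ℂ) * (b : ℂ) - 1) * K1 μ η n u b) β = Lplus μ η n f1 β :=
    Lplus_congr fun b hb => by
      rw [deriv_K1 hμ hη hn huc hu (hβ.trans hb), K1_eq u (hβ.trans hb)]
  have e2 : Lplus μ η n (K2 μ η n u) β = Lplus μ η n f2 β :=
    Lplus_congr fun b hb => by rw [K2, Avg_Lminus u (hβ.trans hb)]
  have e3 : Lplus μ η n (K3 μ η n u) β = Lplus μ η n f3 β := Lplus_congr fun b hb => rfl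
  have e4 : Lplus μ η n h β = w β := Lplus_of_hasDerivAt hμ hη hn hβ
    (fun b hb => hasDerivAt_cutAvg hμ hη hn huc hu hb) hwM hhc (fun b hb => rfl) hhN
  have hN0 : ∀ b, 0 < b → N * b ≤ (2 * N) * b := fun b hb => by
    have : 0 ≤ N * b := (norm_nonneg _).trans (hFN b hb)
    linarith
  rw [Kn, e1, e2, e3, ← Lplus_add hμ hη hn hβ hf1c hf2c hf1N hf2N,
    ← Lplus_add hμ hη hn (f := fun b => f1 b + f2 b) (N := 2 * N) hβ (hf1c.add hf2c) hf3c
      (fun b hb => (norm_add_le _ _).trans (by linarith [hf1N b hb, hf2N b hb]))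
      (fun b hb => (hf3N b hb).trans (hN0 b hb)),
    show cutAvg μ η n u β = w β from rfl, ← e4, ← Lplus_add hμ hη hn hβ hhc hFc hhN hFN]
  congr 1
  refine Lplus_congr fun b hb => ?_
  simp only [f1, f2, f3, h, w, lowerSource, lowerCoeff, cutAvg]
  rw [hG b (hβ.trans hb)]
  push_cast
  ring

/-! ### Linearity, bounds and regularity of `𝒦_n` -/

theorem avgMinus_add (hμ : 1 < μ) (hη : IsCutoff η) (hn : n ≠ 0) {u v : ℝ → ℂ} {M β : ℝ}
    (hβ : 0 < β) (huc : ContinuousOn u (Ioi 0)) (hvc : ContinuousOn v (Ioi 0))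
    (hu : ∀ b, 0 < b → ‖u b‖ ≤ M) (hv : ∀ b, 0 < b → ‖v b‖ ≤ M) :
    avgMinus μ η n (fun b => u b + v b) β = avgMinus μ η n u β + avgMinus μ η n v β := by
  simp only [avgMinus, primMinus]
  rw [← add_div, ← intervalIntegral.integral_add (intervalIntegrable_Lminus hμ hη hn huc hu hβ)
    (intervalIntegrable_Lminus hμ hη hn hvc hv hβ), integral_of_le hβ.le, integral_of_le hβ.le]
  congr 1
  exact MeasureTheory.setIntegral_congr_fun measurableSet_Ioc fun b hb =>
    Lminus_add hμ hη hn hb.1 huc hvc hu hv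

theorem avgMinus_const_mul (c : ℂ) (u : ℝ → ℂ) {β : ℝ} (hβ : 0 < β) :
    avgMinus μ η n (fun b => c * u b) β = c * avgMinus μ η n u β := by
  simp only [avgMinus, primMinus]
  rw [← mul_div_assoc, ← intervalIntegral.integral_const_mul c, integral_of_le hβ.le,
    integral_of_le hβ.le]
  congr 1
  exact MeasureTheory.setIntegral_congr_fun measurableSet_Ioc fun b hb =>
    Lminus_const_mul c u hb.1

theorem avgMinus_congr {u v : ℝ → ℂ} (h : ∀ b, 0 < b → u b = v b) {β : ℝ} (hβ : 0 < β) :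
    avgMinus μ η n u β = avgMinus μ η n v β := by
  simp only [avgMinus, primMinus]
  rw [integral_of_le hβ.le, integral_of_le hβ.le]
  congr 1
  exact MeasureTheory.setIntegral_congr_fun measurableSet_Ioc fun b hb => Lminus_congr h hb.1

theorem norm_Kn_le_of_avgMinus (hμ : 1 < μ) (hη : IsCutoff η) :
    ∃ Q : ℝ, 0 < Q ∧ ∀ n : ℤ, n ≠ 0 → ∀ (u : ℝ → ℂ) (M A r : ℝ), ContinuousOn u (Ioi 0) →
      (∀ b, 0 < b → ‖u b‖ ≤ M) → r ≤ 2 * μ - 1 → (∀ b, 0 < b → ‖avgMinus μ η n u b‖ ≤ A * b ^ r) →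
      ∀ β, 0 < β → ‖Kn μ η n u β‖ ≤ Q * A * β ^ r := by
  obtain ⟨P, hP, hPb⟩ := exists_lowerCoeff_bound hμ hη
  have hμ1 : 0 < μ - 1 := by linarith
  have hc : 0 < 2 * μ - 1 := by linarith
  refine ⟨(2 * μ - 1) * (P + P / (μ - 1)), by positivity,
    fun n hn u M A r huc hu hr hφ β hβ => ?_⟩
  have hn1 : 0 < |(n : ℝ)| := by linarith [one_le_abs_cast hn]
  have hA : 0 ≤ A := by simpa using (norm_nonneg _).trans (hφ 1 one_pos)
  rw [Kn_eq hμ hη hn huc hu hβ, norm_mul, Complex.norm_real, Real.norm_of_nonneg hc.le]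
  have hF : ∀ b, β < b → ‖lowerSource μ η n u b‖ ≤ |(n : ℝ)| * P * A * b ^ r := fun b hb => by
    rw [lowerSource, norm_mul]
    calc _ ≤ |(n : ℝ)| * P * (A * b ^ r) := by
          gcongr
          exacts [(hPb n hn b (hβ.trans hb)).2.2.1, hφ b (hβ.trans hb)]
      _ = _ := by ring
  have h1 := norm_Lplus_le (η := η) hμ hη hn hβ (by positivity) hr hF
  have h2 : ‖cutAvg μ η n u β‖ ≤ P * (A * β ^ r) := by
    rw [cutAvg, norm_mul, Complex.norm_real, Real.norm_eq_abs]
    gcongr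
    exacts [(hPb n hn β hβ).1, hφ β hβ]
  calc _ ≤ (2 * μ - 1) * (P * (A * β ^ r) + |(n : ℝ)| * P * A / (|(n : ℝ)| * (μ - 1)) * β ^ r) := by
        gcongr
        exact (norm_add_le _ _).trans (add_le_add h2 h1)
    _ = _ := by
        field_simp

theorem exists_Kn_bound (hμ : 1 < μ) (hη : IsCutoff η) {δ : ℝ} (hδ0 : 0 < δ) (hδ1 : δ < 1) :
    ∃ C : ℝ, 0 < C ∧ ∀ n : ℤ, n ≠ 0 → ∀ (u : ℝ → ℂ) (M : ℝ), ContinuousOn u (Ioi 0) →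
      (∀ b, 0 < b → ‖u b‖ ≤ M) → ∀ β, 0 < β → |(n : ℝ)| * ‖Kn μ η n u β‖ ≤ C * M ∧
        |(n : ℝ)| * ‖Kn μ η n u β‖ ≤ C * M * β ^ (-δ) := by
  obtain ⟨Q, hQ, hQb⟩ := norm_Kn_le_of_avgMinus hμ hη
  obtain ⟨C, hC, hCb⟩ := exists_avgMinus_decay hμ hη hδ0 hδ1
  refine ⟨Q * C, by positivity, fun n hn u M huc hu β hβ => ?_⟩
  have hn1 : 0 < |(n : ℝ)| := by linarith [one_le_abs_cast hn]
  have h1 := hQb n hn u M (C * M / |(n : ℝ)|) 0 huc hu (by linarith) (fun b hb => by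
    rw [Real.rpow_zero, mul_one, le_div_iff₀ hn1, mul_comm]
    exact (hCb n hn u M huc hu b hb).1) β hβ
  have h2 := hQb n hn u M (C * M / |(n : ℝ)|) (-δ) huc hu (by linarith) (fun b hb => by
    rw [div_mul_eq_mul_div, le_div_iff₀ hn1, mul_comm]
    exact (hCb n hn u M huc hu b hb).2) β hβ
  rw [Real.rpow_zero, mul_one] at h1
  constructor
  · calc _ ≤ |(n : ℝ)| * (Q * (C * M / |(n : ℝ)|)) := by gcongr
      _ = _ := by field_simp
  · calc _ ≤ |(n : ℝ)| * (Q * (C * M / |(n : ℝ)|) * β ^ (-δ)) := by gcongr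
      _ = _ := by field_simp

theorem Kn_congr (hμ : 1 < μ) (hη : IsCutoff η) (hn : n ≠ 0) {u v : ℝ → ℂ} {M β : ℝ}
    (hβ : 0 < β) (huc : ContinuousOn u (Ioi 0)) (hu : ∀ b, 0 < b → ‖u b‖ ≤ M)
    (h : ∀ b, 0 < b → u b = v b) : Kn μ η n u β = Kn μ η n v β := by
  rw [Kn_eq hμ hη hn huc hu hβ, Kn_eq hμ hη hn (huc.congr fun b hb => (h b hb).symm)
    (fun b hb => h b hb ▸ hu b hb) hβ]
  congr 2
  · rw [cutAvg, cutAvg, avgMinus_congr h hβ]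
  · exact Lplus_congr fun b hb => by
      rw [lowerSource, lowerSource, avgMinus_congr h (hβ.trans hb)]

theorem exists_norm_lowerSource_le (hμ : 1 < μ) (hη : IsCutoff η) (hn : n ≠ 0) :
    ∃ C : ℝ, 0 < C ∧ ∀ (u : ℝ → ℂ) (M : ℝ), (∀ b, 0 < b → ‖u b‖ ≤ M) → ∀ β, 0 < β →
      ‖lowerSource μ η n u β‖ ≤ C * M ∧ ‖lowerSource μ η n u β‖ ≤ C * M * β := by
  obtain ⟨P, hP, hPb⟩ := exists_lowerCoeff_bound hμ hη
  obtain ⟨C, hC, hCb⟩ := exists_norm_cutAvgDeriv_le (μ := μ) (η := η) hμ hη hn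
  have hn1 : 0 < |(n : ℝ)| := by linarith [one_le_abs_cast hn]
  refine ⟨|(n : ℝ)| * P * C, by positivity, fun u M hu β hβ => ?_⟩
  have hφ := (hCb u M hu β hβ).1
  rw [lowerSource, norm_mul]
  constructor
  · calc _ ≤ |(n : ℝ)| * P * (C * M) := by
          gcongr
          exact (hPb n hn β hβ).2.2.1
      _ = _ := by ring
  · calc _ ≤ |(n : ℝ)| * P * β * (C * M) := by
          gcongr
          exact (hPb n hn β hβ).2.2.2
      _ = _ := by ring

theorem Kn_add (hμ : 1 < μ) (hη : IsCutoff η) (hn : n ≠ 0) {u v : ℝ → ℂ} {M β : ℝ}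
    (hβ : 0 < β) (huc : ContinuousOn u (Ioi 0)) (hvc : ContinuousOn v (Ioi 0))
    (hu : ∀ b, 0 < b → ‖u b‖ ≤ M) (hv : ∀ b, 0 < b → ‖v b‖ ≤ M) :
    Kn μ η n (fun b => u b + v b) β = Kn μ η n u β + Kn μ η n v β := by
  obtain ⟨C, hC, hCb⟩ := exists_norm_lowerSource_le (η := η) hμ hη hn
  rw [Kn_eq hμ hη hn huc hu hβ, Kn_eq hμ hη hn hvc hv hβ,
    Kn_eq hμ hη hn (u := fun b => u b + v b) (M := 2 * M) (huc.add hvc)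
      (fun b hb => (norm_add_le _ _).trans (by linarith [hu b hb, hv b hb])) hβ]
  have h1 : Lplus μ η n (lowerSource μ η n fun b => u b + v b) β =
      Lplus μ η n (lowerSource μ η n u) β + Lplus μ η n (lowerSource μ η n v) β := by
    rw [← Lplus_add hμ hη hn hβ (continuousOn_lowerSource hμ hη hn huc hu)
      (continuousOn_lowerSource hμ hη hn hvc hv) (fun b hb => (hCb u M hu b hb).2)
      (fun b hb => (hCb v M hv b hb).2)]
    exact Lplus_congr fun b hb => by
      rw [lowerSource, lowerSource, lowerSource, avgMinus_add hμ hη hn (hβ.trans hb) huc hvc hu hv,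
        mul_add]
  rw [h1, cutAvg, cutAvg, cutAvg, avgMinus_add hμ hη hn hβ huc hvc hu hv]
  ring

theorem Kn_const_mul (hμ : 1 < μ) (hη : IsCutoff η) (hn : n ≠ 0) (c : ℂ) {u : ℝ → ℂ} {M β : ℝ}
    (hβ : 0 < β) (huc : ContinuousOn u (Ioi 0)) (hu : ∀ b, 0 < b → ‖u b‖ ≤ M) :
    Kn μ η n (fun b => c * u b) β = c * Kn μ η n u β := by
  rw [Kn_eq hμ hη hn huc hu hβ, Kn_eq hμ hη hn (u := fun b => c * u b) (M := ‖c‖ * M)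
    (continuousOn_const.mul huc)
    (fun b hb => by rw [norm_mul]; gcongr; exact hu b hb) hβ]
  have h1 : Lplus μ η n (lowerSource μ η n fun b => c * u b) β =
      c * Lplus μ η n (lowerSource μ η n u) β := by
    rw [← Lplus_const_mul c _ hβ]
    exact Lplus_congr fun b hb => by
      rw [lowerSource, lowerSource, avgMinus_const_mul c u (hβ.trans hb)]
      ring
  rw [h1, cutAvg, cutAvg, avgMinus_const_mul c u hβ]
  ring

theorem exists_Kn_deriv_bound (hμ : 1 < μ) (hη : IsCutoff η) (hn : n ≠ 0) :
    ∃ C : ℝ, 0 < C ∧ ∀ (u : ℝ → ℂ) (M : ℝ), ContinuousOn u (Ioi 0) →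
      (∀ b, 0 < b → ‖u b‖ ≤ M) → ∀ β, 0 < β → ‖Kn μ η n u β‖ ≤ C * M * β ∧
        ∃ d, HasDerivAt (Kn μ η n u) d β ∧ ‖d‖ ≤ C * M := by
  obtain ⟨C₁, hC₁, hF⟩ := exists_norm_lowerSource_le (η := η) hμ hη hn
  obtain ⟨C₂, hC₂, hD⟩ := exists_norm_cutAvgDeriv_le (μ := μ) (η := η) hμ hη hn
  obtain ⟨P, hP, hPb⟩ := exists_lowerCoeff_bound hμ hη
  have hn1 := one_le_abs_cast hn
  have hn0 : 0 < |(n : ℝ)| := by linarith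
  have hμ1 : 0 < μ - 1 := by linarith
  have hc : 0 < 2 * μ - 1 := by linarith
  set S := C₁ / (|(n : ℝ)| * (μ - 1)) with hS
  have hS0 : 0 < S := by positivity
  have hμ0 : 0 < μ := by linarith
  refine ⟨(2 * μ - 1) * (P * C₂ + S + C₂ + |(n : ℝ)| * S + |(n : ℝ)| * (3 * μ) * S + C₁),
    by positivity, fun u M huc hu β hβ => ?_⟩
  have hM : 0 ≤ M := (norm_nonneg _).trans (hu 1 one_pos)
  have hq0 : ‖Lplus μ η n (lowerSource μ η n u) β‖ ≤ S * M := by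
    have := norm_Lplus_le (η := η) (N := C₁ * M) (r := 0) hμ hη hn hβ
      (by positivity) hc.le
      (fun b hb => by simpa using (hF u M hu b (hβ.trans hb)).1)
    rw [Real.rpow_zero, mul_one] at this
    exact this.trans (le_of_eq (by rw [hS]; ring))
  have hq1 : ‖Lplus μ η n (lowerSource μ η n u) β‖ ≤ S * M * β := by
    have := norm_Lplus_le (η := η) (N := C₁ * M) (r := 1) hμ hη hn hβ
      (by positivity) (by linarith)
      (fun b hb => by simpa using (hF u M hu b (hβ.trans hb)).2)
    rw [Real.rpow_one] at this
    exact this.trans (le_of_eq (by rw [hS]; ring))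
  have hPM : 0 ≤ P * C₂ * M := by positivity
  have hSM : 0 ≤ S * M := by positivity
  have hCM₁ : 0 ≤ C₁ * M := by positivity
  have hCM₂ : 0 ≤ C₂ * M := by positivity
  have hnS : 0 ≤ |(n : ℝ)| * S * M := by positivity
  have hnS' : 0 ≤ |(n : ℝ)| * (3 * μ) * S * M := by positivity
  constructor
  · rw [Kn_eq hμ hη hn huc hu hβ, norm_mul, Complex.norm_real, Real.norm_of_nonneg hc.le, mul_assoc,
      mul_assoc, mul_assoc]
    gcongr
    refine (norm_add_le _ _).trans ?_
    have h2 : ‖cutAvg μ η n u β‖ ≤ P * β * (C₂ * M) := by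
      rw [cutAvg, norm_mul, Complex.norm_real, Real.norm_eq_abs]
      gcongr
      exacts [(hPb n hn β hβ).2.1, (hD u M hu β hβ).1]
    have : 0 ≤ (C₂ + |(n : ℝ)| * S + |(n : ℝ)| * (3 * μ) * S + C₁) * (M * β) := by positivity
    linarith
  · have hLd := hasDerivAt_Lplus hμ hη hn hβ (continuousOn_lowerSource hμ hη hn huc hu)
      (fun b hb => (hF u M hu b hb).1)
    have hd := ((hasDerivAt_cutAvg hμ hη hn huc hu hβ).add hLd).const_mul
      (((2 * μ - 1 : ℝ) : ℂ))
    refine ⟨_, hd.congr_of_eventuallyEq ?_, ?_⟩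
    · filter_upwards [Ioi_mem_nhds hβ] with x hx using Kn_eq hμ hη hn huc hu hx
    rw [norm_mul, Complex.norm_real, Real.norm_of_nonneg hc.le, mul_assoc]
    gcongr
    have ha0 := aFun_pos hμ hη hn β
    have ha1 := aFun_le hμ hη n β
    have e1 : ‖Complex.I * n * Lplus μ η n (lowerSource μ η n u) β‖ ≤ |(n : ℝ)| * (S * M) := by
      rw [norm_mul, norm_mul, Complex.norm_I, Complex.norm_intCast, one_mul]
      gcongr
    have e2 : ‖((2 * μ - 1 + aFun μ η n β : ℝ) : ℂ) / β * Lplus μ η n (lowerSource μ η n u) β‖ ≤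
        |(n : ℝ)| * (3 * μ) * (S * M) := by
      rw [norm_mul, norm_div, Complex.norm_real, Complex.norm_real, Real.norm_of_nonneg hβ.le,
        Real.norm_of_nonneg (by positivity), div_mul_eq_mul_div, div_le_iff₀ hβ]
      calc _ ≤ |(n : ℝ)| * (3 * μ) * (S * M * β) := by
            gcongr
            nlinarith
        _ = _ := by ring
    have e3 : ‖lowerSource μ η n u β / β‖ ≤ C₁ * M := by
      rw [norm_div, Complex.norm_real, Real.norm_of_nonneg hβ.le, div_le_iff₀ hβ]
      exact (hF u M hu β hβ).2
    rw [add_mul (Complex.I * (n : ℂ))]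
    refine (norm_add_le _ _).trans ((add_le_add (hD u M hu β hβ).2
      ((norm_sub_le _ _).trans (add_le_add ((norm_add_le _ _).trans (add_le_add e1 e2)) e3))).trans
      ?_)
    linarith

/-! ### `𝒦_n` as a compact operator on bounded continuous functions -/

/-- `𝒦_n u` extended by zero to the negative axis. -/
noncomputable def KnExt (μ : ℝ) (η : ℝ → ℝ) (n : ℤ) (u : ℝ → ℂ) (β : ℝ) : ℂ :=
  if 0 < β then Kn μ η n u β else 0

theorem exists_lipschitzWith_KnExt (hμ : 1 < μ) (hη : IsCutoff η) (hn : n ≠ 0) :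
    ∃ C : ℝ, 0 < C ∧ ∀ (u : ℝ → ℂ) (M : ℝ), ContinuousOn u (Ioi 0) →
      (∀ b, 0 < b → ‖u b‖ ≤ M) → LipschitzWith (C * M).toNNReal (KnExt μ η n u) := by
  obtain ⟨C, hC, h⟩ := exists_Kn_deriv_bound hμ hη hn
  refine ⟨C, hC, fun u M huc hu => LipschitzWith.of_dist_le_mul fun x y => ?_⟩
  have hM : 0 ≤ M := (norm_nonneg _).trans (hu 1 one_pos)
  have hCM : 0 ≤ C * M := by positivity
  rw [Real.coe_toNNReal _ hCM]
  wlog hxy : x ≤ y generalizing x y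
  · rw [dist_comm, dist_comm x]
    exact this y x (le_of_not_ge hxy)
  rw [dist_comm, dist_comm x, dist_eq_norm, Real.dist_eq, abs_of_nonneg (by linarith)]
  rcases lt_or_ge 0 y with hy | hy
  · rcases lt_or_ge 0 x with hx | hx
    · rw [KnExt, KnExt, if_pos hx, if_pos hy]
      choose! d hd hdC using fun b hb => (h u M huc hu b hb).2
      have := (convex_Ioi (0 : ℝ)).norm_image_sub_le_of_norm_hasDerivWithin_le
        (fun b hb => (hd b hb).hasDerivWithinAt) hdC hx hy
      rwa [Real.norm_of_nonneg (by linarith)] at this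
    · rw [KnExt, KnExt, if_neg hx.not_gt, if_pos hy, sub_zero]
      refine (h u M huc hu y hy).1.trans ?_
      gcongr
      linarith
  · rw [KnExt, KnExt, if_neg hy.not_gt, if_neg (hxy.trans hy).not_gt, sub_zero, norm_zero]
    exact mul_nonneg hCM (by linarith)

/-- `𝒦_n` on bounded continuous functions on the line. -/
noncomputable def KnOp (μ : ℝ) (η : ℝ → ℝ) (n : ℤ) (hμ : 1 < μ) (hη : IsCutoff η) (hn : n ≠ 0) :
    BoundedContinuousFunction ℝ ℂ →L[ℂ] BoundedContinuousFunction ℝ ℂ :=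
  have hbd := exists_Kn_bound hμ hη (δ := 1 / 2) (by norm_num) (by norm_num)
  have hext : ∀ (u : BoundedContinuousFunction ℝ ℂ) (x : ℝ),
      ‖KnExt μ η n u x‖ ≤ hbd.choose * ‖u‖ := fun u x => by
    rw [KnExt]
    split_ifs with hx
    · refine (le_mul_of_one_le_left (norm_nonneg _) (one_le_abs_cast hn)).trans ?_
      exact (hbd.choose_spec.2 n hn u ‖u‖ u.continuous.continuousOn
        (fun b _ => u.norm_coe_le_norm b) x hx).1
    · rw [norm_zero]
      exact mul_nonneg hbd.choose_spec.1.le (norm_nonneg _)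
  LinearMap.mkContinuous
    { toFun := fun u => BoundedContinuousFunction.ofNormedAddCommGroup (KnExt μ η n u)
        ((exists_lipschitzWith_KnExt hμ hη hn).choose_spec.2 u ‖u‖ u.continuous.continuousOn
          fun b _ => u.norm_coe_le_norm b).continuous (hbd.choose * ‖u‖) (hext u)
      map_add' := fun u v => by
        ext x
        simp only [BoundedContinuousFunction.coe_ofNormedAddCommGroup,
          BoundedContinuousFunction.coe_add, Pi.add_apply, KnExt]
        split_ifs with hx
        · exact Kn_add hμ hη hn (M := max ‖u‖ ‖v‖) hx u.continuous.continuousOn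
            v.continuous.continuousOn
            (fun b _ => (u.norm_coe_le_norm b).trans (le_max_left _ _))
            (fun b _ => (v.norm_coe_le_norm b).trans (le_max_right _ _))
        · simp
      map_smul' := fun c u => by
        ext x
        simp only [BoundedContinuousFunction.coe_ofNormedAddCommGroup, RingHom.id_apply,
          BoundedContinuousFunction.coe_smul, KnExt]
        split_ifs with hx
        · exact Kn_const_mul hμ hη hn c hx u.continuous.continuousOn
            fun b _ => u.norm_coe_le_norm b
        · simp }
    hbd.choose fun u => (BoundedContinuousFunction.norm_le
      (mul_nonneg hbd.choose_spec.1.le (norm_nonneg _))).2 (hext u)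

theorem KnOp_apply (hμ : 1 < μ) (hη : IsCutoff η) (hn : n ≠ 0)
    (u : BoundedContinuousFunction ℝ ℂ) (x : ℝ) : KnOp μ η n hμ hη hn u x = KnExt μ η n u x := rfl

theorem isCompactOperator_KnOp (hμ : 1 < μ) (hη : IsCutoff η) (hn : n ≠ 0) :
    IsCompactOperator (KnOp μ η n hμ hη hn) := by
  obtain ⟨C, hC, hCb⟩ := exists_Kn_bound hμ hη (δ := 1 / 2) (by norm_num) (by norm_num)
  obtain ⟨L, hL, hLb⟩ := exists_lipschitzWith_KnExt (η := η) hμ hη hn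
  rw [isCompactOperator_iff_exists_mem_nhds_image_subset_compact]
  refine ⟨Metric.closedBall 0 1, Metric.closedBall_mem_nhds _ one_pos, _,
    isCompact_setOf_lipschitz_decay (L * 1).toNNReal
      (fun x => min (C * 1) (C * 1 * ‖x‖ ^ (-(1 / 2) : ℝ))) (C * 1)
      (fun x => min_le_left _ _) ?_, ?_⟩
  · have h1 := (tendsto_rpow_neg_atTop (y := 1 / 2) (by norm_num)).comp
      (tendsto_norm_cocompact_atTop (E := ℝ))
    have h2 := (tendsto_const_nhds (x := C * 1)).min (h1.const_mul (C * 1))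
    rw [mul_zero, min_eq_right (by linarith)] at h2
    exact h2
  · rintro _ ⟨u, hu, rfl⟩
    have hu1 : ∀ b, 0 < b → ‖u b‖ ≤ 1 := fun b _ =>
      (u.norm_coe_le_norm b).trans (by simpa using hu)
    refine ⟨hLb u 1 u.continuous.continuousOn hu1, fun x => ?_⟩
    rw [KnOp_apply, KnExt]
    split_ifs with hx
    · have h := hCb n hn u 1 u.continuous.continuousOn hu1 x hx
      have h1 := le_mul_of_one_le_left (norm_nonneg (Kn μ η n u x)) (one_le_abs_cast hn)
      rw [Real.norm_of_nonneg hx.le]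
      exact le_min (h1.trans h.1) (h1.trans h.2)
    · rw [norm_zero]
      positivity

end Operator

/-! ### The Laplace transform of the kernel system -/

theorem laplace_add {f g : ℝ → ℂ} {N p : ℝ} (hp : 0 < p) (hfc : ContinuousOn f (Ioi 0))
    (hgc : ContinuousOn g (Ioi 0)) (hf : ∀ x, 0 < x → ‖f x‖ ≤ N * (1 + x))
    (hg : ∀ x, 0 < x → ‖g x‖ ≤ N * (1 + x)) :
    laplace (fun x => f x + g x) p = laplace f p + laplace g p := by
  rw [laplace, laplace, laplace, ← MeasureTheory.integral_add
    (integrableOn_laplace hfc (le_sq_of_le_linear hf) hp)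
    (integrableOn_laplace hgc (le_sq_of_le_linear hg) hp)]
  simp_rw [mul_add]

theorem laplace_const_mul (c : ℂ) (f : ℝ → ℂ) (p : ℝ) :
    laplace (fun x => c * f x) p = c * laplace f p := by
  rw [laplace, laplace, ← MeasureTheory.integral_const_mul c]
  simp_rw [mul_left_comm]

theorem ofReal_add_I_mul_ne_zero (n : ℤ) {p : ℝ} (hp : 0 < p) : (p : ℂ) + Complex.I * n ≠ 0 := by
  intro h
  have := congrArg Complex.re h
  simp at this
  linarith

theorem hasDerivAt_ofReal_rpow (r : ℝ) {p : ℝ} (hp : 0 < p) :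
    HasDerivAt (fun q : ℝ => ((q ^ r : ℝ) : ℂ)) ((r : ℂ) * ((p ^ r : ℝ) : ℂ) / p) p := by
  refine (Real.hasDerivAt_rpow_const (p := r) (Or.inl hp.ne')).ofReal_comp.congr_deriv ?_
  rw [Real.rpow_sub_one hp.ne']
  push_cast
  ring

section System

variable {μ N : ℝ} {n : ℤ} {g U G : ℝ → ℂ}

/-- The potential in the Laplace transform of the kernel system. -/
noncomputable def laplacePotential (μ : ℝ) (n : ℤ) (p : ℝ) : ℂ :=
  (n : ℂ) ^ 2 * (μ : ℂ) ^ 2 - (2 * μ - 1) * (Complex.I * n) / (p + Complex.I * n)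

theorem laplace_system
    (hg : ∀ x, 0 < x → HasDerivAt g (-(U x + (-(2 * μ - 1) : ℂ) * g x) / x) x)
    (hU : ∀ x, 0 < x → HasDerivAt U (-((n : ℂ) ^ 2 * (μ : ℂ) ^ 2 * g x +
      (-((2 * μ - 1) * (Complex.I * n)) * G x + (-(2 * μ - 1) : ℂ) * U x)) / x) x)
    (hG : ∀ x, 0 < x → HasDerivAt G (g x + -(Complex.I * n) * G x) x) (hG0 : G 0 = 0)
    (hgN : ∀ x, 0 < x → ‖g x‖ ≤ N) (hUN : ∀ x, 0 < x → ‖U x‖ ≤ N)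
    (hGN : ∀ x, 0 < x → ‖G x‖ ≤ N * x) {p : ℝ} (hp : 0 < p) :
    HasDerivAt (fun q : ℝ => ((q ^ (2 * μ) : ℝ) : ℂ) * laplace g q)
      (((p ^ (2 * μ) : ℝ) : ℂ) * laplace U p / p) p ∧
    HasDerivAt (fun q : ℝ => ((q ^ (2 * μ) : ℝ) : ℂ) * laplace U q)
      (laplacePotential μ n p * (((p ^ (2 * μ) : ℝ) : ℂ) * laplace g p) / p) p := by
  have hN : 0 ≤ N := (norm_nonneg _).trans (hgN 1 one_pos)
  have hgc : ContinuousOn g (Ioi 0) := fun x hx => (hg x hx).continuousAt.continuousWithinAt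
  have hUc : ContinuousOn U (Ioi 0) := fun x hx => (hU x hx).continuousAt.continuousWithinAt
  have hGc : ContinuousOn G (Ioi 0) := fun x hx => (hG x hx).continuousAt.continuousWithinAt
  have hlin : ∀ (c : ℂ) (f : ℝ → ℂ), (∀ x, 0 < x → ‖f x‖ ≤ N * (1 + x)) → ∀ x, 0 < x →
      ‖c * f x‖ ≤ ‖c‖ * N * (1 + x) := fun c f hf x hx => by
    rw [norm_mul, mul_assoc]
    gcongr
    exact hf x hx
  have hg1 : ∀ x, 0 < x → ‖g x‖ ≤ N * (1 + x) := fun x hx => (hgN x hx).trans (by nlinarith)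
  have hU1 : ∀ x, 0 < x → ‖U x‖ ≤ N * (1 + x) := fun x hx => (hUN x hx).trans (by nlinarith)
  have hG1 : ∀ x, 0 < x → ‖G x‖ ≤ N * (1 + x) := fun x hx => (hGN x hx).trans (by nlinarith)
  set c₁ : ℂ := -(2 * μ - 1) with hc₁
  set c₂ : ℂ := (n : ℂ) ^ 2 * (μ : ℂ) ^ 2 with hc₂
  set c₃ : ℂ := -((2 * μ - 1) * (Complex.I * n)) with hc₃
  set c₄ : ℂ := -(Complex.I * n) with hc₄
  let R : ℝ := (1 + ‖c₁‖ + ‖c₂‖ + ‖c₃‖ + ‖c₄‖) * N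
  have hR : N ≤ R ∧ ‖c₁‖ * N ≤ R ∧ ‖c₂‖ * N ≤ R ∧ ‖c₃‖ * N ≤ R ∧ ‖c₄‖ * N ≤ R ∧
      N + ‖c₁‖ * N ≤ R ∧ N + ‖c₄‖ * N ≤ R ∧ ‖c₃‖ * N + ‖c₁‖ * N ≤ R ∧
      ‖c₂‖ * N + (‖c₃‖ * N + ‖c₁‖ * N) ≤ R := by
    have := mul_nonneg (norm_nonneg c₁) hN
    have := mul_nonneg (norm_nonneg c₂) hN
    have := mul_nonneg (norm_nonneg c₃) hN
    have := mul_nonneg (norm_nonneg c₄) hN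
    simp only [R, add_mul, one_mul]
    refine ⟨?_, ?_, ?_, ?_, ?_, ?_, ?_, ?_, ?_⟩ <;> linarith
  obtain ⟨r0, r1, r2, r3, r4, r01, r04, r31, r231⟩ := hR
  have up : ∀ {S : ℝ} {f : ℝ → ℂ}, S ≤ R → (∀ x, 0 < x → ‖f x‖ ≤ S * (1 + x)) →
      ∀ x, 0 < x → ‖f x‖ ≤ R * (1 + x) := fun hS hf x hx =>
    (hf x hx).trans (mul_le_mul_of_nonneg_right hS (by linarith))
  have sum : ∀ {S T : ℝ} {f h : ℝ → ℂ}, (∀ x, 0 < x → ‖f x‖ ≤ S * (1 + x)) →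
      (∀ x, 0 < x → ‖h x‖ ≤ T * (1 + x)) → ∀ x, 0 < x → ‖f x + h x‖ ≤ (S + T) * (1 + x) :=
    fun hf hh x hx => (norm_add_le _ _).trans (by
      rw [add_mul]
      exact add_le_add (hf x hx) (hh x hx))
  have b1g := hlin c₁ g hg1
  have b1U := hlin c₁ U hU1
  have b2g := hlin c₂ g hg1
  have b3G := hlin c₃ G hG1
  have b4G := hlin c₄ G hG1
  have k1g : ContinuousOn (fun x => c₁ * g x) (Ioi 0) := continuousOn_const.mul hgc
  have k1U : ContinuousOn (fun x => c₁ * U x) (Ioi 0) := continuousOn_const.mul hUc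
  have k2g : ContinuousOn (fun x => c₂ * g x) (Ioi 0) := continuousOn_const.mul hgc
  have k3G : ContinuousOn (fun x => c₃ * G x) (Ioi 0) := continuousOn_const.mul hGc
  have k4G : ContinuousOn (fun x => c₄ * G x) (Ioi 0) := continuousOn_const.mul hGc
  have L1 := laplace_euler hp hg (up r0 hg1) (hUc.add k1g) (up r01 (sum hU1 b1g))
  have L2 := laplace_euler hp hU (up r0 hU1) (k2g.add (k3G.add k1U))
    (up r231 (sum b2g (sum b3G b1U)))
  have L3 := laplace_deriv hp hG0 hG (N := R) (fun x hx => (hGN x hx).trans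
    (mul_le_mul_of_nonneg_right r0 hx.le)) (hgc.add k4G) (up r04 (sum hg1 b4G))
  rw [laplace_add hp hUc k1g (up r0 hU1) (up r1 b1g), laplace_const_mul] at L1
  rw [laplace_add (g := fun x => c₃ * G x + c₁ * U x) hp k2g (k3G.add k1U) (up r2 b2g)
      (up r31 (sum b3G b1U)),
    laplace_add hp k3G k1U (up r3 b3G) (up r1 b1U), laplace_const_mul, laplace_const_mul,
    laplace_const_mul] at L2
  rw [laplace_add hp hgc k4G (up r0 hg1) (up r4 b4G), laplace_const_mul] at L3
  have hp' : (p : ℂ) ≠ 0 := by exact_mod_cast hp.ne'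
  have hpn := ofReal_add_I_mul_ne_zero n hp
  have D1 := (hasDerivAt_ofReal_rpow (2 * μ) hp).mul (hasDerivAt_laplace hgc hg1 hp)
  have D2 := (hasDerivAt_ofReal_rpow (2 * μ) hp).mul (hasDerivAt_laplace hUc hU1 hp)
  have hGhat : laplace G p = laplace g p / (p + Complex.I * n) := by
    rw [eq_div_iff hpn]
    linear_combination L3
  rw [hGhat] at L2
  have hpow : ∀ z : ℂ, ((2 * μ : ℝ) : ℂ) * ((p ^ (2 * μ) : ℝ) : ℂ) / p * z * p =
      ((2 * μ : ℝ) : ℂ) * ((p ^ (2 * μ) : ℝ) : ℂ) * z := fun z => by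
    field_simp
  constructor
  · refine D1.congr_deriv ?_
    rw [eq_div_iff hp', add_mul, hpow (laplace g p)]
    push_cast
    linear_combination ((p ^ (2 * μ) : ℝ) : ℂ) * (L1 + laplace g p * hc₁)
  · refine D2.congr_deriv ?_
    rw [laplacePotential, eq_div_iff hp']
    rw [add_mul, hpow (laplace U p)]
    push_cast
    linear_combination ((p ^ (2 * μ) : ℝ) : ℂ) * (L2 + laplace g p * hc₂ +
      laplace g p / (p + Complex.I * n) * hc₃ + laplace U p * hc₁)

theorem re_laplacePotential_ge (hμ : 1 < μ) {p : ℝ} (hp : 0 < p) :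
    (n : ℝ) ^ 2 * μ ^ 2 - (2 * μ - 1) ≤ (laplacePotential μ n p).re := by
  have hpn := ofReal_add_I_mul_ne_zero n hp
  have e : laplacePotential μ n p = (((n : ℝ) ^ 2 * μ ^ 2 - (2 * μ - 1) : ℝ) : ℂ) +
      (((2 * μ - 1) * p : ℝ) : ℂ) * (p + Complex.I * n)⁻¹ := by
    rw [laplacePotential, ← sub_eq_zero]
    generalize hz : (p : ℂ) + Complex.I * n = z at hpn ⊢
    have hI : Complex.I * n = z - p := by rw [← hz]; ring
    rw [hI]
    push_cast
    field_simp
    ring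
  rw [e, Complex.add_re, Complex.ofReal_re, Complex.re_ofReal_mul, Complex.inv_re]
  have : 0 ≤ (2 * μ - 1) * p * (((p : ℂ) + Complex.I * n).re /
      Complex.normSq ((p : ℂ) + Complex.I * n)) := by
    have h2 : 0 < 2 * μ - 1 := by linarith
    have h3 : ((p : ℂ) + Complex.I * n).re = p := by simp
    rw [h3]
    have := Complex.normSq_nonneg ((p : ℂ) + Complex.I * n)
    positivity
  linarith

theorem eq_zero_of_hasDerivAt_zero {f : ℝ → ℂ} (hf : ∀ p, 0 < p → HasDerivAt f 0 p)
    (h0 : Tendsto (fun p => ‖f p‖) (𝓝[>] 0) (𝓝 0)) : ∀ p, 0 < p → f p = 0 := by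
  intro p hp
  have hc : ∀ q, 0 < q → f q = f p := fun q hq => by
    have := (convex_Ioi (0 : ℝ)).norm_image_sub_le_of_norm_hasDerivWithin_le (C := 0)
      (fun b hb => (hf b hb).hasDerivWithinAt) (fun b hb => by simp) hp hq
    rw [zero_mul] at this
    exact sub_eq_zero.1 (norm_le_zero_iff.1 this)
  have h1 : Tendsto (fun q => ‖f q‖) (𝓝[>] 0) (𝓝 ‖f p‖) :=
    tendsto_const_nhds.congr' (by
      filter_upwards [self_mem_nhdsWithin] with q hq
      rw [hc q hq])
  exact norm_eq_zero.1 (tendsto_nhds_unique h1 h0)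

theorem tendsto_const_mul_rpow_zero (C : ℝ) {r : ℝ} (hr : 0 < r) :
    Tendsto (fun p : ℝ => C * p ^ r) (𝓝[>] 0) (𝓝 0) := by
  have h := ((Real.continuousAt_rpow_const 0 r (Or.inr hr.le)).tendsto.mono_left
    (nhdsWithin_le_nhds (s := Ioi 0))).const_mul C
  rwa [Real.zero_rpow hr.ne', mul_zero] at h

theorem rpow_mul_div_self (N : ℝ) {p r : ℝ} (hp : 0 < p) : p ^ r * (N / p) = N * p ^ (r - 1) := by
  rw [Real.rpow_sub_one hp.ne']
  ring

/-- For `|n| = 1` the system has the explicit solution `(p + in) p^{μ-1}`, and a solution with a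
bounded preimage is comparatively too small at the origin. -/
theorem laplace_eq_zero_of_abs_one (hμ : 1 < μ) (hn : |n| = 1)
    (hk : ∀ p : ℝ, 0 < p → HasDerivAt (fun q : ℝ => ((q ^ (2 * μ) : ℝ) : ℂ) * laplace g q)
      (((p ^ (2 * μ) : ℝ) : ℂ) * laplace U p / p) p)
    (hl : ∀ p : ℝ, 0 < p → HasDerivAt (fun q : ℝ => ((q ^ (2 * μ) : ℝ) : ℂ) * laplace U q)
      (laplacePotential μ n p * (((p ^ (2 * μ) : ℝ) : ℂ) * laplace g p) / p) p)
    (hgN : ∀ x, 0 < x → ‖g x‖ ≤ N) (hUN : ∀ x, 0 < x → ‖U x‖ ≤ N) {p : ℝ} (hp : 0 < p) :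
    laplace g p = 0 := by
  have hN : 0 ≤ N := (norm_nonneg _).trans (hgN 1 one_pos)
  have hn1 : |(n : ℝ)| = 1 := by exact_mod_cast hn
  have hn2 : (n : ℂ) ^ 2 = 1 := by
    have : n ^ 2 = 1 := by rw [← sq_abs, hn]; norm_num
    exact_mod_cast this
  set k : ℝ → ℂ := fun q => ((q ^ (2 * μ) : ℝ) : ℂ) * laplace g q with hkdef
  set l : ℝ → ℂ := fun q => ((q ^ (2 * μ) : ℝ) : ℂ) * laplace U q with hldef
  let z : ℝ → ℂ := fun q => (q + Complex.I * n) * ((q ^ (μ - 1) : ℝ) : ℂ)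
  let y : ℝ → ℂ := fun q => (q + (μ - 1) * (q + Complex.I * n)) * ((q ^ (μ - 1) : ℝ) : ℂ)
  have hz : ∀ q : ℝ, 0 < q → HasDerivAt z (y q / q) q := fun q hq => by
    have hq' : (q : ℂ) ≠ 0 := by exact_mod_cast hq.ne'
    refine (((hasDerivAt_ofReal q).add_const _).mul
      (hasDerivAt_ofReal_rpow (μ - 1) hq)).congr_deriv ?_
    simp only [y]
    push_cast
    field_simp
  have hy : ∀ q : ℝ, 0 < q → HasDerivAt y (laplacePotential μ n q * z q / q) q := fun q hq => by
    have hq' : (q : ℂ) ≠ 0 := by exact_mod_cast hq.ne'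
    have hqn := ofReal_add_I_mul_ne_zero n hq
    refine (((hasDerivAt_ofReal q).add (((hasDerivAt_ofReal q).add_const
      (Complex.I * (n : ℂ))).const_mul ((μ : ℂ) - 1))).mul
      (hasDerivAt_ofReal_rpow (μ - 1) hq)).congr_deriv ?_
    simp only [z, laplacePotential, Pi.add_apply, hn2]
    push_cast
    field_simp
    ring
  have hzn : ∀ q : ℝ, 0 < q → q ^ (μ - 1) ≤ ‖z q‖ := fun q hq => by
    have h1 : 1 ≤ ‖(q : ℂ) + Complex.I * n‖ := by
      have := Complex.abs_im_le_norm ((q : ℂ) + Complex.I * n)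
      simpa [hn1] using this
    simp only [z]
    rw [norm_mul, Complex.norm_real, Real.norm_of_nonneg (by positivity)]
    exact le_mul_of_one_le_left (by positivity) h1
  have hz0 : ∀ q : ℝ, 0 < q → z q ≠ 0 := fun q hq h => by
    have := hzn q hq
    rw [h, norm_zero] at this
    exact absurd (Real.rpow_pos_of_pos hq (μ - 1)) this.not_gt
  have hkb : ∀ q : ℝ, 0 < q → ‖k q‖ ≤ N * q ^ (2 * μ - 1) := fun q hq => by
    rw [← rpow_mul_div_self N hq, hkdef, norm_mul, Complex.norm_real,
      Real.norm_of_nonneg (by positivity)]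
    gcongr
    exact norm_laplace_le hq hgN
  have hlb : ∀ q : ℝ, 0 < q → ‖l q‖ ≤ N * q ^ (2 * μ - 1) := fun q hq => by
    rw [← rpow_mul_div_self N hq, hldef, norm_mul, Complex.norm_real,
      Real.norm_of_nonneg (by positivity)]
    gcongr
    exact norm_laplace_le hq hUN
  have hpn2 : ∀ q : ℝ, 0 < q → q < 1 → ‖(q : ℂ) + Complex.I * n‖ ≤ 2 := fun q hq hq1 => by
    refine (norm_add_le _ _).trans ?_
    rw [Complex.norm_real, Real.norm_of_nonneg hq.le, norm_mul, Complex.norm_I,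
      Complex.norm_intCast, hn1]
    linarith
  have hr1 : ∀ q : ℝ, 0 < q → q < 1 → q ^ (μ - 1) ≤ 1 := fun q hq hq1 =>
    Real.rpow_le_one hq.le hq1.le (by linarith)
  have hW : ∀ q, 0 < q → z q * l q - k q * y q = 0 := by
    refine eq_zero_of_hasDerivAt_zero (fun q hq => ?_) ?_
    · refine (((hz q hq).mul (hl q hq)).sub ((hk q hq).mul (hy q hq))).congr_deriv ?_
      simp only [hkdef, hldef]
      ring
    · refine squeeze_zero' (Eventually.of_forall fun q => norm_nonneg _) ?_
        (tendsto_const_mul_rpow_zero ((5 + 2 * (μ - 1)) * N) (r := 2 * μ - 1) (by linarith))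
      filter_upwards [Ioo_mem_nhdsGT one_pos] with q hq
      obtain ⟨hq, hq1⟩ := hq
      have a1 := hpn2 q hq hq1
      have a2 := hr1 q hq hq1
      have hz2 : ‖z q‖ ≤ 2 * 1 := by
        simp only [z]
        rw [norm_mul, Complex.norm_real, Real.norm_of_nonneg (by positivity)]
        gcongr
      have hy2 : ‖y q‖ ≤ (1 + (μ - 1) * 2) * 1 := by
        simp only [y]
        rw [norm_mul, Complex.norm_real, Real.norm_of_nonneg (by positivity)]
        gcongr
        refine (norm_add_le _ _).trans ?_
        rw [Complex.norm_real, Real.norm_of_nonneg hq.le, norm_mul,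
          show (μ : ℂ) - 1 = ((μ - 1 : ℝ) : ℂ) by push_cast; ring, Complex.norm_real,
          Real.norm_of_nonneg (by linarith)]
        have : (μ - 1) * ‖(q : ℂ) + Complex.I * n‖ ≤ (μ - 1) * 2 :=
          mul_le_mul_of_nonneg_left a1 (by linarith)
        linarith
      have hE : 0 ≤ N * q ^ (2 * μ - 1) := by positivity
      refine (norm_sub_le _ _).trans ?_
      rw [norm_mul (z q), norm_mul (k q)]
      calc _ ≤ 2 * 1 * (N * q ^ (2 * μ - 1)) + N * q ^ (2 * μ - 1) * ((1 + (μ - 1) * 2) * 1) := by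
            exact add_le_add (mul_le_mul hz2 (hlb q hq) (norm_nonneg _) (by norm_num))
              (mul_le_mul (hkb q hq) hy2 (norm_nonneg _) hE)
        _ ≤ _ := by nlinarith
  have hkz : ∀ q, 0 < q → k q / z q = 0 := by
    refine eq_zero_of_hasDerivAt_zero (fun q hq => ?_) ?_
    · refine ((hk q hq).div (hz q hq) (hz0 q hq)).congr_deriv ?_
      have : l q / q * z q - k q * (y q / q) = (z q * l q - k q * y q) / q := by ring
      simp only [hkdef, hldef] at this hW ⊢
      rw [this, hW q hq]
      simp
    · refine squeeze_zero' (Eventually.of_forall fun q => norm_nonneg _) ?_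
        (tendsto_const_mul_rpow_zero N (r := μ) (by linarith))
      filter_upwards [self_mem_nhdsWithin] with q hq
      have hq : 0 < q := hq
      rw [norm_div, div_le_iff₀ ((Real.rpow_pos_of_pos hq _).trans_le (hzn q hq))]
      calc _ ≤ N * q ^ (2 * μ - 1) := hkb q hq
        _ = N * q ^ μ * q ^ (μ - 1) := by
          rw [mul_assoc, ← Real.rpow_add hq]
          ring_nf
        _ ≤ _ := by
          gcongr
          exact hzn q hq
  have h1 := hkz p hp
  rw [div_eq_zero_iff, or_iff_left (hz0 p hp)] at h1
  have h2 : ((p ^ (2 * μ) : ℝ) : ℂ) ≠ 0 := by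
    exact_mod_cast (Real.rpow_pos_of_pos hp _).ne'
  exact (mul_eq_zero.1 h1).resolve_left h2

theorem laplace_eq_zero_of_two_le {M : ℝ} (hμ : 1 < μ) (hn : 2 ≤ |n|)
    (hk : ∀ p : ℝ, 0 < p → HasDerivAt (fun q : ℝ => ((q ^ (2 * μ) : ℝ) : ℂ) * laplace g q)
      (((p ^ (2 * μ) : ℝ) : ℂ) * laplace U p / p) p)
    (hl : ∀ p : ℝ, 0 < p → HasDerivAt (fun q : ℝ => ((q ^ (2 * μ) : ℝ) : ℂ) * laplace U q)
      (laplacePotential μ n p * (((p ^ (2 * μ) : ℝ) : ℂ) * laplace g p) / p) p)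
    (hgN : ∀ x, 0 < x → ‖g x‖ ≤ N) (hgM : ∀ x, 0 < x → ‖g x‖ ≤ M * x) {p : ℝ} (hp : 0 < p) :
    laplace g p = 0 := by
  have hn2 : (2 : ℝ) ≤ |(n : ℝ)| := by exact_mod_cast hn
  have hn4 : (4 : ℝ) ≤ (n : ℝ) ^ 2 := by rw [← sq_abs]; nlinarith
  have hs : ∀ q : ℝ, 0 < q → (2 * μ - 3 / 2) ^ 2 ≤ (laplacePotential μ n q).re := fun q hq => by
    refine le_trans ?_ (re_laplacePotential_ge hμ hq)
    nlinarith [sq_nonneg μ]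
  have hnorm : ∀ q : ℝ, 0 < q → q ^ (-(2 * μ - 3 / 2)) * ‖((q ^ (2 * μ) : ℝ) : ℂ) * laplace g q‖ =
      q ^ (3 / 2 : ℝ) * ‖laplace g q‖ := fun q hq => by
    rw [norm_mul, Complex.norm_real, Real.norm_of_nonneg (by positivity), ← mul_assoc,
      ← Real.rpow_add hq]
    ring_nf
  have h := eq_zero_of_euler_second_order hs hk hl ?_ ?_ p hp
  · have h2 : ((p ^ (2 * μ) : ℝ) : ℂ) ≠ 0 := by
      exact_mod_cast (Real.rpow_pos_of_pos hp _).ne'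
    exact (mul_eq_zero.1 h).resolve_left h2
  · refine squeeze_zero' ?_ ?_ (tendsto_const_mul_rpow_zero N (r := 1 / 2) (by norm_num))
    · filter_upwards [self_mem_nhdsWithin] with q hq
      have hq : 0 < q := hq
      positivity
    · filter_upwards [self_mem_nhdsWithin] with q hq
      have hq : 0 < q := hq
      rw [hnorm q hq, show (1 / 2 : ℝ) = 3 / 2 - 1 by norm_num, ← rpow_mul_div_self N hq]
      gcongr
      exact norm_laplace_le hq hgN
  · have hlim := (tendsto_rpow_neg_atTop (y := 1 / 2) (by norm_num)).const_mul M
    rw [mul_zero] at hlim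
    refine squeeze_zero' ?_ ?_ hlim
    · filter_upwards [eventually_gt_atTop 0] with q hq
      positivity
    · filter_upwards [eventually_gt_atTop 0] with q hq
      rw [hnorm q hq]
      calc _ ≤ q ^ (3 / 2 : ℝ) * (M / q ^ 2) := by
            gcongr
            exact norm_laplace_le_sq hq hgM
        _ = M * (q ^ (3 / 2 : ℝ) * q ^ (-2 : ℝ)) := by
            rw [Real.rpow_neg hq.le, Real.rpow_two]
            ring
        _ = _ := by
            rw [← Real.rpow_add hq]
            norm_num

end System

/-! ### Injectivity of `id + 𝒦_n` -/

section Injectivity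

variable {μ : ℝ} {η : ℝ → ℝ} {n : ℤ} {u : ℝ → ℂ} {M β : ℝ}

theorem hasDerivAt_of_add_Kn_eq_zero (hμ : 1 < μ) (hη : IsCutoff η) (hn : n ≠ 0)
    (huc : ContinuousOn u (Ioi 0)) (hu : ∀ b, 0 < b → ‖u b‖ ≤ M)
    (h : ∀ b, 0 < b → u b + Kn μ η n u b = 0) (hβ : 0 < β) :
    HasDerivAt u ((Complex.I * n + ((2 * μ - 1 + aFun μ η n β : ℝ) : ℂ) / β) * u β -
      (2 * μ - 1) * (chiFun μ η n β * Lminus μ η n u β -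
        Complex.I * n * primMinus μ η n u β) / β) β := by
  obtain ⟨C, -, hC⟩ := exists_norm_lowerSource_le (μ := μ) (η := η) hμ hη hn
  have hβ' : (β : ℂ) ≠ 0 := by exact_mod_cast hβ.ne'
  have hu' : ∀ b, 0 < b → u b = -(((2 * μ - 1 : ℝ) : ℂ) *
      (cutAvg μ η n u b + Lplus μ η n (lowerSource μ η n u) b)) := fun b hb => by
    rw [← Kn_eq hμ hη hn huc hu hb]
    exact eq_neg_of_add_eq_zero_left (h b hb)
  have hd := (((hasDerivAt_cutAvg hμ hη hn huc hu hβ).add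
    (hasDerivAt_Lplus hμ hη hn hβ (continuousOn_lowerSource hμ hη hn huc hu)
      fun b hb => (hC u M hu b hb).1)).const_mul (((2 * μ - 1 : ℝ) : ℂ))).neg
  refine (hd.congr_of_eventuallyEq ?_).congr_deriv ?_
  · filter_upwards [Ioi_mem_nhds hβ] with b hb using hu' b hb
  · rw [hu' β hβ]
    simp only [cutAvg, cutAvgDeriv, lowerSource, lowerCoeff, avgMinus]
    push_cast
    field_simp
    ring

/-- The companion `u + a_n L_{n,-}^{-1}u` of `L_{n,-}^{-1}u`. -/
noncomputable def companion (μ : ℝ) (η : ℝ → ℝ) (n : ℤ) (u : ℝ → ℂ) (β : ℝ) : ℂ :=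
  u β + (aFun μ η n β : ℂ) * Lminus μ η n u β

theorem hasDerivAt_companion (hμ : 1 < μ) (hη : IsCutoff η) (hn : n ≠ 0)
    (huc : ContinuousOn u (Ioi 0)) (hu : ∀ b, 0 < b → ‖u b‖ ≤ M)
    (h : ∀ b, 0 < b → u b + Kn μ η n u b = 0) (hβ : 0 < β) :
    HasDerivAt (companion μ η n u)
      ((Complex.I * n + (2 * μ - 1) / β) * companion μ η n u β -
        ((n : ℂ) ^ 2 * (μ : ℂ) ^ 2 * Lminus μ η n u β -
          (2 * μ - 1) * (Complex.I * n) * primMinus μ η n u β) / β) β := by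
  have hβ' : (β : ℂ) ≠ 0 := by exact_mod_cast hβ.ne'
  have ha : (aFun μ η n β : ℂ) ≠ 0 := by exact_mod_cast (aFun_pos hμ hη hn β).ne'
  have hsq : (aFun μ η n β : ℂ) ^ 2 = (n : ℂ) ^ 2 * (μ : ℂ) ^ 2 - (2 * μ - 1) * η β := by
    exact_mod_cast congrArg (fun x : ℝ => (x : ℂ)) (sq_aFun hμ hη hn β)
  refine ((hasDerivAt_of_add_Kn_eq_zero hμ hη hn huc hu h hβ).add
    ((hasDerivAt_aFun hμ hη hn β).ofReal_comp.mul
      (hasDerivAt_Lminus hμ hη hn hβ huc hu))).congr_deriv ?_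
  have hχ : (2 * μ - 1) * (chiFun μ η n β : ℂ) -
      β * (-((2 * μ - 1) * deriv η β) / (2 * aFun μ η n β)) =
      (n : ℂ) ^ 2 * (μ : ℂ) ^ 2 - (aFun μ η n β : ℂ) ^ 2 := by
    rw [hsq, chiFun]
    push_cast
    ring
  rw [companion, ← sub_eq_zero]
  push_cast
  have : (β : ℂ)⁻¹ * β = 1 := inv_mul_cancel₀ hβ'
  linear_combination (-Lminus μ η n u β / β) * hχ +
    (-((2 * μ - 1) * ((deriv η β : ℝ) : ℂ)) / (2 * aFun μ η n β)) * Lminus μ η n u β * (-this)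

/-- A bounded solution of `u + 𝒦_n u = 0` vanishes. -/
theorem eq_zero_of_add_Kn_eq_zero (hμ : 1 < μ) (hη : IsCutoff η) (hn : n ≠ 0)
    (huc : ContinuousOn u (Ioi 0)) (hu : ∀ b, 0 < b → ‖u b‖ ≤ M)
    (h : ∀ b, 0 < b → u b + Kn μ η n u b = 0) : ∀ b, 0 < b → u b = 0 := by
  have hM : 0 ≤ M := (norm_nonneg _).trans (hu 1 one_pos)
  obtain ⟨C, hC, hCb⟩ := exists_norm_Lminus_le (η := η) hμ hη hn
  obtain ⟨D, hD, hDb⟩ := exists_Kn_deriv_bound (η := η) hμ hη hn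
  set e : ℝ → ℂ := fun x => Complex.exp (Complex.I * ((-n : ℤ) : ℂ) * (x : ℂ)) with he
  have he1 : ∀ x, ‖e x‖ = 1 := norm_phase_zero (-n)
  have hed : ∀ x, HasDerivAt e (e x * (Complex.I * ((-n : ℤ) : ℂ))) x := hasDerivAt_phase (-n)
  set g : ℝ → ℂ := fun x => e x * Lminus μ η n u x with hg
  set U : ℝ → ℂ := fun x => e x * companion μ η n u x with hU
  set G : ℝ → ℂ := fun x => e x * primMinus μ η n u x with hG
  have dg : ∀ x, 0 < x → HasDerivAt g (-(U x + (-(2 * μ - 1) : ℂ) * g x) / x) x := fun x hx => by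
    have hx' : (x : ℂ) ≠ 0 := by exact_mod_cast hx.ne'
    refine ((hed x).mul (hasDerivAt_Lminus hμ hη hn hx huc hu)).congr_deriv ?_
    simp only [hU, hg, companion]
    push_cast
    field_simp
    ring
  have dU : ∀ x, 0 < x → HasDerivAt U (-((n : ℂ) ^ 2 * (μ : ℂ) ^ 2 * g x +
      (-((2 * μ - 1) * (Complex.I * n)) * G x + (-(2 * μ - 1) : ℂ) * U x)) / x) x := fun x hx => by
    have hx' : (x : ℂ) ≠ 0 := by exact_mod_cast hx.ne'
    refine ((hed x).mul (hasDerivAt_companion hμ hη hn huc hu h hx)).congr_deriv ?_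
    simp only [hU, hg, hG]
    push_cast
    field_simp
    ring
  have dG : ∀ x, 0 < x → HasDerivAt G (g x + -(Complex.I * n) * G x) x := fun x hx => by
    refine ((hed x).mul (hasDerivAt_primMinus hμ hη hn huc hu hx)).congr_deriv ?_
    simp only [hg, hG]
    push_cast
    ring
  have hG0 : G 0 = 0 := by simp [hG, primMinus]
  have bL := hCb u M hu
  set N : ℝ := M + (|(n : ℝ)| * μ + 1) * (C * M) with hN
  have hCM : 0 ≤ C * M := by positivity
  have hnμ : 0 ≤ |(n : ℝ)| * μ := by positivity
  have hCN : C * M ≤ N := by nlinarith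
  have bg : ∀ x, 0 < x → ‖g x‖ ≤ N := fun x hx => by
    rw [hg, norm_mul, he1, one_mul]
    exact (bL x hx).trans hCN
  have bU : ∀ x, 0 < x → ‖U x‖ ≤ N := fun x hx => by
    rw [hU, norm_mul, he1, one_mul, companion]
    refine (norm_add_le _ _).trans ?_
    rw [norm_mul, Complex.norm_real, Real.norm_of_nonneg (aFun_pos hμ hη hn x).le]
    have := mul_le_mul (aFun_le hμ hη n x) (bL x hx) (norm_nonneg _) hnμ
    have := hu x hx
    linarith
  have bG : ∀ x, 0 < x → ‖G x‖ ≤ N * x := fun x hx => by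
    rw [hG, norm_mul, he1, one_mul]
    exact (norm_primMinus_le bL hx).trans (mul_le_mul_of_nonneg_right hCN hx.le)
  have hlap : ∀ p, 0 < p → laplace g p = 0 := fun p hp => by
    have hsys := fun q (hq : 0 < q) => laplace_system dg dU dG hG0 bg bU bG hq
    by_cases hn2 : 2 ≤ |n|
    · have hur : ∀ b, 0 < b → ‖u b‖ ≤ D * M * b ^ (1 : ℝ) := fun b hb => by
        rw [eq_neg_of_add_eq_zero_left (h b hb), norm_neg, Real.rpow_one]
        exact (hDb u M huc hu b hb).1
      refine laplace_eq_zero_of_two_le hμ hn2 (fun q hq => (hsys q hq).1)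
        (fun q hq => (hsys q hq).2) bg (M := D * M / (alphaInf μ n - (2 * μ - 1)))
        (fun x hx => ?_) hp
      rw [hg, norm_mul, he1, one_mul]
      simpa using norm_Lminus_le_of_two_le hμ hη hn hn2 hx (by positivity) zero_le_one hur
    · exact laplace_eq_zero_of_abs_one hμ (abs_eq_one_of_not_two_le hn hn2)
        (fun q hq => (hsys q hq).1) (fun q hq => (hsys q hq).2) bg bU hp
  have hgc : ContinuousOn g (Ioi 0) := fun x hx => (dg x hx).continuousAt.continuousWithinAt
  have g0 := eq_zero_of_laplace_eq_zero hgc bg hlap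
  intro b hb
  have hb' : (b : ℂ) ≠ 0 := by exact_mod_cast hb.ne'
  have heb : e b ≠ 0 := Complex.exp_ne_zero _
  have hd0 : HasDerivAt g 0 b := (hasDerivAt_const b (0 : ℂ)).congr_of_eventuallyEq
    (by filter_upwards [Ioi_mem_nhds hb] with x hx using g0 x hx)
  have h1 := (dg b hb).unique hd0
  rw [g0 b hb, mul_zero, add_zero, div_eq_zero_iff, or_iff_left hb', neg_eq_zero] at h1
  have h2 := (mul_eq_zero.1 h1).resolve_left heb
  rwa [companion, (mul_eq_zero.1 (g0 b hb)).resolve_left heb, mul_zero, add_zero] at h2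

end Injectivity

/-! ### Uniform invertibility -/

section Invertibility

variable {μ δ : ℝ} {η : ℝ → ℝ} {n : ℤ}

theorem eq_zero_of_add_KnOp_eq_zero (hμ : 1 < μ) (hη : IsCutoff η) (hn : n ≠ 0)
    (u : BoundedContinuousFunction ℝ ℂ) (h : u + KnOp μ η n hμ hη hn u = 0) : u = 0 := by
  have hx : ∀ x, u x + KnExt μ η n u x = 0 := fun x => congrArg (fun f => f x) h
  have hpos := eq_zero_of_add_Kn_eq_zero hμ hη hn u.continuous.continuousOn
    (fun b _ => u.norm_coe_le_norm b) fun b hb => by simpa [KnExt, hb] using hx b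
  ext x
  rcases lt_or_ge 0 x with h0 | h0
  · exact hpos x h0
  · simpa [KnExt, h0.not_gt] using hx x

theorem exists_add_KnOp_lower_bound (hμ : 1 < μ) (hη : IsCutoff η) :
    ∃ C : ℝ, 0 ≤ C ∧ ∀ (n : ℤ) (hn : n ≠ 0) (u : BoundedContinuousFunction ℝ ℂ),
      ‖u‖ ≤ C * ‖u + KnOp μ η n hμ hη hn u‖ := by
  obtain ⟨C₀, hC₀, hK⟩ := exists_Kn_bound hμ hη (δ := 1 / 2) (by norm_num) (by norm_num)
  have hfin : ∀ n : ℤ, ∃ c : ℝ, 0 ≤ c ∧ ∀ (hn : n ≠ 0) (u : BoundedContinuousFunction ℝ ℂ),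
      ‖u‖ ≤ c * ‖u + KnOp μ η n hμ hη hn u‖ := fun n => by
    by_cases hn : n = 0
    · exact ⟨0, le_rfl, fun h => absurd hn h⟩
    · obtain ⟨c, hc, h⟩ := (IsCompactOperator.exists_bound_surjective_of_injective _
        (isCompactOperator_KnOp hμ hη hn) (eq_zero_of_add_KnOp_eq_zero hμ hη hn)).1
      exact ⟨c, hc, fun _ => h⟩
  choose c hc hcb using hfin
  obtain ⟨N, hN⟩ := exists_nat_ge (2 * C₀)
  have hS : 0 ≤ ∑ k ∈ Finset.Icc (-(N : ℤ)) N, c k := Finset.sum_nonneg fun k _ => hc k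
  refine ⟨2 + ∑ k ∈ Finset.Icc (-(N : ℤ)) N, c k, by linarith, fun n hn u => ?_⟩
  by_cases hnN : n ∈ Finset.Icc (-(N : ℤ)) N
  · refine (hcb n hn u).trans ?_
    gcongr
    linarith [Finset.single_le_sum (fun k _ => hc k) hnN]
  · have hnN' : (N : ℝ) ≤ |(n : ℝ)| := by
      have : (N : ℤ) ≤ |n| := by
        by_contra hlt
        exact hnN (Finset.mem_Icc.2 (abs_le.1 (not_le.1 hlt).le))
      exact_mod_cast this
    have hKu : ‖KnOp μ η n hμ hη hn u‖ ≤ ‖u‖ / 2 := by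
      refine (BoundedContinuousFunction.norm_le (by positivity)).2 fun x => ?_
      rw [KnOp_apply, KnExt]
      split_ifs with hx
      · have h1 := (hK n hn u ‖u‖ u.continuous.continuousOn
          (fun b _ => u.norm_coe_le_norm b) x hx).1
        have h2 := mul_le_mul_of_nonneg_right (hN.trans hnN') (norm_nonneg (Kn μ η n u x))
        have h3 : C₀ * ‖Kn μ η n u x‖ ≤ C₀ * (‖u‖ / 2) := by linarith
        exact le_of_mul_le_mul_left h3 hC₀
      · rw [norm_zero]
        positivity
    have h1 : ‖u‖ ≤ ‖u + KnOp μ η n hμ hη hn u‖ + ‖KnOp μ η n hμ hη hn u‖ := by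
      simpa using norm_sub_le (u + KnOp μ η n hμ hη hn u) (KnOp μ η n hμ hη hn u)
    have h2 := mul_nonneg hS (norm_nonneg (u + KnOp μ η n hμ hη hn u))
    linarith

theorem MemCdelta.bddAbove_norm {f : ℝ → ℂ} (hf : MemCdelta δ f 0) :
    BddAbove (range fun β : Ici (0 : ℝ) => ‖f (β : ℝ)‖) := by
  obtain ⟨R, hR⟩ := eventually_atTop.1 (hf.2.1.norm.eventually_lt_const
    (norm_zero.trans_lt (one_pos (α := ℝ))))
  obtain ⟨B, hB⟩ := isCompact_Icc.exists_bound_of_continuousOn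
    (hf.1.mono (Icc_subset_Ici_self : Icc 0 R ⊆ Ici 0))
  refine ⟨max B 1, ?_⟩
  rintro _ ⟨⟨x, hx⟩, rfl⟩
  rcases le_total x R with h | h
  · exact (hB x ⟨hx, h⟩).trans (le_max_left _ _)
  · exact (hR x h).le.trans (le_max_right _ _)

theorem MemCdelta.norm_le_supN {f : ℝ → ℂ} (hf : MemCdelta δ f 0) {x : ℝ} (hx : 0 ≤ x) :
    ‖f x‖ ≤ supN f :=
  le_ciSup hf.bddAbove_norm (⟨x, hx⟩ : Ici (0 : ℝ))

theorem MemCdelta.rpow_mul_norm_le_hoel {f : ℝ → ℂ} (hf : MemCdelta δ f 0) {x : ℝ} (hx : 0 < x) :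
    x ^ δ * ‖f x‖ ≤ hoel δ f 0 := by
  simpa [hoel] using le_ciSup hf.2.2 (⟨x, hx⟩ : Ioi (0 : ℝ))

/-- The extension of an element of `𝒞^δ_0` to the line, constant on the negative axis. -/
noncomputable def MemCdelta.extend {f : ℝ → ℂ} (hf : MemCdelta δ f 0) :
    BoundedContinuousFunction ℝ ℂ :=
  BoundedContinuousFunction.ofNormedAddCommGroup (fun x => f (max x 0))
    (hf.1.comp_continuous (continuous_id.max continuous_const) fun x => le_max_right x 0)
    (supN f) fun x => hf.norm_le_supN (le_max_right x 0)

theorem MemCdelta.extend_apply {f : ℝ → ℂ} (hf : MemCdelta δ f 0) (x : ℝ) :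
    hf.extend x = f (max x 0) := rfl

theorem MemCdelta.extend_of_nonneg {f : ℝ → ℂ} (hf : MemCdelta δ f 0) {x : ℝ} (hx : 0 ≤ x) :
    hf.extend x = f x := by rw [extend_apply, max_eq_left hx]

theorem MemCdelta.supN_nonneg {f : ℝ → ℂ} (hf : MemCdelta δ f 0) : 0 ≤ supN f :=
  (norm_nonneg _).trans (hf.norm_le_supN le_rfl)

theorem MemCdelta.hoel_nonneg {f : ℝ → ℂ} (hf : MemCdelta δ f 0) : 0 ≤ hoel δ f 0 :=
  (by positivity : (0 : ℝ) ≤ 1 ^ δ * ‖f 1‖).trans (hf.rpow_mul_norm_le_hoel one_pos)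

theorem MemCdelta.norm_extend_le {f : ℝ → ℂ} (hf : MemCdelta δ f 0) : ‖hf.extend‖ ≤ supN f :=
  (BoundedContinuousFunction.norm_le hf.supN_nonneg).2 fun x =>
    hf.norm_le_supN (le_max_right x 0)

/-- A bounded continuous function with `β^δ`-weighted decay restricts to an element of `𝒞^δ_0`. -/
theorem memCdelta_of_rpow_mul_norm_le (hδ : 0 < δ) (w : BoundedContinuousFunction ℝ ℂ) {H : ℝ}
    (hH : ∀ x, 0 < x → x ^ δ * ‖w x‖ ≤ H) : MemCdelta δ w 0 ∧ normC δ w 0 ≤ ‖w‖ + H := by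
  have : Nonempty (Ici (0 : ℝ)) := ⟨⟨0, self_mem_Ici⟩⟩
  have : Nonempty (Ioi (0 : ℝ)) := ⟨⟨1, mem_Ioi.2 one_pos⟩⟩
  refine ⟨⟨w.continuous.continuousOn, ?_, H, ?_⟩, add_le_add ?_ ?_⟩
  · have hlim := (tendsto_rpow_neg_atTop hδ).const_mul H
    rw [mul_zero] at hlim
    refine squeeze_zero_norm' ?_ hlim
    filter_upwards [eventually_gt_atTop 0] with x hx
    rw [Real.rpow_neg hx.le, ← div_eq_mul_inv, le_div_iff₀ (Real.rpow_pos_of_pos hx δ), mul_comm]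
    exact hH x hx
  · rintro _ ⟨⟨x, hx⟩, rfl⟩
    simpa using hH x hx
  · exact ciSup_le fun x => w.norm_coe_le_norm x
  · exact ciSup_le fun x => by simpa using hH x x.2

/-- An equation on the open half line extends to the line. -/
theorem MemCdelta.extend_add_KnOp_eq {u v : ℝ → ℂ} (hμ : 1 < μ) (hη : IsCutoff η) (hn : n ≠ 0)
    (hu : MemCdelta δ u 0) (hv : MemCdelta δ v 0)
    (h : ∀ β, 0 < β → u β + Kn μ η n u β = v β) :
    hu.extend + KnOp μ η n hμ hη hn hu.extend = hv.extend := by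
  have hpos : EqOn (hu.extend + KnOp μ η n hμ hη hn hu.extend) hv.extend (Ioi 0) := fun x hx => by
    have hx : 0 < x := hx
    rw [BoundedContinuousFunction.add_apply, KnOp_apply, KnExt, if_pos hx,
      hu.extend_of_nonneg hx.le, hv.extend_of_nonneg hx.le, ← h x hx,
      Kn_congr hμ hη hn hx hu.extend.continuous.continuousOn
        (fun b _ => hu.extend.norm_coe_le_norm b) fun b hb => hu.extend_of_nonneg hb.le]
  have hcl := hpos.closure (BoundedContinuousFunction.continuous _) hv.extend.continuous
  rw [closure_Ioi] at hcl
  ext x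
  rcases le_total 0 x with hx | hx
  · exact hcl hx
  · have h0 := hcl (self_mem_Ici (a := (0 : ℝ)))
    rw [BoundedContinuousFunction.add_apply, KnOp_apply, KnExt] at h0 ⊢
    rw [if_neg (lt_irrefl _)] at h0
    rw [if_neg hx.not_gt, hu.extend_apply, hv.extend_apply, max_eq_right hx]
    simpa [extend_apply] using h0

end Invertibility

/-- For every `n ≠ 0`, `id + 𝒦_n` is a bijection of `𝒞^δ_0`, and the
inverse is bounded uniformly in `n`. -/
theorem stmt_18 (μ δ : ℝ) (hμ : 1 < μ)
    (hδ0 : 0 < δ)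
    (hδ1 : δ < min (Real.sqrt (4 * μ ^ 2 - 2 * μ + 1) - 2 * μ + 1) 1)
    (η : ℝ → ℝ) (hη_smooth : ContDiff ℝ (⊤ : ℕ∞) η)
    (hη_range : ∀ β, 0 ≤ η β ∧ η β ≤ 1)
    (hη0 : ∀ β : ℝ, β ≤ 1 → η β = 0) (hη1 : ∀ β : ℝ, 2 ≤ β → η β = 1) :
    ∃ C : ℝ, 0 < C ∧ ∀ n : ℤ, n ≠ 0 → ∀ v : ℝ → ℂ, MemCdelta δ v 0 →
      ∃ u : ℝ → ℂ, MemCdelta δ u 0 ∧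
        (∀ β : ℝ, 0 < β → u β + Kn μ η n u β = v β) ∧
        normC δ u 0 ≤ C * normC δ v 0 ∧
        (∀ u' : ℝ → ℂ, MemCdelta δ u' 0 →
          (∀ β : ℝ, 0 < β → u' β + Kn μ η n u' β = v β) →
          ∀ β : ℝ, 0 ≤ β → u' β = u β) := by
  have hη : IsCutoff η := ⟨hη_smooth, hη_range, hη0, hη1⟩
  obtain ⟨C₀, hC₀, hK⟩ := exists_Kn_bound hμ hη hδ0 (hδ1.trans_le (min_le_right _ _))
  obtain ⟨C, hC, hinv⟩ := exists_add_KnOp_lower_bound hμ hη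
  refine ⟨C + C₀ * C + 1, by positivity, fun n hn v hv => ?_⟩
  have hinj := eq_zero_of_add_KnOp_eq_zero hμ hη hn
  obtain ⟨w, hw⟩ := (IsCompactOperator.exists_bound_surjective_of_injective _
    (isCompactOperator_KnOp hμ hη hn) hinj).2 hv.extend
  have hwv : ∀ β : ℝ, 0 < β → w β + Kn μ η n w β = v β := fun β hβ => by
    have := congrArg (fun f => f β) hw
    simpa [KnOp_apply, KnExt, hβ, hv.extend_of_nonneg hβ.le] using this
  have hwC : ‖w‖ ≤ C * supN v := by
    refine (hinv n hn w).trans ?_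
    rw [hw]
    exact mul_le_mul_of_nonneg_left hv.norm_extend_le hC
  have hH : ∀ x, 0 < x → x ^ δ * ‖w x‖ ≤ hoel δ v 0 + C₀ * ‖w‖ := fun x hx => by
    have hp := Real.rpow_pos_of_pos hx δ
    have h1 := (hK n hn w ‖w‖ w.continuous.continuousOn (fun b _ => w.norm_coe_le_norm b) x hx).2
    have h2 : ‖Kn μ η n w x‖ ≤ C₀ * ‖w‖ * x ^ (-δ) :=
      (le_mul_of_one_le_left (norm_nonneg _) (one_le_abs_cast hn)).trans h1
    rw [Real.rpow_neg hx.le, ← div_eq_mul_inv, le_div_iff₀ hp, mul_comm] at h2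
    rw [eq_sub_of_add_eq (hwv x hx)]
    calc _ ≤ x ^ δ * (‖v x‖ + ‖Kn μ η n w x‖) := by
          gcongr
          exact norm_sub_le _ _
      _ ≤ _ := by
          rw [mul_add]
          exact add_le_add (hv.rpow_mul_norm_le_hoel hx) h2
  obtain ⟨hmem, hnorm⟩ := memCdelta_of_rpow_mul_norm_le hδ0 w hH
  refine ⟨w, hmem, hwv, hnorm.trans ?_, fun u' hu' h β hβ => ?_⟩
  · have h1 := mul_le_mul_of_nonneg_left hwC hC₀.le
    have h2 : 0 ≤ (C + C₀ * C) * hoel δ v 0 := mul_nonneg (by positivity) hv.hoel_nonneg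
    have h3 := hv.supN_nonneg
    rw [normC]
    linarith
  · have heq := hu'.extend_add_KnOp_eq hμ hη hn hv h
    have hsub := hinj (hu'.extend - w) (by
      rw [map_sub, sub_add_sub_comm, heq, hw, sub_self])
    rw [← hu'.extend_of_nonneg hβ, sub_eq_zero.1 hsub]
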